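/- arXiv:2503.22439 — 3 statements merged into one kernel-verified Lean document; each statement's English description precedes it below -/
import Mathlib

section
/- Let λ ∈ ℝ. Suppose u : [0,1] → ℂ is C¹ with x ↦ a(x)u'(x) locally Lipschitz, v : [0,1] → ℂ is C¹, and η₁, η₂, ζ₁ ∈ ℂ satisfy: v(x) = iλ u(x) for all x ∈ [0,1]; iλ v(x) = (a u')'(x) − q(x)v(x) for a.e. x ∈ (0,1); iλ η₁ = −α₁η₁ − α₂η₂ − β₁u'(1); iλ η₂ = η₁; iλ ζ₁ = −γ₁ζ₁ + μ₁u'(0); v(1) = η₁, v(0) = ζ₁ and u(1) = η₂. Then u ≡ 0, v ≡ 0 and η₁ = η₂ = ζ₁ = 0. -/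
open Set MeasureTheory

/-- Assumption (A1): `a` is Lipschitz on `[0,1]` and bounded below and above by positive
constants `a_min ≤ a_max`. -/
def AssumptionA1 (a : ℝ → ℝ) (a_min a_max : ℝ) : Prop :=
  (∃ K : NNReal, LipschitzOnWith K a (Icc (0:ℝ) 1)) ∧ 0 < a_min ∧ a_min ≤ a_max ∧
    ∀ x ∈ Icc (0:ℝ) 1, a_min ≤ a x ∧ a x ≤ a_max

/-- Assumption (A2): `q` is bounded measurable, nonnegative a.e., and bounded below by
`q_min > 0` (and above by `q_max`) a.e. on a nonempty open subinterval `ω = (c,d) ⊆ (0,1)`. -/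
def AssumptionA2 (q : ℝ → ℝ) (c d q_min q_max : ℝ) : Prop :=
  Measurable q ∧ (∃ Q : ℝ, ∀ x ∈ Icc (0:ℝ) 1, |q x| ≤ Q) ∧
    (∀ᵐ x ∂(volume.restrict (Ioo (0:ℝ) 1)), 0 ≤ q x) ∧
    0 ≤ c ∧ c < d ∧ d ≤ 1 ∧ 0 < q_min ∧ q_min ≤ q_max ∧
    ∀ᵐ x ∂(volume.restrict (Ioo c d)), q_min ≤ q x ∧ q x ≤ q_max

/-- An absolutely continuous function with a.e. nonnegative derivative does not decrease. -/
theorem AbsolutelyContinuousOnInterval.le_of_ae_hasDerivAt_nonneg {f : ℝ → ℝ} {x y : ℝ}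
    (hf : AbsolutelyContinuousOnInterval f x y) (hxy : x ≤ y)
    (h : ∀ᵐ t ∂(volume.restrict (Ioo x y)), ∃ f' : ℝ, 0 ≤ f' ∧ HasDerivAt f f' t) :
    f x ≤ f y := by
  rw [← sub_nonneg, ← hf.integral_deriv_eq_sub]
  apply intervalIntegral.integral_nonneg_of_ae_restrict hxy
  rw [← restrict_Ioo_eq_restrict_Icc]
  filter_upwards [h] with t ⟨f', hf', ht⟩
  simpa [ht.deriv] using hf'

/-- Backward Grönwall inequality: `f' ≥ -C f` a.e. bounds `f x` by a multiple of `f y`. -/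
theorem AbsolutelyContinuousOnInterval.mul_exp_le_mul_exp {f : ℝ → ℝ} {x y C : ℝ}
    (hf : AbsolutelyContinuousOnInterval f x y) (hxy : x ≤ y)
    (h : ∀ᵐ t ∂(volume.restrict (Ioo x y)), ∃ f' : ℝ, -(C * f t) ≤ f' ∧ HasDerivAt f f' t) :
    f x * Real.exp (C * x) ≤ f y * Real.exp (C * y) := by
  have hexp : AbsolutelyContinuousOnInterval (fun t => Real.exp (C * t)) x y :=
    ContDiffOn.absolutelyContinuousOnInterval (by fun_prop)
  refine (hf.fun_mul hexp).le_of_ae_hasDerivAt_nonneg hxy ?_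
  filter_upwards [h] with t ⟨f', hf', ht⟩
  have hd : HasDerivAt (fun t => Real.exp (C * t)) (Real.exp (C * t) * C) t := by
    simpa using ((hasDerivAt_id t).const_mul C).exp
  refine ⟨_, ?_, ht.fun_mul hd⟩
  have := mul_nonneg (Real.exp_pos (C * t)).le (by linarith : 0 ≤ f' + C * f t)
  linarith

/-- The squared norm of a Lipschitz function is absolutely continuous. -/
theorem LipschitzOnWith.absolutelyContinuousOnInterval_norm_sq {E : Type*}
    [SeminormedAddCommGroup E] {f : ℝ → E} {K : NNReal} {x y : ℝ}
    (hf : LipschitzOnWith K f (uIcc x y)) :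
    AbsolutelyContinuousOnInterval (fun t => ‖f t‖ ^ 2) x y := by
  have h := (lipschitzWith_one_norm.comp_lipschitzOnWith hf).absolutelyContinuousOnInterval
  simpa [Function.comp_def, pow_two] using h.fun_mul h

/-- Backward uniqueness for a linear system of two coupled Lipschitz functions. -/
theorem eq_zero_of_ae_norm_deriv_le {E F : Type*} [NormedAddCommGroup E] [InnerProductSpace ℝ E]
    [NormedAddCommGroup F] [InnerProductSpace ℝ F] {f f' : ℝ → E} {g g' : ℝ → F} {x y M : ℝ}
    {K L : NNReal} (hf : LipschitzOnWith K f (Icc x y)) (hg : LipschitzOnWith L g (Icc x y))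
    (h : ∀ᵐ t ∂(volume.restrict (Ioo x y)), HasDerivAt f (f' t) t ∧ HasDerivAt g (g' t) t ∧
      ‖f' t‖ ≤ M * ‖g t‖ ∧ ‖g' t‖ ≤ M * ‖f t‖)
    (hM : 0 ≤ M) (hfy : f y = 0) (hgy : g y = 0) {t : ℝ} (ht : t ∈ Icc x y) : f t = 0 := by
  have hsub : uIcc t y ⊆ Icc x y := by
    rw [uIcc_of_le ht.2]
    exact Icc_subset_Icc_left ht.1
  have hac := (hf.mono hsub).absolutelyContinuousOnInterval_norm_sq.fun_add
    (hg.mono hsub).absolutelyContinuousOnInterval_norm_sq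
  have key := hac.mul_exp_le_mul_exp (C := 2 * M) ht.2 (by
    filter_upwards [ae_restrict_of_ae_restrict_of_subset (Ioo_subset_Ioo_left ht.1) h]
      with s ⟨h1, h2, h3, h4⟩
    refine ⟨_, ?_, h1.norm_sq.fun_add h2.norm_sq⟩
    have i1 := neg_le_of_abs_le (abs_real_inner_le_norm (f s) (f' s))
    have i2 := neg_le_of_abs_le (abs_real_inner_le_norm (g s) (g' s))
    have j1 := mul_le_mul_of_nonneg_left h3 (norm_nonneg (f s))
    have j2 := mul_le_mul_of_nonneg_left h4 (norm_nonneg (g s))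
    have := mul_nonneg hM (sq_nonneg (‖f s‖ - ‖g s‖))
    nlinarith)
  simp only [hfy, hgy, norm_zero, ne_eq, OfNat.ofNat_ne_zero, not_false_eq_true, zero_pow,
    add_zero, zero_mul] at key
  have := nonpos_of_mul_nonpos_left key (Real.exp_pos _)
  have : ‖f t‖ ^ 2 = 0 := by nlinarith [sq_nonneg ‖f t‖, sq_nonneg ‖g t‖]
  simpa using this

/-- A function with continuous derivative on a compact interval is Lipschitz there. -/
theorem exists_lipschitzOnWith_of_hasDerivAt {E : Type*} [NormedAddCommGroup E] [NormedSpace ℝ E]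
    {f f' : ℝ → E} {x y : ℝ} (hf : ∀ t ∈ Icc x y, HasDerivAt f (f' t) t)
    (hf' : ContinuousOn f' (Icc x y)) : ∃ K : NNReal, LipschitzOnWith K f (Icc x y) := by
  obtain ⟨C, hC⟩ := isCompact_Icc.exists_bound_of_continuousOn hf'
  refine ⟨C.toNNReal, (convex_Icc x y).lipschitzOnWith_of_nnnorm_hasDerivWithin_le
    (fun t ht => (hf t ht).hasDerivWithinAt) fun t ht => ?_⟩
  rw [← NNReal.coe_le_coe, coe_nnnorm]
  exact (hC t ht).trans (Real.le_coe_toNNReal C)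

/-- For Lipschitz `f`, `g`, the function `Re (c (conj f) g)` does not decrease if its derivative
is a.e. nonnegative. -/
theorem re_mul_star_mul_le_of_ae_nonneg {f f' g g' : ℝ → ℂ} {x y : ℝ} {K L : NNReal} (c : ℂ)
    (hxy : x ≤ y) (hf : LipschitzOnWith K f (Icc x y)) (hg : LipschitzOnWith L g (Icc x y))
    (h : ∀ᵐ t ∂(volume.restrict (Ioo x y)), HasDerivAt f (f' t) t ∧ HasDerivAt g (g' t) t ∧
      0 ≤ (c * (star (f' t) * g t + star (f t) * g' t)).re) :
    (c * (star (f x) * g x)).re ≤ (c * (star (f y) * g y)).re := by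
  rw [← uIcc_of_le hxy] at hf hg
  have hre : LipschitzWith 1 Complex.re := RCLike.lipschitzWith_re (K := ℂ)
  have him : LipschitzWith 1 Complex.im := RCLike.lipschitzWith_im (K := ℂ)
  have f1 := (hre.comp_lipschitzOnWith hf).absolutelyContinuousOnInterval
  have f2 := (him.comp_lipschitzOnWith hf).absolutelyContinuousOnInterval
  have g1 := (hre.comp_lipschitzOnWith hg).absolutelyContinuousOnInterval
  have g2 := (him.comp_lipschitzOnWith hg).absolutelyContinuousOnInterval
  have hac := (((f1.fun_mul g1).fun_add (f2.fun_mul g2)).const_mul c.re).fun_sub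
    (((f1.fun_mul g2).fun_sub (f2.fun_mul g1)).const_mul c.im)
  have heq : (fun t => (c * (star (f t) * g t)).re) = fun t =>
      c.re * ((f t).re * (g t).re + (f t).im * (g t).im)
        - c.im * ((f t).re * (g t).im - (f t).im * (g t).re) := by
    funext t
    simp only [Complex.star_def, Complex.mul_re, Complex.mul_im, Complex.conj_re, Complex.conj_im]
    ring
  have hac' : AbsolutelyContinuousOnInterval (fun t => (c * (star (f t) * g t)).re) x y := by
    rw [heq]
    exact hac
  refine hac'.le_of_ae_hasDerivAt_nonneg hxy ?_
  filter_upwards [h] with t ⟨h1, h2, h3⟩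
  exact ⟨_, h3, Complex.reCLM.hasFDerivAt.comp_hasDerivAt t
    ((h1.star.fun_mul h2).const_mul c)⟩

/-- No eigenvalues on the imaginary axis: if `(u, v, η₁, η₂, ζ₁)` solves the eigenvalue problem
`𝒜U = iλU` (with `U` in the domain of the operator), then `U = 0`. -/
theorem no_imaginary_eigenvalues (a q : ℝ → ℝ)
    (a_min a_max c d q_min q_max α₁ α₂ β₁ γ₁ μ₁ : ℝ)
    (hA1 : AssumptionA1 a a_min a_max) (hA2 : AssumptionA2 q c d q_min q_max)
    (hα₁ : 0 < α₁) (hα₂ : 0 < α₂) (hβ₁ : 0 < β₁) (hγ₁ : 0 < γ₁) (hμ₁ : 0 < μ₁)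
    (lam : ℝ) (u u' v v' w : ℝ → ℂ) (η₁ η₂ ζ₁ : ℂ)
    (hu : ∀ x ∈ Icc (0:ℝ) 1, HasDerivAt u (u' x) x) (hu' : ContinuousOn u' (Icc (0:ℝ) 1))
    (hlip : ∃ K : NNReal, LipschitzOnWith K (fun x => (a x : ℂ) * u' x) (Icc (0:ℝ) 1))
    (hw : ∀ᵐ x ∂(volume.restrict (Ioo (0:ℝ) 1)),
      HasDerivAt (fun y => (a y : ℂ) * u' y) (w x) x)
    (hv : ∀ x ∈ Icc (0:ℝ) 1, HasDerivAt v (v' x) x) (hv' : ContinuousOn v' (Icc (0:ℝ) 1))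
    (heq_v : ∀ x ∈ Icc (0:ℝ) 1, v x = Complex.I * (lam : ℂ) * u x)
    (heq_pde : ∀ᵐ x ∂(volume.restrict (Ioo (0:ℝ) 1)),
      Complex.I * (lam : ℂ) * v x = w x - (q x : ℂ) * v x)
    (heq1 : Complex.I * (lam : ℂ) * η₁
      = -(α₁ : ℂ) * η₁ - (α₂ : ℂ) * η₂ - (β₁ : ℂ) * u' 1)
    (heq2 : Complex.I * (lam : ℂ) * η₂ = η₁)
    (heq3 : Complex.I * (lam : ℂ) * ζ₁ = -(γ₁ : ℂ) * ζ₁ + (μ₁ : ℂ) * u' 0)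
    (hv1 : v 1 = η₁) (hv0 : v 0 = ζ₁) (hu1 : u 1 = η₂) :
    (∀ x ∈ Icc (0:ℝ) 1, u x = 0 ∧ v x = 0) ∧ η₁ = 0 ∧ η₂ = 0 ∧ ζ₁ = 0 := by
  obtain ⟨-, ha0, -, ha⟩ := hA1
  obtain ⟨-, ⟨Q, hQ⟩, hq0, -⟩ := hA2
  obtain ⟨L, hL⟩ := hlip
  obtain ⟨K, hK⟩ := exists_lipschitzOnWith_of_hasDerivAt hu hu'
  have m0 : (0:ℝ) ∈ Icc (0:ℝ) 1 := by simp
  have m1 : (1:ℝ) ∈ Icc (0:ℝ) 1 := by simp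
  have hw' : ∀ᵐ x ∂(volume.restrict (Ioo (0:ℝ) 1)), x ∈ Icc (0:ℝ) 1 ∧ 0 ≤ q x ∧
      HasDerivAt (fun y => (a y : ℂ) * u' y) (w x) x ∧
      w x = (-(lam:ℂ) ^ 2 + Complex.I * lam * q x) * u x := by
    filter_upwards [hw, heq_pde, hq0, ae_restrict_mem measurableSet_Ioo] with x h1 h2 h3 h4
    have h5 := Ioo_subset_Icc_self h4
    refine ⟨h5, h3, h1, ?_⟩
    rw [heq_v x h5] at h2
    linear_combination -h2 + (lam:ℂ) ^ 2 * u x * Complex.I_sq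
  have hη₁ : η₁ = Complex.I * lam * u 1 := by rw [← hv1, heq_v 1 m1]
  have hζ₁ : ζ₁ = Complex.I * lam * u 0 := by rw [← hv0, heq_v 0 m0]
  have hu'1 : u' 1 = (lam ^ 2 - Complex.I * lam * α₁ - α₂) / β₁ * u 1 := by
    have : (β₁:ℂ) ≠ 0 := by exact_mod_cast hβ₁.ne'
    rw [← hu1, hη₁] at heq1
    field_simp
    linear_combination heq1 - (lam:ℂ) ^ 2 * u 1 * Complex.I_sq
  have hu'0 : u' 0 = (-lam ^ 2 + Complex.I * lam * γ₁) / μ₁ * u 0 := by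
    have : (μ₁:ℂ) ≠ 0 := by exact_mod_cast hμ₁.ne'
    rw [hζ₁] at heq3
    field_simp
    linear_combination -heq3 + (lam:ℂ) ^ 2 * u 0 * Complex.I_sq
  have ha0' := ha0.trans_le (ha 0 m0).1
  have ha1' := ha0.trans_le (ha 1 m1).1
  have hu1z : u 1 = 0 := by
    have boundary : ∀ (z c s : ℂ) (b k : ℝ), c * (star z * (b * (s / k * z)))
        = c * s * ((b / k * Complex.normSq z : ℝ) : ℂ) := fun z c s b k => by
      push_cast
      rw [Complex.normSq_eq_conj_mul_self]
      simp only [Complex.star_def]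
      ring
    have fin : ∀ k : ℝ, 0 < k → 0 ≤ -(k * Complex.normSq (u 1)) → u 1 = 0 := fun k hk h => by
      rw [← Complex.normSq_eq_zero]
      nlinarith [Complex.normSq_nonneg (u 1)]
    by_cases hlam : lam = 0
    · subst hlam
      have key := re_mul_star_mul_le_of_ae_nonneg 1 zero_le_one hK hL (by
        filter_upwards [hw'] with x ⟨h1, h2, h3, h4⟩
        refine ⟨hu x h1, h3, ?_⟩
        have := mul_nonneg (ha0.le.trans (ha x h1).1) (Complex.normSq_nonneg (u' x))
        simp [h4, Complex.normSq_apply] at this ⊢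
        linarith)
      refine fin (α₂ * (a 1 / β₁)) (by positivity) ?_
      rw [hu'1, hu'0, boundary, boundary, Complex.re_mul_ofReal, Complex.re_mul_ofReal] at key
      simp at key
      linarith
    · have key := re_mul_star_mul_le_of_ae_nonneg (-(Complex.I * lam)) zero_le_one hK hL (by
        filter_upwards [hw'] with x ⟨h1, h2, h3, h4⟩
        refine ⟨hu x h1, h3, ?_⟩
        have := mul_nonneg (mul_nonneg (sq_nonneg lam) h2) (Complex.normSq_nonneg (u x))
        simp [h4, Complex.normSq_apply, pow_two] at this ⊢
        linarith)
      refine fin (lam ^ 2 * α₁ * (a 1 / β₁)) (by positivity) ?_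
      have := mul_nonneg (by positivity : 0 ≤ lam ^ 2 * γ₁ * (a 0 / μ₁))
        (Complex.normSq_nonneg (u 0))
      rw [hu'1, hu'0, boundary, boundary, Complex.re_mul_ofReal, Complex.re_mul_ofReal] at key
      simp [pow_two] at key
      linarith
  have hu'1z : u' 1 = 0 := by rw [hu'1, hu1z, mul_zero]
  have hall : ∀ x ∈ Icc (0:ℝ) 1, u x = 0 := fun x hx => by
    have hQ0 : 0 ≤ Q := (abs_nonneg _).trans (hQ 0 m0)
    refine eq_zero_of_ae_norm_deriv_le (f' := u') (g' := w)
      (M := a_min⁻¹ + (lam ^ 2 + |lam| * Q)) hK hL ?_ (by positivity) hu1z (by simp [hu'1z]) hx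
    filter_upwards [hw'] with t ⟨h1, h2, h3, h4⟩
    refine ⟨hu t h1, h3, ?_, ?_⟩
    · have hat := (ha t h1).1
      have : ‖(a t : ℂ) * u' t‖ = a t * ‖u' t‖ := by
        rw [norm_mul, Complex.norm_of_nonneg (ha0.le.trans hat)]
      rw [this]
      calc ‖u' t‖ = a_min⁻¹ * (a_min * ‖u' t‖) := by field_simp
        _ ≤ (a_min⁻¹ + (lam ^ 2 + |lam| * Q)) * (a t * ‖u' t‖) := by
          gcongr
          exact le_add_of_nonneg_right (by positivity)
    · rw [h4, norm_mul]
      gcongr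
      calc _ ≤ ‖-(lam:ℂ) ^ 2‖ + ‖Complex.I * lam * q t‖ := norm_add_le _ _
        _ = lam ^ 2 + |lam| * |q t| := by simp
        _ ≤ lam ^ 2 + |lam| * Q := by gcongr; exact hQ t h1
        _ ≤ _ := le_add_of_nonneg_left (by positivity)
  refine ⟨fun x hx => ⟨hall x hx, ?_⟩, ?_, ?_, ?_⟩
  · rw [heq_v x hx, hall x hx, mul_zero]
  · rw [hη₁, hu1z, mul_zero]
  · rw [← hu1, hu1z]
  · rw [hζ₁, hall 0 m0, mul_zero]
end

section
/- There exists a constant C > 0 with the following property. For every λ ∈ ℝ, every u : [0,1] → ℂ which is C¹ with x ↦ a(x)u'(x) locally Lipschitz, every C¹ function v : [0,1] → ℂ, and every η₁, η₂, ζ₁ ∈ ℂ with v(1) = η₁, v(0) = ζ₁ and u(1) = η₂, define the residuals f = iλu − v (a C¹ function on [0,1]), g(x) = iλv(x) − (au')'(x) + q(x)v(x) (defined for a.e. x), k₁ = iλη₁ + α₁η₁ + α₂η₂ + β₁u'(1), k₂ = iλη₂ − η₁, k₃ = iλζ₁ + γ₁ζ₁ − μ₁u'(0). Then ∫₀¹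 a|u'|² dx + ∫₀¹ |v|² dx + c₁|η₁|² + c₂|η₂|² + c₃|ζ₁|² ≤ C ( ∫₀¹ a|f'|² dx + ∫₀¹ |g|² dx + c₁|k₁|² + c₂|k₂|² + c₃|k₃|² ), where c₁ = a(1)/β₁, c₂ = a(1)α₂/β₁ and c₃ = a(0)/μ₁. -/
open Set MeasureTheory

/-- An absolutely continuous function whose a.e. derivative is at most `B` grows by at most the
integral of `B`. -/
lemma AbsolutelyContinuousOnInterval.sub_le_integral_of_ae_hasDerivAt_le {F F' B : ℝ → ℝ}
    {x y : ℝ} (hF : AbsolutelyContinuousOnInterval F x y) (hxy : x ≤ y)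
    (hd : ∀ᵐ t ∂volume.restrict (Ioo x y), HasDerivAt F (F' t) t ∧ F' t ≤ B t)
    (hB : IntervalIntegrable B volume x y) : F y - F x ≤ ∫ t in x..y, B t := by
  rw [← hF.integral_deriv_eq_sub]
  refine intervalIntegral.integral_mono_ae_restrict hxy hF.intervalIntegrable_deriv hB ?_
  rw [← restrict_Ioo_eq_restrict_Icc]
  filter_upwards [hd] with t ht
  rw [ht.1.deriv]
  exact ht.2

/-- Restricting an almost everywhere statement on `(0,1)` to a subinterval. -/
lemma ae_restrict_Ioo_of_subinterval {P : ℝ → Prop} {x y : ℝ} (hx : 0 ≤ x) (hy : y ≤ 1)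
    (h : ∀ᵐ t ∂volume.restrict (Ioo (0 : ℝ) 1), P t) :
    ∀ᵐ t ∂volume.restrict (Ioo x y), P t :=
  ae_mono (Measure.restrict_mono (Ioo_subset_Ioo hx hy) le_rfl) h

lemma uIcc_subset_unit {x y : ℝ} (hx : x ∈ Icc (0 : ℝ) 1) (hy : y ∈ Icc (0 : ℝ) 1) :
    uIcc x y ⊆ uIcc 0 1 :=
  uIcc_subset_uIcc (by simpa using hx) (by simpa using hy)

/-- A two-sided Gronwall estimate on `[0,1]`. -/
lemma le_exp_mul_add_integral_of_abs_deriv_le {F F' n : ℝ → ℝ} {K : ℝ} (hK : 0 ≤ K)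
    (hF : AbsolutelyContinuousOnInterval F 0 1) (hn : IntervalIntegrable n volume 0 1)
    (hn0 : ∀ x ∈ Icc (0 : ℝ) 1, 0 ≤ n x)
    (hd : ∀ᵐ t ∂volume.restrict (Ioo (0 : ℝ) 1),
      HasDerivAt F (F' t) t ∧ |F' t| ≤ K * F t + n t)
    {x y : ℝ} (hx : x ∈ Icc (0 : ℝ) 1) (hy : y ∈ Icc (0 : ℝ) 1) (hFx : 0 ≤ F x) (hFy : 0 ≤ F y) :
    F y ≤ Real.exp K * (F x + ∫ t in (0 : ℝ)..1, n t) := by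
  have hae (P Q : ℝ) (hP : 0 ≤ P) (hPQ : P ≤ Q) (hQ : Q ≤ 1) :
      IntervalIntegrable n volume P Q ∧ ∫ t in P..Q, n t ≤ ∫ t in (0 : ℝ)..1, n t := by
    refine ⟨hn.mono_set (uIcc_subset_unit ⟨hP, hPQ.trans hQ⟩ ⟨hP.trans hPQ, hQ⟩), ?_⟩
    refine intervalIntegral.integral_mono_interval hP hPQ hQ ?_ hn
    filter_upwards [ae_restrict_mem measurableSet_Ioc] with t ht
    exact hn0 t ⟨ht.1.le, ht.2⟩
  have hexp (s : ℝ) : AbsolutelyContinuousOnInterval (fun t => Real.exp (s * t)) 0 1 := by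
    refine ContDiffOn.absolutelyContinuousOnInterval (ContDiff.contDiffOn ?_)
    fun_prop
  have hexpd (s t : ℝ) : HasDerivAt (fun t => Real.exp (s * t)) (Real.exp (s * t) * s) t := by
    simpa using ((hasDerivAt_id t).const_mul s).exp
  set N := ∫ t in (0 : ℝ)..1, n t
  have hN : 0 ≤ N := intervalIntegral.integral_nonneg zero_le_one hn0
  have hE1 : 1 ≤ Real.exp K := Real.one_le_exp hK
  rcases le_total x y with hxy | hxy
  · obtain ⟨hi, hl⟩ := hae x y hx.1 hxy hy.2
    have key := AbsolutelyContinuousOnInterval.sub_le_integral_of_ae_hasDerivAt_le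
      (F := fun t => Real.exp (-K * t) * F t)
      (F' := fun t => Real.exp (-K * t) * -K * F t + Real.exp (-K * t) * F' t) (B := n)
      (((hexp (-K)).fun_mul hF).mono (uIcc_subset_unit hx hy)) hxy (by
        filter_upwards [ae_restrict_Ioo_of_subinterval hx.1 hy.2 hd,
          ae_restrict_mem measurableSet_Ioo] with t ht htm
        refine ⟨(hexpd (-K) t).mul ht.1, ?_⟩
        have ht0 : 0 ≤ t := hx.1.trans htm.1.le
        have h1 : Real.exp (-K * t) ≤ 1 := Real.exp_le_one_iff.2 (by nlinarith)
        have h2 := Real.exp_pos (-K * t)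
        have h3 := (abs_le.1 ht.2).2
        have h4 := hn0 t ⟨ht0, htm.2.le.trans hy.2⟩
        nlinarith [mul_le_mul_of_nonneg_left h3 h2.le]) hi
    have e1 : Real.exp K * Real.exp (-K * y) ≥ 1 := by
      rw [← Real.exp_add]; exact Real.one_le_exp (by nlinarith [hy.2])
    have e2 : Real.exp (-K * x) ≤ 1 := Real.exp_le_one_iff.2 (by nlinarith [hx.1])
    have e3 : Real.exp (-K * y) * F y ≤ F x + N := by
      nlinarith
    nlinarith [mul_le_mul_of_nonneg_left e3 (Real.exp_pos K).le]
  · obtain ⟨hi, hl⟩ := hae y x hy.1 hxy hx.2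
    have key := AbsolutelyContinuousOnInterval.sub_le_integral_of_ae_hasDerivAt_le
      (F := fun t => -(Real.exp (K * t) * F t))
      (F' := fun t => -(Real.exp (K * t) * K * F t + Real.exp (K * t) * F' t))
      (B := fun t => Real.exp K * n t)
      (((hexp K).fun_mul hF).mono (uIcc_subset_unit hy hx)).fun_neg hxy (by
        filter_upwards [ae_restrict_Ioo_of_subinterval hy.1 hx.2 hd,
          ae_restrict_mem measurableSet_Ioo] with t ht htm
        refine ⟨((hexpd K t).mul ht.1).neg, ?_⟩
        have ht1 : t ≤ 1 := htm.2.le.trans hx.2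
        have h1 : Real.exp (K * t) ≤ Real.exp K := Real.exp_le_exp.2 (by nlinarith)
        have h2 := Real.exp_pos (K * t)
        have h3 := (abs_le.1 ht.2).1
        have h4 := hn0 t ⟨hy.1.trans htm.1.le, ht1⟩
        nlinarith [mul_le_mul_of_nonneg_left h3 h2.le]) (hi.const_mul _)
    rw [intervalIntegral.integral_const_mul] at key
    have e1 : 1 ≤ Real.exp (K * y) := Real.one_le_exp (mul_nonneg hK hy.1)
    have e2 : Real.exp (K * x) ≤ Real.exp K := Real.exp_le_exp.2 (by nlinarith [hx.2])
    nlinarith [mul_le_mul_of_nonneg_left hl (Real.exp_pos K).le,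
      mul_le_mul_of_nonneg_right e2 hFx, mul_le_mul_of_nonneg_right e1 hFy]

lemma mul_le_eps_sq_add {ε : ℝ} (hε : 0 < ε) (x y : ℝ) :
    x * y ≤ ε * y ^ 2 + x ^ 2 / (4 * ε) := by
  have h : ε * y ^ 2 + x ^ 2 / (4 * ε) - x * y = (2 * ε * y - x) ^ 2 / (4 * ε) := by
    field_simp
    ring
  have : 0 ≤ (2 * ε * y - x) ^ 2 / (4 * ε) := by positivity
  linarith

lemma inner_le_eps_sq_add {ε : ℝ} (hε : 0 < ε) (x y : ℂ) :
    inner ℝ x y ≤ ε * ‖y‖ ^ 2 + ‖x‖ ^ 2 / (4 * ε) :=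
  (real_inner_le_norm x y).trans (mul_le_eps_sq_add hε _ _)

section Pointwise

variable (a q l : ℝ) (U V V' W : ℂ)

lemma inner_flux_add_inner_velocity :
    inner ℝ ((a : ℂ) * U) W + a * inner ℝ V V' =
      q * inner ℝ ((a : ℂ) * U) V
        - inner ℝ ((a : ℂ) * U) (Complex.I * l * V - W + q * V)
        - a * inner ℝ V (Complex.I * l * U - V') := by
  simp [Complex.inner]
  ring

lemma inner_flux_velocity_deriv :
    inner ℝ ((a : ℂ) * U) V' + inner ℝ W V =
      q * ‖V‖ ^ 2 - inner ℝ (Complex.I * l * V - W + q * V) V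
        - a * inner ℝ U (Complex.I * l * U - V') := by
  simp [Complex.inner, Complex.sq_norm, Complex.normSq_apply]
  ring

lemma inner_I_flux_velocity_deriv :
    inner ℝ (Complex.I * ((a : ℂ) * U)) V' + inner ℝ (Complex.I * W) V =
      l * (a * ‖U‖ ^ 2 - ‖V‖ ^ 2)
        - inner ℝ (Complex.I * (Complex.I * l * V - W + q * V)) V
        - a * inner ℝ (Complex.I * U) (Complex.I * l * U - V') := by
  simp [Complex.inner, Complex.sq_norm, Complex.normSq_apply]
  ring

end Pointwise
/-- The regularity of `(u', v)` for an element of the domain of the wave operator: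
`u'` and `v' = dv/dx` are continuous, the flux `a u'` is Lipschitz with a.e. derivative `w`. -/
structure WaveState (a : ℝ → ℝ) (u' v v' w : ℝ → ℂ) : Prop where
  continuousOn_u' : ContinuousOn u' (Icc (0 : ℝ) 1)
  lipschitz_flux : ∃ K : NNReal, LipschitzOnWith K (fun x => (a x : ℂ) * u' x) (Icc (0 : ℝ) 1)
  hasDerivAt_flux : ∀ᵐ x ∂(volume.restrict (Ioo (0 : ℝ) 1)),
    HasDerivAt (fun y => (a y : ℂ) * u' y) (w x) x
  hasDerivAt_v : ∀ x ∈ Icc (0 : ℝ) 1, HasDerivAt v (v' x) x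
  continuousOn_v' : ContinuousOn v' (Icc (0 : ℝ) 1)

/-- The density `a |f'|² + |g|²` of the interior part of the squared residual norm. -/
noncomputable def forcingDensity (a q : ℝ → ℝ) (lam : ℝ) (u' v v' w : ℝ → ℂ) (x : ℝ) : ℝ :=
  a x * ‖Complex.I * (lam : ℂ) * u' x - v' x‖ ^ 2
    + ‖Complex.I * (lam : ℂ) * v x - w x + (q x : ℂ) * v x‖ ^ 2

/-- The density `a |u'|² + |v|²` of the interior energy. -/
noncomputable def energyDensity (a : ℝ → ℝ) (u' v : ℝ → ℂ) (x : ℝ) : ℝ :=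
  a x * ‖u' x‖ ^ 2 + ‖v x‖ ^ 2

/-- The rescaled pointwise energy `|a u'|² + a |v|²`. -/
noncomputable def fluxEnergy (a : ℝ → ℝ) (u' v : ℝ → ℂ) (x : ℝ) : ℝ :=
  ‖(a x : ℂ) * u' x‖ ^ 2 + a x * ‖v x‖ ^ 2

lemma fluxEnergy_eq_mul_energyDensity (a : ℝ → ℝ) (u' v : ℝ → ℂ) (x : ℝ) :
    fluxEnergy a u' v x = a x * energyDensity a u' v x := by
  simp only [fluxEnergy, energyDensity, norm_mul, Complex.norm_real, Real.norm_eq_abs, mul_pow,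
    sq_abs]
  ring

lemma AbsolutelyContinuousOnInterval.re {f : ℝ → ℂ} {x y : ℝ}
    (hf : AbsolutelyContinuousOnInterval f x y) :
    AbsolutelyContinuousOnInterval (fun t => (f t).re) x y := by
  refine squeeze_zero (fun E => Finset.sum_nonneg fun _ _ => dist_nonneg)
    (fun E => Finset.sum_le_sum fun i _ => ?_) hf
  rw [Real.dist_eq, Complex.dist_eq, ← Complex.sub_re]
  exact Complex.abs_re_le_norm _

lemma AbsolutelyContinuousOnInterval.im {f : ℝ → ℂ} {x y : ℝ}
    (hf : AbsolutelyContinuousOnInterval f x y) :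
    AbsolutelyContinuousOnInterval (fun t => (f t).im) x y := by
  refine squeeze_zero (fun E => Finset.sum_nonneg fun _ _ => dist_nonneg)
    (fun E => Finset.sum_le_sum fun i _ => ?_) hf
  rw [Real.dist_eq, Complex.dist_eq, ← Complex.sub_im]
  exact Complex.abs_im_le_norm _

lemma AbsolutelyContinuousOnInterval.complex_inner {f g : ℝ → ℂ} {x y : ℝ}
    (hf : AbsolutelyContinuousOnInterval f x y) (hg : AbsolutelyContinuousOnInterval g x y) :
    AbsolutelyContinuousOnInterval (fun t => inner ℝ (f t) (g t)) x y := by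
  have h := (hf.re.fun_mul hg.re).fun_add (hf.im.fun_mul hg.im)
  have heq : (fun t => inner ℝ (f t) (g t)) =
      fun t => (f t).re * (g t).re + (f t).im * (g t).im := by
    funext t
    simp [Complex.inner]
    ring
  rwa [heq]

namespace WaveState

variable {a q : ℝ → ℝ} {a_min a_max c d q_min q_max lam : ℝ} {u' v v' w : ℝ → ℂ}

lemma absolutelyContinuous_flux (h : WaveState a u' v v' w) :
    AbsolutelyContinuousOnInterval (fun x => (a x : ℂ) * u' x) 0 1 := by
  obtain ⟨K, hK⟩ := h.lipschitz_flux
  rw [← uIcc_of_le zero_le_one] at hK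
  exact hK.absolutelyContinuousOnInterval

lemma continuousOn_v (h : WaveState a u' v v' w) : ContinuousOn v (Icc (0 : ℝ) 1) :=
  fun x hx => (h.hasDerivAt_v x hx).continuousAt.continuousWithinAt

lemma absolutelyContinuous_v (h : WaveState a u' v v' w) :
    AbsolutelyContinuousOnInterval v 0 1 := by
  obtain ⟨C, hC⟩ := isCompact_Icc.exists_bound_of_continuousOn h.continuousOn_v'
  have hC0 : 0 ≤ C := (norm_nonneg _).trans (hC 0 (by simp))
  have hK : LipschitzOnWith ⟨C, hC0⟩ v (Icc (0 : ℝ) 1) :=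
    (convex_Icc 0 1).lipschitzOnWith_of_nnnorm_hasDerivWithin_le
      (fun x hx => (h.hasDerivAt_v x hx).hasDerivWithinAt) (fun x hx => hC x hx)
  rw [← uIcc_of_le zero_le_one] at hK
  exact hK.absolutelyContinuousOnInterval

lemma continuousOn_coeff (hA1 : AssumptionA1 a a_min a_max) : ContinuousOn a (Icc (0 : ℝ) 1) :=
  let ⟨⟨_, hK⟩, _⟩ := hA1
  hK.continuousOn

lemma absolutelyContinuous_fluxEnergy (hA1 : AssumptionA1 a a_min a_max)
    (h : WaveState a u' v v' w) :
    AbsolutelyContinuousOnInterval (fluxEnergy a u' v) 0 1 := by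
  obtain ⟨⟨K, hK⟩, -⟩ := hA1
  rw [← uIcc_of_le zero_le_one] at hK
  have h1 := h.absolutelyContinuous_flux.complex_inner h.absolutelyContinuous_flux
  have h2 := h.absolutelyContinuous_v.complex_inner h.absolutelyContinuous_v
  have h3 := h1.fun_add (hK.absolutelyContinuousOnInterval.fun_mul h2)
  have heq : fluxEnergy a u' v = fun t => inner ℝ ((a t : ℂ) * u' t) ((a t : ℂ) * u' t)
      + a t * inner ℝ (v t) (v t) := by
    funext t
    rw [fluxEnergy, real_inner_self_eq_norm_sq, real_inner_self_eq_norm_sq]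
  rwa [heq]

lemma intervalIntegrable_of_continuousOn {f : ℝ → ℝ} (hf : ContinuousOn f (Icc (0 : ℝ) 1)) :
    IntervalIntegrable f volume 0 1 :=
  ContinuousOn.intervalIntegrable (by rwa [uIcc_of_le zero_le_one])

lemma intervalIntegrable_u' (hA1 : AssumptionA1 a a_min a_max) (h : WaveState a u' v v' w) :
    IntervalIntegrable (fun x => a x * ‖u' x‖ ^ 2) volume 0 1 :=
  intervalIntegrable_of_continuousOn
    ((continuousOn_coeff hA1).mul (h.continuousOn_u'.norm.pow 2))

lemma intervalIntegrable_v (h : WaveState a u' v v' w) :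
    IntervalIntegrable (fun x => ‖v x‖ ^ 2) volume 0 1 :=
  intervalIntegrable_of_continuousOn (h.continuousOn_v.norm.pow 2)

lemma intervalIntegrable_potential (hA2 : AssumptionA2 q c d q_min q_max)
    (h : WaveState a u' v v' w) :
    IntervalIntegrable (fun x => q x * ‖v x‖ ^ 2) volume 0 1 := by
  obtain ⟨hq, ⟨Q, hQ⟩, -⟩ := hA2
  have := h.intervalIntegrable_v
  rw [intervalIntegrable_iff] at this ⊢
  refine this.bdd_mul (c := Q) hq.aestronglyMeasurable ?_
  filter_upwards [ae_restrict_mem measurableSet_uIoc] with x hx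
  rw [uIoc_of_le zero_le_one] at hx
  exact hQ x ⟨hx.1.le, hx.2⟩

lemma intervalIntegrable_f' (hA1 : AssumptionA1 a a_min a_max) (h : WaveState a u' v v' w) :
    IntervalIntegrable (fun x => a x * ‖Complex.I * (lam : ℂ) * u' x - v' x‖ ^ 2) volume 0 1 :=
  intervalIntegrable_of_continuousOn ((continuousOn_coeff hA1).mul
    (((continuousOn_const.mul h.continuousOn_u').sub h.continuousOn_v').norm.pow 2))

lemma memLp_w (h : WaveState a u' v v' w) : MemLp w ⊤ (volume.restrict (Ioo (0 : ℝ) 1)) := by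
  obtain ⟨K, hK⟩ := h.lipschitz_flux
  have hw : deriv (fun y => (a y : ℂ) * u' y) =ᵐ[volume.restrict (Ioo (0 : ℝ) 1)] w := by
    filter_upwards [h.hasDerivAt_flux] with x hx using hx.deriv
  refine memLp_top_of_bound ((aestronglyMeasurable_deriv _ _).congr hw) (K : ℝ) ?_
  filter_upwards [hw, ae_restrict_mem measurableSet_Ioo] with x hx hxm
  rw [← hx]
  exact norm_deriv_le_of_lipschitzOn (Icc_mem_nhds hxm.1 hxm.2) hK

lemma memLp_v (h : WaveState a u' v v' w) : MemLp v ⊤ (volume.restrict (Ioo (0 : ℝ) 1)) := by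
  obtain ⟨C, hC⟩ := isCompact_Icc.exists_bound_of_continuousOn h.continuousOn_v
  refine memLp_top_of_bound
    ((h.continuousOn_v.mono Ioo_subset_Icc_self).aestronglyMeasurable measurableSet_Ioo) C ?_
  filter_upwards [ae_restrict_mem measurableSet_Ioo] with x hx
  exact hC x ⟨hx.1.le, hx.2.le⟩

lemma intervalIntegrable_g (hA2 : AssumptionA2 q c d q_min q_max) (h : WaveState a u' v v' w) :
    IntervalIntegrable (fun x => ‖Complex.I * (lam : ℂ) * v x - w x + (q x : ℂ) * v x‖ ^ 2)
      volume 0 1 := by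
  obtain ⟨hq, ⟨Q, hQ⟩, -⟩ := hA2
  have hq' : MemLp (fun x => (q x : ℂ)) ⊤ (volume.restrict (Ioo (0 : ℝ) 1)) := by
    refine memLp_top_of_bound (Complex.measurable_ofReal.comp hq).aestronglyMeasurable Q ?_
    filter_upwards [ae_restrict_mem measurableSet_Ioo] with x hx
    simpa using hQ x ⟨hx.1.le, hx.2.le⟩
  have hG : MemLp (fun x => Complex.I * (lam : ℂ) * v x - w x + (q x : ℂ) * v x) ⊤
      (volume.restrict (Ioo (0 : ℝ) 1)) :=
    ((h.memLp_v.const_mul _).sub h.memLp_w).add (h.memLp_v.mul hq')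
  rw [intervalIntegrable_iff_integrableOn_Ioo_of_le zero_le_one]
  exact (hG.mono_exponent le_top : MemLp _ 2 _).integrable_norm_pow (by norm_num)

lemma intervalIntegrable_forcing (hA1 : AssumptionA1 a a_min a_max)
    (hA2 : AssumptionA2 q c d q_min q_max) (h : WaveState a u' v v' w) :
    IntervalIntegrable (forcingDensity a q lam u' v v' w) volume 0 1 :=
  (h.intervalIntegrable_f' hA1).add (h.intervalIntegrable_g hA2)

lemma intervalIntegrable_energyDensity (hA1 : AssumptionA1 a a_min a_max)
    (h : WaveState a u' v v' w) : IntervalIntegrable (energyDensity a u' v) volume 0 1 :=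
  (h.intervalIntegrable_u' hA1).add h.intervalIntegrable_v

lemma coeff_pos (hA1 : AssumptionA1 a a_min a_max) {x : ℝ} (hx : x ∈ Icc (0 : ℝ) 1) : 0 < a x :=
  hA1.2.1.trans_le (hA1.2.2.2 x hx).1

lemma forcingDensity_nonneg (hA1 : AssumptionA1 a a_min a_max) {x : ℝ}
    (hx : x ∈ Icc (0 : ℝ) 1) : 0 ≤ forcingDensity a q lam u' v v' w x := by
  have := coeff_pos hA1 hx
  unfold forcingDensity
  positivity

lemma energyDensity_nonneg (hA1 : AssumptionA1 a a_min a_max) {x : ℝ}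
    (hx : x ∈ Icc (0 : ℝ) 1) : 0 ≤ energyDensity a u' v x := by
  have := coeff_pos hA1 hx
  unfold energyDensity
  positivity

lemma fluxEnergy_nonneg (hA1 : AssumptionA1 a a_min a_max) {x : ℝ}
    (hx : x ∈ Icc (0 : ℝ) 1) : 0 ≤ fluxEnergy a u' v x := by
  have := coeff_pos hA1 hx
  unfold fluxEnergy
  positivity

/-- Propagation: the pointwise energy at one point controls it at every other point, uniformly in
the frequency, up to the forcing. -/
lemma exists_fluxEnergy_le (hA1 : AssumptionA1 a a_min a_max)
    (hA2 : AssumptionA2 q c d q_min q_max) :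
    ∃ M ≥ (1 : ℝ), ∀ {lam : ℝ} {u' v v' w : ℝ → ℂ}, WaveState a u' v v' w →
      ∀ x ∈ Icc (0 : ℝ) 1, ∀ y ∈ Icc (0 : ℝ) 1, fluxEnergy a u' v y ≤
        M * (fluxEnergy a u' v x + ∫ t in (0 : ℝ)..1, forcingDensity a q lam u' v v' w t) := by
  obtain ⟨L, hL⟩ := hA1.1
  obtain ⟨Q, hQ⟩ := hA2.2.1
  have ham := hA1.2.1
  have hQ0 : 0 ≤ Q := (abs_nonneg _).trans (hQ 0 (by simp))
  set K : ℝ := L / a_min + Q * (1 + 1 / a_min) + 1 with hK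
  have hK0 : 0 ≤ K := by positivity
  refine ⟨Real.exp K, Real.one_le_exp hK0, fun {lam u' v v' w} h x hx y hy => ?_⟩
  refine le_exp_mul_add_integral_of_abs_deriv_le
    (F' := fun t => 2 * inner ℝ ((a t : ℂ) * u' t) (w t)
      + (deriv a t * ‖v t‖ ^ 2 + a t * (2 * inner ℝ (v t) (v' t))))
    hK0 (h.absolutelyContinuous_fluxEnergy hA1)
    (h.intervalIntegrable_forcing hA1 hA2) (fun x hx => forcingDensity_nonneg hA1 hx) ?_ hx hy
    (fluxEnergy_nonneg hA1 hx) (fluxEnergy_nonneg hA1 hy)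
  have had := hL.ae_differentiableWithinAt_of_mem (μ := volume)
  filter_upwards [h.hasDerivAt_flux, ae_restrict_mem measurableSet_Ioo,
    ae_restrict_of_ae had] with t hw ht hda
  have ht' : t ∈ Icc (0 : ℝ) 1 := ⟨ht.1.le, ht.2.le⟩
  have hnhds : Icc (0 : ℝ) 1 ∈ nhds t := Icc_mem_nhds ht.1 ht.2
  have hda' := ((hda ht').differentiableAt hnhds).hasDerivAt
  refine ⟨hw.norm_sq.add (hda'.mul (h.hasDerivAt_v t ht').norm_sq), ?_⟩
  have hLd : |deriv a t| ≤ L := norm_deriv_le_of_lipschitzOn hnhds hL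
  have hat := hA1.2.2.2 t ht'
  have hat0 := coeff_pos hA1 ht'
  have hQt := hQ t ht'
  have hid := inner_flux_add_inner_velocity (a t) (q t) lam (u' t) (v t) (v' t) (w t)
  have heq : 2 * inner ℝ ((a t : ℂ) * u' t) (w t)
      + (deriv a t * ‖v t‖ ^ 2 + a t * (2 * inner ℝ (v t) (v' t))) =
      deriv a t * ‖v t‖ ^ 2 + 2 * (inner ℝ ((a t : ℂ) * u' t) (w t)
        + a t * inner ℝ (v t) (v' t)) := by ring
  rw [heq, hid, forcingDensity, fluxEnergy]
  set P := (a t : ℂ) * u' t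
  set F := Complex.I * (lam : ℂ) * u' t - v' t
  set G := Complex.I * (lam : ℂ) * v t - w t + (q t : ℂ) * v t
  have i1 := abs_real_inner_le_norm P (v t)
  have i2 := abs_real_inner_le_norm P G
  have i3 := abs_real_inner_le_norm (v t) F
  have b1 : |deriv a t * ‖v t‖ ^ 2| ≤ L * ‖v t‖ ^ 2 := by
    rw [abs_mul, abs_of_nonneg (sq_nonneg ‖v t‖)]
    gcongr
  have b2 : |q t * inner ℝ P (v t)| ≤ Q * (‖P‖ * ‖v t‖) := by
    rw [abs_mul]
    gcongr
  have b3 : |a t * inner ℝ (v t) F| ≤ a t * (‖v t‖ * ‖F‖) := by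
    rw [abs_mul, abs_of_pos hat0]
    gcongr
  have b0 : ‖v t‖ ^ 2 ≤ (1 / a_min) * (a t * ‖v t‖ ^ 2) := by
    rw [one_div, inv_mul_eq_div, le_div_iff₀ ham]
    nlinarith [mul_le_mul_of_nonneg_right hat.1 (sq_nonneg ‖v t‖)]
  have y1 : 2 * (‖P‖ * ‖v t‖) ≤ ‖P‖ ^ 2 + ‖v t‖ ^ 2 := by nlinarith [sq_nonneg (‖P‖ - ‖v t‖)]
  have y2 : 2 * (‖P‖ * ‖G‖) ≤ ‖P‖ ^ 2 + ‖G‖ ^ 2 := by nlinarith [sq_nonneg (‖P‖ - ‖G‖)]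
  have y3 : 2 * (‖v t‖ * ‖F‖) ≤ ‖v t‖ ^ 2 + ‖F‖ ^ 2 := by nlinarith [sq_nonneg (‖v t‖ - ‖F‖)]
  have z1 := mul_le_mul_of_nonneg_left y1 hQ0
  have z3 := mul_le_mul_of_nonneg_left y3 hat0.le
  have z4 := mul_le_mul_of_nonneg_left b0 L.coe_nonneg
  have z5 := mul_le_mul_of_nonneg_left b0 hQ0
  have hfin : (L : ℝ) * ‖v t‖ ^ 2 + Q * (‖P‖ ^ 2 + ‖v t‖ ^ 2) + (‖P‖ ^ 2 + ‖G‖ ^ 2)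
      + a t * (‖v t‖ ^ 2 + ‖F‖ ^ 2) ≤
      K * (‖P‖ ^ 2 + a t * ‖v t‖ ^ 2) + (a t * ‖F‖ ^ 2 + ‖G‖ ^ 2) := by
    have p1 : 0 ≤ L / a_min * ‖P‖ ^ 2 := by positivity
    have p2 : 0 ≤ Q * (1 / a_min) * ‖P‖ ^ 2 := by positivity
    have p3 : 0 ≤ Q * (a t * ‖v t‖ ^ 2) := by positivity
    rw [hK]
    have hLm : (L : ℝ) / a_min = L * (1 / a_min) := by ring
    rw [hLm] at p1 ⊢
    linarith
  rw [abs_le] at *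
  constructor <;> linarith [b1.1, b1.2, b2.1, b2.2, b3.1, b3.2, i2.1, i2.2]

/-- The pointwise inequality behind the localized multiplier estimate. -/
lemma multiplier_pointwise_le {e k l χ χ' a A s m U V F G θ g f : ℝ}
    (hk : ∀ x y : ℝ, x * y ≤ e * y ^ 2 + k * x ^ 2) (he0 : 0 ≤ e) (hk0 : 0 ≤ k)
    (hl0 : l ≠ 0) (hl : |l⁻¹| ≤ 1) (hχ0 : 0 ≤ χ) (hχ1 : χ ≤ 1) (hχ' : |χ'| ≤ 1)
    (ha0 : 0 ≤ a) (ha : a ≤ A)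
    (hθ : |θ| ≤ a * U * V) (hg : |g| ≤ G * V) (hf : |f| ≤ U * F)
    (hs : s ≤ a * U ^ 2 + V ^ 2) (hm : (2 + A * k) * V ^ 2 ≤ m) :
    -l⁻¹ * χ' * θ + -l⁻¹ * χ * (l * (a * U ^ 2 - V ^ 2) - g - a * f) ≤
      -s * χ + 2 * e * (a * U ^ 2 + V ^ 2) + k * (a * F ^ 2 + G ^ 2) + m := by
  have b1 : -l⁻¹ * χ' * θ ≤ a * U * V := by
    refine (le_abs_self _).trans ?_
    rw [abs_mul, abs_mul, abs_neg]
    calc |l⁻¹| * |χ'| * |θ| ≤ 1 * 1 * (a * U * V) := by gcongr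
      _ = _ := by ring
  have b2 : l⁻¹ * χ * g ≤ G * V := by
    refine (le_abs_self _).trans ?_
    rw [abs_mul, abs_mul, abs_of_nonneg hχ0]
    calc |l⁻¹| * χ * |g| ≤ 1 * 1 * (G * V) := by gcongr
      _ = _ := by ring
  have b3 : l⁻¹ * χ * (a * f) ≤ a * (U * F) := by
    refine (le_abs_self _).trans ?_
    rw [abs_mul, abs_mul, abs_mul, abs_of_nonneg hχ0, abs_of_nonneg ha0]
    calc |l⁻¹| * χ * (a * |f|) ≤ 1 * 1 * (a * (U * F)) := by gcongr
      _ = _ := by ring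
  have heq : -l⁻¹ * χ' * θ + -l⁻¹ * χ * (l * (a * U ^ 2 - V ^ 2) - g - a * f) =
      -χ * (a * U ^ 2 - V ^ 2) + -l⁻¹ * χ' * θ + l⁻¹ * χ * g + l⁻¹ * χ * (a * f) := by
    field_simp
    ring
  rw [heq]
  have y1 := mul_le_mul_of_nonneg_left (hk V U) ha0
  have y2 := hk G V
  have y3 := mul_le_mul_of_nonneg_left (hk F U) ha0
  have y4 : a * (k * V ^ 2) ≤ A * (k * V ^ 2) := by gcongr
  have y5 := mul_le_mul_of_nonneg_left hs hχ0
  have y6 := mul_le_mul_of_nonneg_right hχ1 (sq_nonneg V)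
  have y8 : 0 ≤ e * V ^ 2 := by positivity
  linarith

/-- The integral of `q |v|²` over `(0,1)` is nonnegative. -/
lemma integral_potential_nonneg (hA2 : AssumptionA2 q c d q_min q_max) (v : ℝ → ℂ) :
    0 ≤ ∫ x in (0 : ℝ)..1, q x * ‖v x‖ ^ 2 := by
  refine intervalIntegral.integral_nonneg_of_ae_restrict zero_le_one ?_
  rw [← restrict_Ioo_eq_restrict_Icc]
  filter_upwards [hA2.2.2.1] with x hx
  exact mul_nonneg hx (sq_nonneg _)

/-- For frequencies bounded away from zero, the pointwise energy is controlled by the damping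
`∫ q |v|²` and the forcing, up to a small multiple of the energy. -/
lemma exists_fluxEnergy_le_of_one_le_abs (hA1 : AssumptionA1 a a_min a_max)
    (hA2 : AssumptionA2 q c d q_min q_max) {ε : ℝ} (hε : 0 < ε) :
    ∃ B > (0 : ℝ), ∀ {lam : ℝ} {u' v v' w : ℝ → ℂ}, WaveState a u' v v' w → 1 ≤ |lam| →
      ∀ y ∈ Icc (0 : ℝ) 1, fluxEnergy a u' v y ≤
        ε * (∫ t in (0 : ℝ)..1, energyDensity a u' v t)
          + B * ((∫ t in (0 : ℝ)..1, q t * ‖v t‖ ^ 2)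
            + ∫ t in (0 : ℝ)..1, forcingDensity a q lam u' v v' w t) := by
  obtain ⟨M, hM1, hM⟩ := exists_fluxEnergy_le hA1 hA2
  obtain ⟨-, -, hq0, hc, hcd, hd1, hqm, -, hqω⟩ := id hA2
  have hM0 : 0 < M := zero_lt_one.trans_le hM1
  have hamax : 0 < a_max := hA1.2.1.trans_le hA1.2.2.1
  have hκi : IntervalIntegrable (fun x => (x - c) * (d - x)) volume c d :=
    Continuous.intervalIntegrable (by fun_prop) _ _
  obtain ⟨κ, hκ⟩ : ∃ κ, κ = ∫ x in c..d, (x - c) * (d - x) := ⟨_, rfl⟩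
  have hκ0 : 0 < κ := by
    rw [hκ]
    exact intervalIntegral.intervalIntegral_pos_of_pos_on hκi
      (fun x hx => mul_pos (sub_pos.2 hx.1) (sub_pos.2 hx.2)) hcd
  obtain ⟨e, he⟩ : ∃ e, e = ε * κ / (2 * M * a_max) := ⟨_, rfl⟩
  have he0 : 0 < e := by rw [he]; positivity
  obtain ⟨D, hD⟩ : ∃ D, D = 2 + a_max / (4 * e) := ⟨_, rfl⟩
  have hD0 : 0 < D := by rw [hD]; positivity
  refine ⟨M * (a_max / κ * (1 / (4 * e) + D / q_min) + 1), by positivity,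
    fun {lam u' v v' w} h hlam y hy => ?_⟩
  set N := ∫ t in (0 : ℝ)..1, forcingDensity a q lam u' v v' w t with hN
  set V := ∫ t in (0 : ℝ)..1, q t * ‖v t‖ ^ 2 with hV
  set T := ∫ t in (0 : ℝ)..1, energyDensity a u' v t with hT
  obtain ⟨s, hs⟩ : ∃ s, s = (fluxEnergy a u' v y / M - N) / a_max := ⟨_, rfl⟩
  have hsx (x : ℝ) (hx : x ∈ Icc (0 : ℝ) 1) : s ≤ energyDensity a u' v x := by
    have h1 := hM h x hx y hy (lam := lam)
    rw [fluxEnergy_eq_mul_energyDensity a u' v x, ← hN] at h1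
    have h2 : fluxEnergy a u' v y / M ≤ a x * energyDensity a u' v x + N := by
      rwa [div_le_iff₀' hM0]
    rw [hs, div_le_iff₀ hamax]
    nlinarith [mul_le_mul_of_nonneg_right (hA1.2.2.2 x hx).2
      (energyDensity_nonneg (u' := u') (v := v) hA1 hx)]
  have hlam0 : lam ≠ 0 := by
    rintro rfl
    norm_num at hlam
  have hinv : |lam⁻¹| ≤ 1 := by
    rw [abs_inv]
    exact inv_le_one_of_one_le₀ hlam
  have hsub (f : ℝ → ℝ) (hf : IntervalIntegrable f volume 0 1)
      (hf0 : ∀ᵐ t ∂volume.restrict (Ioo (0 : ℝ) 1), 0 ≤ f t) :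
      IntervalIntegrable f volume c d ∧ ∫ t in c..d, f t ≤ ∫ t in (0 : ℝ)..1, f t := by
    refine ⟨hf.mono_set (uIcc_subset_unit ⟨hc, hcd.le.trans hd1⟩ ⟨hc.trans hcd.le, hd1⟩),
      intervalIntegral.integral_mono_interval hc hcd.le hd1 ?_ hf⟩
    rwa [← restrict_Ioo_eq_restrict_Ioc]
  obtain ⟨iT, lT⟩ := hsub _ (h.intervalIntegrable_energyDensity hA1) (by
    filter_upwards [ae_restrict_mem measurableSet_Ioo] with x hx
    exact energyDensity_nonneg hA1 ⟨hx.1.le, hx.2.le⟩)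
  obtain ⟨iN, lN⟩ := hsub _ (h.intervalIntegrable_forcing hA1 hA2 (lam := lam)) (by
    filter_upwards [ae_restrict_mem measurableSet_Ioo] with x hx
    exact forcingDensity_nonneg hA1 ⟨hx.1.le, hx.2.le⟩)
  obtain ⟨iV, lV⟩ := hsub _ (h.intervalIntegrable_potential hA2) (by
    filter_upwards [hq0] with x hx
    exact mul_nonneg hx (sq_nonneg _))
  have hχd (t : ℝ) : HasDerivAt (fun t => -lam⁻¹ * ((t - c) * (d - t)))
      (-lam⁻¹ * ((d - t) - (t - c))) t := by
    have := (((hasDerivAt_id t).sub_const c).mul ((hasDerivAt_id t).const_sub d)).const_mul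
      (-lam⁻¹)
    refine this.congr_deriv ?_
    simp only [id_eq]
    ring
  have hχac : AbsolutelyContinuousOnInterval (fun t => -lam⁻¹ * ((t - c) * (d - t))) 0 1 :=
    ContDiffOn.absolutelyContinuousOnInterval (ContDiff.contDiffOn (by fun_prop))
  have hIp : AbsolutelyContinuousOnInterval
      (fun t => Complex.I * ((a t : ℂ) * u' t)) 0 1 :=
    h.absolutelyContinuous_flux.const_smul Complex.I
  have key := AbsolutelyContinuousOnInterval.sub_le_integral_of_ae_hasDerivAt_le
    (F := fun t => -lam⁻¹ * ((t - c) * (d - t)) *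
      inner ℝ (Complex.I * ((a t : ℂ) * u' t)) (v t))
    (F' := fun t => -lam⁻¹ * ((d - t) - (t - c)) *
      inner ℝ (Complex.I * ((a t : ℂ) * u' t)) (v t) + -lam⁻¹ * ((t - c) * (d - t)) *
        (inner ℝ (Complex.I * ((a t : ℂ) * u' t)) (v' t) + inner ℝ (Complex.I * w t) (v t)))
    (B := fun t => -s * ((t - c) * (d - t)) + (2 * e) * energyDensity a u' v t
      + (1 / (4 * e)) * forcingDensity a q lam u' v v' w t + (D / q_min) * (q t * ‖v t‖ ^ 2))
    ((hχac.fun_mul (hIp.complex_inner h.absolutelyContinuous_v)).mono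
      (uIcc_subset_unit ⟨hc, hcd.le.trans hd1⟩ ⟨hc.trans hcd.le, hd1⟩)) hcd.le (by
      filter_upwards [ae_restrict_Ioo_of_subinterval hc hd1 h.hasDerivAt_flux, hqω,
        ae_restrict_mem measurableSet_Ioo] with t hw hq htm
      have ht : t ∈ Icc (0 : ℝ) 1 := ⟨hc.trans htm.1.le, htm.2.le.trans hd1⟩
      refine ⟨(hχd t).mul ((hw.const_mul Complex.I).inner ℝ (h.hasDerivAt_v t ht)), ?_⟩
      have hat0 := coeff_pos hA1 ht
      have hat := (hA1.2.2.2 t ht).2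
      have hst := hsx t ht
      rw [inner_I_flux_velocity_deriv (a t) (q t) lam (u' t) (v t) (v' t) (w t)]
      simp only [energyDensity, forcingDensity] at hst ⊢
      set F := Complex.I * (lam : ℂ) * u' t - v' t
      set G := Complex.I * (lam : ℂ) * v t - w t + (q t : ℂ) * v t
      have hχ0 : 0 ≤ (t - c) * (d - t) :=
        mul_nonneg (sub_nonneg.2 htm.1.le) (sub_nonneg.2 htm.2.le)
      have hχ1 : (t - c) * (d - t) ≤ 1 := by
        nlinarith [htm.1, htm.2]
      have hχ2 : |(d - t) - (t - c)| ≤ 1 := by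
        rw [abs_le]
        constructor <;> linarith [htm.1, htm.2]
      set χ := (t - c) * (d - t)
      set χ' := (d - t) - (t - c)
      have i1 := abs_real_inner_le_norm (Complex.I * ((a t : ℂ) * u' t)) (v t)
      have i2 := abs_real_inner_le_norm (Complex.I * G) (v t)
      have i3 := abs_real_inner_le_norm (Complex.I * u' t) F
      simp only [norm_mul, Complex.norm_I, one_mul, Complex.norm_real, Real.norm_eq_abs,
        abs_of_pos hat0] at i1 i2 i3
      set θ := inner ℝ (Complex.I * ((a t : ℂ) * u' t)) (v t)
      set g := inner ℝ (Complex.I * G) (v t)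
      set f := inner ℝ (Complex.I * u' t) F
      have hD' : (2 + a_max * (1 / (4 * e))) * ‖v t‖ ^ 2 ≤ D / q_min * (q t * ‖v t‖ ^ 2) := by
        have hDe : 2 + a_max * (1 / (4 * e)) = D := by rw [hD]; ring
        rw [hDe, div_mul_eq_mul_div, le_div_iff₀ hqm]
        nlinarith [mul_le_mul_of_nonneg_right hq.1 (sq_nonneg ‖v t‖)]
      refine multiplier_pointwise_le (fun x y => ?_) he0.le (by positivity) hlam0 hinv hχ0 hχ1 hχ2
        hat0.le hat i1 i2 i3 hst hD'
      calc x * y ≤ e * y ^ 2 + x ^ 2 / (4 * e) := mul_le_eps_sq_add he0 x y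
        _ = _ := by ring)
    ((((hκi.const_mul (-s)).add (iT.const_mul _)).add (iN.const_mul _)).add (iV.const_mul _))
  rw [intervalIntegral.integral_add
      (((hκi.const_mul (-s)).add (iT.const_mul _)).add (iN.const_mul _)) (iV.const_mul _),
    intervalIntegral.integral_add ((hκi.const_mul (-s)).add (iT.const_mul _)) (iN.const_mul _),
    intervalIntegral.integral_add (hκi.const_mul (-s)) (iT.const_mul _)] at key
  simp only [intervalIntegral.integral_const_mul, ← hκ, sub_self, zero_mul, mul_zero] at key
  have l1 := mul_le_mul_of_nonneg_left lT (by positivity : 0 ≤ 2 * e)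
  have l2 := mul_le_mul_of_nonneg_left lN (by positivity : 0 ≤ 1 / (4 * e))
  have l3 := mul_le_mul_of_nonneg_left lV (by positivity : 0 ≤ D / q_min)
  have hκs : s * κ ≤ 2 * e * T + 1 / (4 * e) * N + D / q_min * V := by linarith
  have hs' := (le_div_iff₀ hκ0).2 hκs
  have hy' : fluxEnergy a u' v y = M * (a_max * s + N) := by
    rw [hs]
    field_simp
    ring
  have hN0 : 0 ≤ N := intervalIntegral.integral_nonneg zero_le_one
    fun x hx => forcingDensity_nonneg hA1 hx
  have hV0 : 0 ≤ V := integral_potential_nonneg hA2 v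
  calc fluxEnergy a u' v y
      ≤ M * (a_max * ((2 * e * T + 1 / (4 * e) * N + D / q_min * V) / κ) + N) := by
        rw [hy']
        gcongr
    _ = M * a_max / κ * (2 * e) * T
        + M * (a_max / κ * (1 / (4 * e) * N + D / q_min * V) + N) := by
        field_simp
        ring
    _ = ε * T + M * (a_max / κ * (1 / (4 * e) * N + D / q_min * V) + N) := by
        rw [he]
        congr 2
        field_simp
    _ ≤ _ := by
        have p1 : 0 ≤ M * (a_max / κ * (1 / (4 * e)) * V) := by positivity
        have p2 : 0 ≤ M * (a_max / κ * (D / q_min) * N) := by positivity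
        have p3 : 0 ≤ M * V := by positivity
        linarith

end WaveState

/-- The boundary residuals `k₁, k₂, k₃` associated with the boundary values of `(u', v)` and the
trace `η₂`. -/
structure BoundaryState (α₁ α₂ β₁ γ₁ μ₁ lam : ℝ) (u' v : ℝ → ℂ) (η₂ k₁ k₂ k₃ : ℂ) : Prop where
  eq_k₁ : k₁ = Complex.I * (lam : ℂ) * v 1 + (α₁ : ℂ) * v 1 + (α₂ : ℂ) * η₂ + (β₁ : ℂ) * u' 1
  eq_k₂ : k₂ = Complex.I * (lam : ℂ) * η₂ - v 1
  eq_k₃ : k₃ = Complex.I * (lam : ℂ) * v 0 + (γ₁ : ℂ) * v 0 - (μ₁ : ℂ) * u' 0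

/-- The squared norm of the boundary components. -/
noncomputable def boundaryNormSq (a : ℝ → ℝ) (α₂ β₁ μ₁ : ℝ) (x y z : ℂ) : ℝ :=
  a 1 / β₁ * ‖x‖ ^ 2 + a 1 * α₂ / β₁ * ‖y‖ ^ 2 + a 0 / μ₁ * ‖z‖ ^ 2

/-- The total squared norm of the state. -/
noncomputable def totalEnergy (a : ℝ → ℝ) (α₂ β₁ μ₁ : ℝ) (u' v : ℝ → ℂ) (η₂ : ℂ) : ℝ :=
  (∫ t in (0 : ℝ)..1, energyDensity a u' v t) + boundaryNormSq a α₂ β₁ μ₁ (v 1) η₂ (v 0)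

/-- The total squared norm of the residual. -/
noncomputable def totalForcing (a q : ℝ → ℝ) (α₂ β₁ μ₁ lam : ℝ) (u' v v' w : ℝ → ℂ)
    (k₁ k₂ k₃ : ℂ) : ℝ :=
  (∫ t in (0 : ℝ)..1, forcingDensity a q lam u' v v' w t) + boundaryNormSq a α₂ β₁ μ₁ k₁ k₂ k₃

namespace BoundaryState

variable {a q : ℝ → ℝ} {a_min a_max c d q_min q_max α₁ α₂ β₁ γ₁ μ₁ lam : ℝ}
  {u' v v' w : ℝ → ℂ} {η₂ k₁ k₂ k₃ : ℂ}

lemma inner_flux_one (hb : BoundaryState α₁ α₂ β₁ γ₁ μ₁ lam u' v η₂ k₁ k₂ k₃) (hβ₁ : 0 < β₁) :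
    inner ℝ ((a 1 : ℂ) * u' 1) (v 1) = a 1 / β₁ * inner ℝ k₁ (v 1)
      - a 1 / β₁ * α₁ * ‖v 1‖ ^ 2 + a 1 * α₂ / β₁ * inner ℝ η₂ k₂ := by
  have h : v 1 = Complex.I * (lam : ℂ) * η₂ - k₂ := by rw [hb.eq_k₂]; ring
  have h1 : inner ℝ η₂ k₂ = - inner ℝ η₂ (v 1) := by
    rw [h]
    simp [Complex.inner]
    ring
  rw [h1, hb.eq_k₁]
  simp [Complex.inner, Complex.sq_norm, Complex.normSq_apply]
  field_simp
  ring

lemma inner_flux_zero (hb : BoundaryState α₁ α₂ β₁ γ₁ μ₁ lam u' v η₂ k₁ k₂ k₃) (hμ₁ : 0 < μ₁) :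
    inner ℝ ((a 0 : ℂ) * u' 0) (v 0) =
      a 0 / μ₁ * γ₁ * ‖v 0‖ ^ 2 - a 0 / μ₁ * inner ℝ k₃ (v 0) := by
  rw [hb.eq_k₃]
  simp [Complex.inner, Complex.sq_norm, Complex.normSq_apply]
  field_simp
  ring

/-- The dissipation identity, with the forcing terms absorbed by Young's inequality. -/
lemma dissipation_le (hb : BoundaryState α₁ α₂ β₁ γ₁ μ₁ lam u' v η₂ k₁ k₂ k₃)
    (h : WaveState a u' v v' w) (hA1 : AssumptionA1 a a_min a_max)
    (hA2 : AssumptionA2 q c d q_min q_max) (hα₂ : 0 < α₂) (hβ₁ : 0 < β₁) (hμ₁ : 0 < μ₁)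
    {δ : ℝ} (hδ : 0 < δ) :
    (∫ t in (0 : ℝ)..1, q t * ‖v t‖ ^ 2) + a 1 / β₁ * α₁ * ‖v 1‖ ^ 2
        + a 0 / μ₁ * γ₁ * ‖v 0‖ ^ 2 ≤
      δ * totalEnergy a α₂ β₁ μ₁ u' v η₂
        + 1 / (4 * δ) * totalForcing a q α₂ β₁ μ₁ lam u' v v' w k₁ k₂ k₃ := by
  have hiT := h.intervalIntegrable_energyDensity hA1
  have hiN := h.intervalIntegrable_forcing hA1 hA2 (lam := lam)
  have hiV := h.intervalIntegrable_potential hA2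
  have key := AbsolutelyContinuousOnInterval.sub_le_integral_of_ae_hasDerivAt_le
    (F := fun t => -inner ℝ ((a t : ℂ) * u' t) (v t))
    (F' := fun t => -(inner ℝ ((a t : ℂ) * u' t) (v' t) + inner ℝ (w t) (v t)))
    (B := fun t => δ * energyDensity a u' v t
      + 1 / (4 * δ) * forcingDensity a q lam u' v v' w t - q t * ‖v t‖ ^ 2)
    (h.absolutelyContinuous_flux.complex_inner h.absolutelyContinuous_v).fun_neg zero_le_one (by
      filter_upwards [h.hasDerivAt_flux, ae_restrict_mem measurableSet_Ioo] with t hw htm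
      have ht : t ∈ Icc (0 : ℝ) 1 := ⟨htm.1.le, htm.2.le⟩
      refine ⟨(hw.inner ℝ (h.hasDerivAt_v t ht)).neg, ?_⟩
      rw [inner_flux_velocity_deriv (a t) (q t) lam (u' t) (v t) (v' t) (w t)]
      simp only [energyDensity, forcingDensity]
      have y1 := inner_le_eps_sq_add hδ
        (Complex.I * (lam : ℂ) * v t - w t + (q t : ℂ) * v t) (v t)
      have y2 := inner_le_eps_sq_add hδ (Complex.I * (lam : ℂ) * u' t - v' t) (u' t)
      rw [real_inner_comm] at y2
      have y3 := mul_le_mul_of_nonneg_left y2 (WaveState.coeff_pos hA1 ht).le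
      rw [div_eq_mul_one_div] at y1 y3
      linarith)
    (((hiT.const_mul δ).add (hiN.const_mul _)).sub hiV)
  rw [intervalIntegral.integral_sub ((hiT.const_mul δ).add (hiN.const_mul _)) hiV,
    intervalIntegral.integral_add (hiT.const_mul δ) (hiN.const_mul _),
    intervalIntegral.integral_const_mul, intervalIntegral.integral_const_mul,
    hb.inner_flux_one hβ₁, hb.inner_flux_zero hμ₁] at key
  have ha1 := WaveState.coeff_pos hA1 (x := 1) (by simp)
  have ha0 := WaveState.coeff_pos hA1 (x := 0) (by simp)
  have y1 := mul_le_mul_of_nonneg_left (inner_le_eps_sq_add hδ k₁ (v 1))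
    (by positivity : 0 ≤ a 1 / β₁)
  have y2 := inner_le_eps_sq_add hδ k₂ η₂
  rw [real_inner_comm] at y2
  have y2 := mul_le_mul_of_nonneg_left y2 (by positivity : 0 ≤ a 1 * α₂ / β₁)
  have y3 := mul_le_mul_of_nonneg_left (inner_le_eps_sq_add hδ k₃ (v 0))
    (by positivity : 0 ≤ a 0 / μ₁)
  rw [div_eq_mul_one_div _ (4 * δ)] at y1 y2 y3
  simp only [totalEnergy, totalForcing, boundaryNormSq]
  linarith

lemma norm_I_mul_le {lam : ℝ} (hlam : |lam| ≤ 1) (z : ℂ) : ‖Complex.I * (lam : ℂ) * z‖ ≤ ‖z‖ := by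
  rw [norm_mul, norm_mul, Complex.norm_I, one_mul, Complex.norm_real, Real.norm_eq_abs]
  exact mul_le_of_le_one_left (norm_nonneg _) hlam

/-- At low frequency, the energy at the left endpoint is controlled by the velocity trace. -/
lemma fluxEnergy_zero_le (hb : BoundaryState α₁ α₂ β₁ γ₁ μ₁ lam u' v η₂ k₁ k₂ k₃)
    (ha0 : 0 < a 0) (hγ₁ : 0 < γ₁) (hμ₁ : 0 < μ₁) (hlam : |lam| ≤ 1) :
    fluxEnergy a u' v 0 ≤
      (2 * (a 0 / μ₁) ^ 2 * (1 + γ₁) ^ 2 + a 0) * (‖v 0‖ ^ 2 + ‖k₃‖ ^ 2) := by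
  have h1 : ‖(μ₁ : ℂ) * u' 0‖ ≤ (1 + γ₁) * (‖v 0‖ + ‖k₃‖) := by
    have h2 : (μ₁ : ℂ) * u' 0 = Complex.I * (lam : ℂ) * v 0 + (γ₁ : ℂ) * v 0 - k₃ := by
      rw [hb.eq_k₃]; ring
    have h3 : ‖(γ₁ : ℂ) * v 0‖ = γ₁ * ‖v 0‖ := by
      rw [norm_mul, Complex.norm_real, Real.norm_of_nonneg hγ₁.le]
    rw [h2]
    have h4 := norm_I_mul_le hlam (v 0)
    have h5 := norm_sub_le (Complex.I * (lam : ℂ) * v 0 + (γ₁ : ℂ) * v 0) k₃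
    have h6 := norm_add_le (Complex.I * (lam : ℂ) * v 0) ((γ₁ : ℂ) * v 0)
    have h7 : 0 ≤ γ₁ * ‖k₃‖ := by positivity
    linarith
  have h2 : ‖(a 0 : ℂ) * u' 0‖ = a 0 / μ₁ * ‖(μ₁ : ℂ) * u' 0‖ := by
    rw [norm_mul, norm_mul, Complex.norm_real, Complex.norm_real, Real.norm_of_nonneg ha0.le,
      Real.norm_of_nonneg hμ₁.le]
    field_simp
  have h3 : (‖v 0‖ + ‖k₃‖) ^ 2 ≤ 2 * (‖v 0‖ ^ 2 + ‖k₃‖ ^ 2) := by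
    nlinarith [sq_nonneg (‖v 0‖ - ‖k₃‖)]
  have h4 : 0 ≤ a 0 * ‖k₃‖ ^ 2 := by positivity
  calc fluxEnergy a u' v 0
      ≤ (a 0 / μ₁ * ((1 + γ₁) * (‖v 0‖ + ‖k₃‖))) ^ 2 + a 0 * ‖v 0‖ ^ 2 := by
        rw [fluxEnergy, h2]
        gcongr
    _ = (a 0 / μ₁) ^ 2 * (1 + γ₁) ^ 2 * (‖v 0‖ + ‖k₃‖) ^ 2 + a 0 * ‖v 0‖ ^ 2 := by ring
    _ ≤ (a 0 / μ₁) ^ 2 * (1 + γ₁) ^ 2 * (2 * (‖v 0‖ ^ 2 + ‖k₃‖ ^ 2)) + a 0 * ‖v 0‖ ^ 2 := by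
        gcongr
    _ ≤ _ := by linarith

lemma norm_trace_le_of_one_le_abs (hb : BoundaryState α₁ α₂ β₁ γ₁ μ₁ lam u' v η₂ k₁ k₂ k₃)
    (hlam : 1 ≤ |lam|) : ‖η₂‖ ≤ ‖k₂‖ + ‖v 1‖ := by
  have h1 : Complex.I * (lam : ℂ) * η₂ = k₂ + v 1 := by rw [hb.eq_k₂]; ring
  have h2 : ‖Complex.I * (lam : ℂ) * η₂‖ = |lam| * ‖η₂‖ := by simp
  rw [h1] at h2
  have h3 := norm_add_le k₂ (v 1)
  have h4 := mul_le_mul_of_nonneg_right hlam (norm_nonneg η₂)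
  linarith

lemma norm_trace_le_of_abs_le_one (hb : BoundaryState α₁ α₂ β₁ γ₁ μ₁ lam u' v η₂ k₁ k₂ k₃)
    (hα₁ : 0 < α₁) (hα₂ : 0 < α₂) (hβ₁ : 0 < β₁) (hlam : |lam| ≤ 1) :
    α₂ * ‖η₂‖ ≤ ‖k₁‖ + (1 + α₁) * ‖v 1‖ + β₁ * ‖u' 1‖ := by
  have hr (r : ℝ) (hr : 0 < r) (z : ℂ) : ‖(r : ℂ) * z‖ = r * ‖z‖ := by
    rw [norm_mul, Complex.norm_real, Real.norm_of_nonneg hr.le]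
  have h1 : (α₂ : ℂ) * η₂ =
      k₁ - Complex.I * (lam : ℂ) * v 1 - (α₁ : ℂ) * v 1 - (β₁ : ℂ) * u' 1 := by
    rw [hb.eq_k₁]; ring
  rw [← hr α₂ hα₂, h1]
  have h2 := norm_sub_le (k₁ - Complex.I * (lam : ℂ) * v 1 - (α₁ : ℂ) * v 1) ((β₁ : ℂ) * u' 1)
  have h3 := norm_sub_le (k₁ - Complex.I * (lam : ℂ) * v 1) ((α₁ : ℂ) * v 1)
  have h4 := norm_sub_le k₁ (Complex.I * (lam : ℂ) * v 1)
  have h5 := norm_I_mul_le hlam (v 1)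
  rw [hr _ hβ₁] at h2
  rw [hr _ hα₁] at h3
  linarith

/-- The displacement trace is controlled by the energy at the right endpoint and the residuals. -/
lemma norm_trace_sq_le (hb : BoundaryState α₁ α₂ β₁ γ₁ μ₁ lam u' v η₂ k₁ k₂ k₃)
    (hα₁ : 0 < α₁) (hα₂ : 0 < α₂) (hβ₁ : 0 < β₁) :
    ‖η₂‖ ^ 2 ≤ 4 * (1 + (1 + (1 + α₁) + β₁) / α₂) ^ 2 *
      (‖k₁‖ ^ 2 + ‖k₂‖ ^ 2 + ‖v 1‖ ^ 2 + ‖u' 1‖ ^ 2) := by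
  have hle : ‖η₂‖ ≤ (1 + (1 + (1 + α₁) + β₁) / α₂) * (‖k₁‖ + ‖k₂‖ + ‖v 1‖ + ‖u' 1‖) := by
    have hs : 0 ≤ ‖k₁‖ + ‖k₂‖ + ‖v 1‖ + ‖u' 1‖ := by positivity
    have e1 := norm_nonneg k₁
    have e2 := norm_nonneg k₂
    have e3 := norm_nonneg (v 1)
    have e4 := norm_nonneg (u' 1)
    rcases le_total 1 |lam| with hl | hl
    · have h1 := hb.norm_trace_le_of_one_le_abs hl
      have h2 : 0 ≤ (1 + (1 + α₁) + β₁) / α₂ * (‖k₁‖ + ‖k₂‖ + ‖v 1‖ + ‖u' 1‖) := by positivity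
      linarith
    · have h1 := hb.norm_trace_le_of_abs_le_one hα₁ hα₂ hβ₁ hl
      have h2 : ‖k₁‖ + (1 + α₁) * ‖v 1‖ + β₁ * ‖u' 1‖ ≤
          (1 + (1 + α₁) + β₁) * (‖k₁‖ + ‖k₂‖ + ‖v 1‖ + ‖u' 1‖) := by
        have p1 := mul_nonneg hα₁.le e1
        have p2 := mul_nonneg hα₁.le e2
        have p3 := mul_nonneg hα₁.le e4
        have p4 := mul_nonneg hβ₁.le e1
        have p5 := mul_nonneg hβ₁.le e2
        have p6 := mul_nonneg hβ₁.le e3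
        linarith
      have h3 := (le_div_iff₀' hα₂).2 (h1.trans h2)
      rw [mul_div_right_comm] at h3
      linarith
  have hsq : (‖k₁‖ + ‖k₂‖ + ‖v 1‖ + ‖u' 1‖) ^ 2 ≤
      4 * (‖k₁‖ ^ 2 + ‖k₂‖ ^ 2 + ‖v 1‖ ^ 2 + ‖u' 1‖ ^ 2) := by
    nlinarith [sq_nonneg (‖k₁‖ - ‖k₂‖), sq_nonneg (‖k₁‖ - ‖v 1‖), sq_nonneg (‖k₁‖ - ‖u' 1‖),
      sq_nonneg (‖k₂‖ - ‖v 1‖), sq_nonneg (‖k₂‖ - ‖u' 1‖), sq_nonneg (‖v 1‖ - ‖u' 1‖)]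
  calc ‖η₂‖ ^ 2 ≤ ((1 + (1 + (1 + α₁) + β₁) / α₂) * (‖k₁‖ + ‖k₂‖ + ‖v 1‖ + ‖u' 1‖)) ^ 2 := by
        gcongr
    _ = (1 + (1 + (1 + α₁) + β₁) / α₂) ^ 2 * (‖k₁‖ + ‖k₂‖ + ‖v 1‖ + ‖u' 1‖) ^ 2 := by ring
    _ ≤ (1 + (1 + (1 + α₁) + β₁) / α₂) ^ 2 *
        (4 * (‖k₁‖ ^ 2 + ‖k₂‖ ^ 2 + ‖v 1‖ ^ 2 + ‖u' 1‖ ^ 2)) := by gcongr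
    _ = _ := by ring

lemma boundaryNormSq_nonneg (hA1 : AssumptionA1 a a_min a_max) (hα₂ : 0 < α₂) (hβ₁ : 0 < β₁)
    (hμ₁ : 0 < μ₁) (x y z : ℂ) : 0 ≤ boundaryNormSq a α₂ β₁ μ₁ x y z := by
  have ha1 := WaveState.coeff_pos hA1 (x := 1) (by simp)
  have ha0 := WaveState.coeff_pos hA1 (x := 0) (by simp)
  unfold boundaryNormSq
  positivity

lemma integral_forcing_nonneg (hA1 : AssumptionA1 a a_min a_max) :
    0 ≤ ∫ t in (0 : ℝ)..1, forcingDensity a q lam u' v v' w t :=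
  intervalIntegral.integral_nonneg zero_le_one fun _ hx => WaveState.forcingDensity_nonneg hA1 hx

lemma integral_forcing_le_totalForcing (hA1 : AssumptionA1 a a_min a_max) (hα₂ : 0 < α₂)
    (hβ₁ : 0 < β₁) (hμ₁ : 0 < μ₁) :
    ∫ t in (0 : ℝ)..1, forcingDensity a q lam u' v v' w t ≤
      totalForcing a q α₂ β₁ μ₁ lam u' v v' w k₁ k₂ k₃ :=
  le_add_of_nonneg_right (boundaryNormSq_nonneg hA1 hα₂ hβ₁ hμ₁ _ _ _)

lemma totalForcing_nonneg (hA1 : AssumptionA1 a a_min a_max) (hα₂ : 0 < α₂)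
    (hβ₁ : 0 < β₁) (hμ₁ : 0 < μ₁) : 0 ≤ totalForcing a q α₂ β₁ μ₁ lam u' v v' w k₁ k₂ k₃ :=
  add_nonneg (integral_forcing_nonneg hA1) (boundaryNormSq_nonneg hA1 hα₂ hβ₁ hμ₁ _ _ _)

/-- High frequencies: the pointwise energy is bounded by the residual, up to a small multiple of
the total energy. -/
lemma exists_fluxEnergy_le_high (hA1 : AssumptionA1 a a_min a_max)
    (hA2 : AssumptionA2 q c d q_min q_max) (hα₁ : 0 < α₁) (hα₂ : 0 < α₂) (hβ₁ : 0 < β₁)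
    (hγ₁ : 0 < γ₁) (hμ₁ : 0 < μ₁) {ε : ℝ} (hε : 0 < ε) :
    ∃ B > (0 : ℝ), ∀ {lam : ℝ} {u' v v' w : ℝ → ℂ} {η₂ k₁ k₂ k₃ : ℂ}, WaveState a u' v v' w →
      BoundaryState α₁ α₂ β₁ γ₁ μ₁ lam u' v η₂ k₁ k₂ k₃ → 1 ≤ |lam| →
      ∀ y ∈ Icc (0 : ℝ) 1, fluxEnergy a u' v y ≤ ε * totalEnergy a α₂ β₁ μ₁ u' v η₂
        + B * totalForcing a q α₂ β₁ μ₁ lam u' v v' w k₁ k₂ k₃ := by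
  obtain ⟨B, hB0, hB⟩ :=
    WaveState.exists_fluxEnergy_le_of_one_le_abs hA1 hA2 (half_pos hε)
  obtain ⟨δ, hδ⟩ : ∃ δ, δ = ε / (2 * B) := ⟨_, rfl⟩
  have hδ0 : 0 < δ := by rw [hδ]; positivity
  refine ⟨B * (1 / (4 * δ) + 1), by positivity,
    fun {lam u' v v' w η₂ k₁ k₂ k₃} h hb hlam y hy => ?_⟩
  have h1 := hB h hlam y hy
  have h2 := hb.dissipation_le h hA1 hA2 hα₂ hβ₁ hμ₁ hδ0
  have h3 : ∫ t in (0 : ℝ)..1, forcingDensity a q lam u' v v' w t ≤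
      totalForcing a q α₂ β₁ μ₁ lam u' v v' w k₁ k₂ k₃ :=
    integral_forcing_le_totalForcing hA1 hα₂ hβ₁ hμ₁
  have h4 : ∫ t in (0 : ℝ)..1, energyDensity a u' v t ≤ totalEnergy a α₂ β₁ μ₁ u' v η₂ :=
    le_add_of_nonneg_right (boundaryNormSq_nonneg hA1 hα₂ hβ₁ hμ₁ _ _ _)
  have ha1 := WaveState.coeff_pos hA1 (x := 1) (by simp)
  have ha0 := WaveState.coeff_pos hA1 (x := 0) (by simp)
  have p1 : 0 ≤ a 1 / β₁ * α₁ * ‖v 1‖ ^ 2 := by positivity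
  have p2 : 0 ≤ a 0 / μ₁ * γ₁ * ‖v 0‖ ^ 2 := by positivity
  set E := totalEnergy a α₂ β₁ μ₁ u' v η₂
  set R := totalForcing a q α₂ β₁ μ₁ lam u' v v' w k₁ k₂ k₃
  have h5 : (∫ t in (0 : ℝ)..1, q t * ‖v t‖ ^ 2) ≤ δ * E + 1 / (4 * δ) * R := by linarith
  have h6 : B * δ = ε / 2 := by rw [hδ]; field_simp
  calc fluxEnergy a u' v y ≤ ε / 2 * E + B * ((δ * E + 1 / (4 * δ) * R) + R) := by
        refine h1.trans ?_
        gcongr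
    _ = ε / 2 * E + B * δ * E + B * (1 / (4 * δ) + 1) * R := by ring
    _ = _ := by rw [h6]; ring

/-- Low frequencies: the pointwise energy is bounded by the residual, up to a small multiple of
the total energy. -/
lemma exists_fluxEnergy_le_low (hA1 : AssumptionA1 a a_min a_max)
    (hA2 : AssumptionA2 q c d q_min q_max) (hα₁ : 0 < α₁) (hα₂ : 0 < α₂) (hβ₁ : 0 < β₁)
    (hγ₁ : 0 < γ₁) (hμ₁ : 0 < μ₁) {ε : ℝ} (hε : 0 < ε) :
    ∃ B > (0 : ℝ), ∀ {lam : ℝ} {u' v v' w : ℝ → ℂ} {η₂ k₁ k₂ k₃ : ℂ}, WaveState a u' v v' w →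
      BoundaryState α₁ α₂ β₁ γ₁ μ₁ lam u' v η₂ k₁ k₂ k₃ → |lam| ≤ 1 →
      ∀ y ∈ Icc (0 : ℝ) 1, fluxEnergy a u' v y ≤ ε * totalEnergy a α₂ β₁ μ₁ u' v η₂
        + B * totalForcing a q α₂ β₁ μ₁ lam u' v v' w k₁ k₂ k₃ := by
  obtain ⟨M, hM1, hM⟩ := WaveState.exists_fluxEnergy_le hA1 hA2
  have hM0 : 0 < M := zero_lt_one.trans_le hM1
  have ha1 := WaveState.coeff_pos hA1 (x := 1) (by simp)
  have ha0 := WaveState.coeff_pos hA1 (x := 0) (by simp)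
  obtain ⟨P, hP⟩ : ∃ P, P = 2 * (a 0 / μ₁) ^ 2 * (1 + γ₁) ^ 2 + a 0 := ⟨_, rfl⟩
  have hP0 : 0 < P := by rw [hP]; positivity
  obtain ⟨m, hm⟩ : ∃ m, m = a 0 / μ₁ := ⟨_, rfl⟩
  have hm0 : 0 < m := by rw [hm]; positivity
  obtain ⟨δ, hδ⟩ : ∃ δ, δ = ε * (m * γ₁) / (M * P) := ⟨_, rfl⟩
  have hδ0 : 0 < δ := by rw [hδ]; positivity
  refine ⟨M * (P * (1 / (4 * δ) / (m * γ₁) + 1 / m) + 1), by positivity,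
    fun {lam u' v v' w η₂ k₁ k₂ k₃} h hb hlam y hy => ?_⟩
  have h1 := hM h 0 (by simp) y hy (lam := lam)
  have h2 := hb.dissipation_le h hA1 hA2 hα₂ hβ₁ hμ₁ hδ0
  have h3 : ∫ t in (0 : ℝ)..1, forcingDensity a q lam u' v v' w t ≤
      totalForcing a q α₂ β₁ μ₁ lam u' v v' w k₁ k₂ k₃ :=
    integral_forcing_le_totalForcing hA1 hα₂ hβ₁ hμ₁
  have h4 := hb.fluxEnergy_zero_le ha0 hγ₁ hμ₁ hlam
  have h5 := WaveState.integral_potential_nonneg hA2 v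
  have p1 : 0 ≤ a 1 / β₁ * α₁ * ‖v 1‖ ^ 2 := by positivity
  have h6 : m * ‖k₃‖ ^ 2 ≤ totalForcing a q α₂ β₁ μ₁ lam u' v v' w k₁ k₂ k₃ := by
    have p2 := integral_forcing_nonneg hA1 (q := q) (lam := lam) (u' := u') (v := v) (v' := v')
      (w := w)
    have p3 : 0 ≤ a 1 / β₁ * ‖k₁‖ ^ 2 := by positivity
    have p4 : 0 ≤ a 1 * α₂ / β₁ * ‖k₂‖ ^ 2 := by positivity
    rw [totalForcing, boundaryNormSq, hm]
    linarith
  rw [← hP] at h4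
  rw [← hm] at h2
  set E := totalEnergy a α₂ β₁ μ₁ u' v η₂
  set R := totalForcing a q α₂ β₁ μ₁ lam u' v v' w k₁ k₂ k₃
  have h7 : ‖v 0‖ ^ 2 ≤ (δ * E + 1 / (4 * δ) * R) / (m * γ₁) := by
    rw [le_div_iff₀' (by positivity)]
    linarith
  have h8 : ‖k₃‖ ^ 2 ≤ R / m := (le_div_iff₀' hm0).2 h6
  calc fluxEnergy a u' v y
      ≤ M * (P * ((δ * E + 1 / (4 * δ) * R) / (m * γ₁) + R / m) + R) := by
        refine h1.trans ?_
        gcongr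
        refine h4.trans ?_
        gcongr
    _ = M * P * δ / (m * γ₁) * E
        + M * (P * (1 / (4 * δ) / (m * γ₁) + 1 / m) + 1) * R := by ring
    _ = _ := by
        congr 2
        rw [hδ]
        field_simp

/-- A uniform bound on the pointwise energy controls the total energy, up to the residual. -/
lemma exists_totalEnergy_le (hA1 : AssumptionA1 a a_min a_max)
    (hα₁ : 0 < α₁) (hα₂ : 0 < α₂) (hβ₁ : 0 < β₁) (hμ₁ : 0 < μ₁) :
    ∃ C > (0 : ℝ), ∀ {lam : ℝ} {u' v v' w : ℝ → ℂ} {η₂ k₁ k₂ k₃ : ℂ} {H : ℝ},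
      WaveState a u' v v' w → BoundaryState α₁ α₂ β₁ γ₁ μ₁ lam u' v η₂ k₁ k₂ k₃ →
      (∀ y ∈ Icc (0 : ℝ) 1, fluxEnergy a u' v y ≤ H) →
      totalEnergy a α₂ β₁ μ₁ u' v η₂ ≤
        C * (H + totalForcing a q α₂ β₁ μ₁ lam u' v v' w k₁ k₂ k₃) := by
  have ha1 := WaveState.coeff_pos hA1 (x := 1) (by simp)
  have ha0 := WaveState.coeff_pos hA1 (x := 0) (by simp)
  have ham := hA1.2.1
  obtain ⟨S, hS⟩ : ∃ S, S = 4 * (1 + (1 + (1 + α₁) + β₁) / α₂) ^ 2 := ⟨_, rfl⟩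
  have hS0 : 0 < S := by rw [hS]; positivity
  obtain ⟨c₁, hc₁⟩ : ∃ r, r = a 1 / β₁ := ⟨_, rfl⟩
  obtain ⟨c₂, hc₂⟩ : ∃ r, r = a 1 * α₂ / β₁ := ⟨_, rfl⟩
  obtain ⟨c₃, hc₃⟩ : ∃ r, r = a 0 / μ₁ := ⟨_, rfl⟩
  have hc₁0 : 0 < c₁ := by rw [hc₁]; positivity
  have hc₂0 : 0 < c₂ := by rw [hc₂]; positivity
  have hc₃0 : 0 < c₃ := by rw [hc₃]; positivity
  refine ⟨1 / a_min + c₁ / a 1 + c₂ * (S * (1 / c₁ + 1 / c₂ + 1 / a 1 + 1 / (a 1) ^ 2))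
      + c₃ / a 0, by positivity, fun {lam u' v v' w η₂ k₁ k₂ k₃ H} h hb hH => ?_⟩
  have hR0 : 0 ≤ totalForcing a q α₂ β₁ μ₁ lam u' v v' w k₁ k₂ k₃ :=
    totalForcing_nonneg hA1 hα₂ hβ₁ hμ₁
  have hN0 := integral_forcing_nonneg hA1 (q := q) (lam := lam) (u' := u') (v := v) (v' := v')
    (w := w)
  have hRdef : totalForcing a q α₂ β₁ μ₁ lam u' v v' w k₁ k₂ k₃ =
      (∫ t in (0 : ℝ)..1, forcingDensity a q lam u' v v' w t)
        + (c₁ * ‖k₁‖ ^ 2 + c₂ * ‖k₂‖ ^ 2 + c₃ * ‖k₃‖ ^ 2) := by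
    rw [totalForcing, boundaryNormSq, hc₁, hc₂, hc₃]
  have hH0 : 0 ≤ H := (WaveState.fluxEnergy_nonneg hA1 (by simp)).trans (hH 0 (by simp))
  have hT : ∫ t in (0 : ℝ)..1, energyDensity a u' v t ≤ H / a_min := by
    have := intervalIntegral.integral_mono_on zero_le_one
      (h.intervalIntegrable_energyDensity hA1) (intervalIntegrable_const (c := H / a_min))
      (fun x hx => by
        have h1 := hH x hx
        rw [fluxEnergy_eq_mul_energyDensity] at h1
        rw [le_div_iff₀' ham]
        exact (mul_le_mul_of_nonneg_right (hA1.2.2.2 x hx).1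
          (WaveState.energyDensity_nonneg hA1 hx)).trans h1)
    simpa using this
  have hv (x : ℝ) (hx : x ∈ Icc (0 : ℝ) 1) : ‖v x‖ ^ 2 ≤ H / a x := by
    rw [le_div_iff₀' (WaveState.coeff_pos hA1 hx)]
    exact (le_add_of_nonneg_left (sq_nonneg _)).trans (hH x hx)
  have hv1 := hv 1 (by simp)
  have hv0 := hv 0 (by simp)
  have hu1 : ‖u' 1‖ ^ 2 ≤ H / (a 1) ^ 2 := by
    rw [le_div_iff₀' (by positivity), ← mul_pow]
    have h1 := hH 1 (by simp)
    have h2 : 0 ≤ a 1 * ‖v 1‖ ^ 2 := by positivity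
    rw [fluxEnergy, norm_mul, Complex.norm_real, Real.norm_of_nonneg ha1.le] at h1
    linarith
  have hη := hb.norm_trace_sq_le hα₁ hα₂ hβ₁
  rw [← hS] at hη
  set R := totalForcing a q α₂ β₁ μ₁ lam u' v v' w k₁ k₂ k₃
  have q1 : 0 ≤ c₁ * ‖k₁‖ ^ 2 := by positivity
  have q2 : 0 ≤ c₂ * ‖k₂‖ ^ 2 := by positivity
  have q3 : 0 ≤ c₃ * ‖k₃‖ ^ 2 := by positivity
  have hk1 : ‖k₁‖ ^ 2 ≤ R / c₁ := by
    rw [le_div_iff₀' hc₁0]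
    linarith
  have hk2 : ‖k₂‖ ^ 2 ≤ R / c₂ := by
    rw [le_div_iff₀' hc₂0]
    linarith
  have hHR : H ≤ H + R := by linarith
  have hRH : R ≤ H + R := by linarith
  rw [totalEnergy, boundaryNormSq, ← hc₁, ← hc₂, ← hc₃]
  calc (∫ t in (0 : ℝ)..1, energyDensity a u' v t)
        + (c₁ * ‖v 1‖ ^ 2 + c₂ * ‖η₂‖ ^ 2 + c₃ * ‖v 0‖ ^ 2)
      ≤ (H + R) / a_min + (c₁ * ((H + R) / a 1)
        + c₂ * (S * ((H + R) / c₁ + (H + R) / c₂ + (H + R) / a 1 + (H + R) / (a 1) ^ 2))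
        + c₃ * ((H + R) / a 0)) := by
        gcongr
        · exact hT.trans (by gcongr)
        · exact hv1.trans (by gcongr)
        · refine hη.trans ?_
          gcongr
          · exact hk1.trans (by gcongr)
          · exact hk2.trans (by gcongr)
          · exact hv1.trans (by gcongr)
          · exact hu1.trans (by gcongr)
        · exact hv0.trans (by gcongr)
    _ = _ := by ring

/-- The resolvent estimate in terms of the total energy and the total forcing. -/
lemma exists_totalEnergy_le_totalForcing (hA1 : AssumptionA1 a a_min a_max)
    (hA2 : AssumptionA2 q c d q_min q_max) (hα₁ : 0 < α₁) (hα₂ : 0 < α₂) (hβ₁ : 0 < β₁)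
    (hγ₁ : 0 < γ₁) (hμ₁ : 0 < μ₁) :
    ∃ C > (0 : ℝ), ∀ {lam : ℝ} {u' v v' w : ℝ → ℂ} {η₂ k₁ k₂ k₃ : ℂ}, WaveState a u' v v' w →
      BoundaryState α₁ α₂ β₁ γ₁ μ₁ lam u' v η₂ k₁ k₂ k₃ →
      totalEnergy a α₂ β₁ μ₁ u' v η₂ ≤
        C * totalForcing a q α₂ β₁ μ₁ lam u' v v' w k₁ k₂ k₃ := by
  obtain ⟨C, hC0, hC⟩ := exists_totalEnergy_le (q := q) (γ₁ := γ₁) hA1 hα₁ hα₂ hβ₁ hμ₁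
  have hε : 0 < 1 / (2 * C) := by positivity
  obtain ⟨B₁, hB₁0, hB₁⟩ := exists_fluxEnergy_le_high hA1 hA2 hα₁ hα₂ hβ₁ hγ₁ hμ₁ hε
  obtain ⟨B₂, hB₂0, hB₂⟩ := exists_fluxEnergy_le_low hA1 hA2 hα₁ hα₂ hβ₁ hγ₁ hμ₁ hε
  refine ⟨2 * C * (B₁ + B₂ + 1), by positivity,
    fun {lam u' v v' w η₂ k₁ k₂ k₃} h hb => ?_⟩
  have hR0 : 0 ≤ totalForcing a q α₂ β₁ μ₁ lam u' v v' w k₁ k₂ k₃ :=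
    totalForcing_nonneg hA1 hα₂ hβ₁ hμ₁
  have hH : ∀ y ∈ Icc (0 : ℝ) 1, fluxEnergy a u' v y ≤
      1 / (2 * C) * totalEnergy a α₂ β₁ μ₁ u' v η₂
        + (B₁ + B₂) * totalForcing a q α₂ β₁ μ₁ lam u' v v' w k₁ k₂ k₃ := by
    intro y hy
    have p1 := mul_nonneg hB₁0.le hR0
    have p2 := mul_nonneg hB₂0.le hR0
    rcases le_total 1 |lam| with hl | hl
    · linarith [hB₁ h hb hl y hy]
    · linarith [hB₂ h hb hl y hy]
  have h1 := hC (w := w) h hb hH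
  set E := totalEnergy a α₂ β₁ μ₁ u' v η₂
  set R := totalForcing a q α₂ β₁ μ₁ lam u' v v' w k₁ k₂ k₃
  have h2 : C * (1 / (2 * C) * E + (B₁ + B₂) * R + R) = E / 2 + C * (B₁ + B₂ + 1) * R := by
    field_simp
    ring
  linarith

end BoundaryState

/-- Uniform resolvent estimate: there is `C > 0` such that for every `λ ∈ ℝ` and every `U` in the
domain of the operator, `‖U‖² ≤ C ‖(iλ - 𝒜)U‖²`, written out with the explicit residuals
`f = iλu - v`, `g = iλv - (au')' + qv`, `k₁, k₂, k₃`, and weights `c₁ = a(1)/β₁`,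
`c₂ = a(1)α₂/β₁`, `c₃ = a(0)/μ₁`. -/
theorem uniform_resolvent_estimate (a q : ℝ → ℝ)
    (a_min a_max c d q_min q_max α₁ α₂ β₁ γ₁ μ₁ : ℝ)
    (hA1 : AssumptionA1 a a_min a_max) (hA2 : AssumptionA2 q c d q_min q_max)
    (hα₁ : 0 < α₁) (hα₂ : 0 < α₂) (hβ₁ : 0 < β₁) (hγ₁ : 0 < γ₁) (hμ₁ : 0 < μ₁) :
    ∃ C > (0:ℝ), ∀ lam : ℝ, ∀ u u' v v' w : ℝ → ℂ, ∀ η₁ η₂ ζ₁ : ℂ,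
      (∀ x ∈ Icc (0:ℝ) 1, HasDerivAt u (u' x) x) → ContinuousOn u' (Icc (0:ℝ) 1) →
      (∃ K : NNReal, LipschitzOnWith K (fun x => (a x : ℂ) * u' x) (Icc (0:ℝ) 1)) →
      (∀ᵐ x ∂(volume.restrict (Ioo (0:ℝ) 1)),
        HasDerivAt (fun y => (a y : ℂ) * u' y) (w x) x) →
      (∀ x ∈ Icc (0:ℝ) 1, HasDerivAt v (v' x) x) → ContinuousOn v' (Icc (0:ℝ) 1) →
      v 1 = η₁ → v 0 = ζ₁ → u 1 = η₂ →
      (∫ x in (0:ℝ)..1, a x * ‖u' x‖ ^ 2) + (∫ x in (0:ℝ)..1, ‖v x‖ ^ 2)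
          + (a 1 / β₁) * ‖η₁‖ ^ 2 + (a 1 * α₂ / β₁) * ‖η₂‖ ^ 2 + (a 0 / μ₁) * ‖ζ₁‖ ^ 2
        ≤ C * ((∫ x in (0:ℝ)..1, a x * ‖Complex.I * (lam : ℂ) * u' x - v' x‖ ^ 2)
          + (∫ x in (0:ℝ)..1, ‖Complex.I * (lam : ℂ) * v x - w x + (q x : ℂ) * v x‖ ^ 2)
          + (a 1 / β₁) * ‖Complex.I * (lam : ℂ) * η₁ + (α₁ : ℂ) * η₁ + (α₂ : ℂ) * η₂
              + (β₁ : ℂ) * u' 1‖ ^ 2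
          + (a 1 * α₂ / β₁) * ‖Complex.I * (lam : ℂ) * η₂ - η₁‖ ^ 2
          + (a 0 / μ₁) * ‖Complex.I * (lam : ℂ) * ζ₁ + (γ₁ : ℂ) * ζ₁
              - (μ₁ : ℂ) * u' 0‖ ^ 2) := by
  obtain ⟨C, hC0, hC⟩ :=
    BoundaryState.exists_totalEnergy_le_totalForcing hA1 hA2 hα₁ hα₂ hβ₁ hγ₁ hμ₁
  refine ⟨C, hC0, fun lam u u' v v' w η₁ η₂ ζ₁ _ hu' hp hw hv hv' h1 h0 _ => ?_⟩
  subst h1 h0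
  have h : WaveState a u' v v' w := ⟨hu', hp, hw, hv, hv'⟩
  have key := hC h ⟨rfl, rfl, rfl⟩ (lam := lam) (η₂ := η₂)
  simp only [totalEnergy, totalForcing, boundaryNormSq, energyDensity, forcingDensity] at key
  rw [intervalIntegral.integral_add (h.intervalIntegrable_u' hA1) h.intervalIntegrable_v,
    intervalIntegral.integral_add (h.intervalIntegrable_f' hA1) (h.intervalIntegrable_g hA2)]
    at key
  simpa only [add_assoc] using key
end

section
/- There exist constants M > 0 and ν > 0, depending only on a, q, q₀, q₁ (and not on the solution), such that every classical solution of system (S') satisfies E(t) ≤ M E(0) e^{−νt} for all t ≥ 0. -/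
open Set MeasureTheory

/-- A classical solution of system (S'): a wave equation with localized in-domain damping and
first-order dynamic (Wentzell) boundary conditions at both ends. -/
structure ClassicalSolutionS' (a q : ℝ → ℝ) (q₀ q₁ : ℝ) where
  u : ℝ → ℝ → ℝ
  ut : ℝ → ℝ → ℝ
  ux : ℝ → ℝ → ℝ
  utt : ℝ → ℝ → ℝ
  dAux : ℝ → ℝ → ℝ
  η : ℝ → ℝ
  ζ : ℝ → ℝ
  hu_t : ∀ t ∈ Ici (0:ℝ), ∀ x ∈ Icc (0:ℝ) 1, HasDerivAt (fun s => u s x) (ut t x) t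
  hu_x : ∀ t ∈ Ici (0:ℝ), ∀ x ∈ Icc (0:ℝ) 1, HasDerivAt (fun y => u t y) (ux t x) x
  hut_C1 : ContDiffOn ℝ 1 (fun p : ℝ × ℝ => ut p.1 p.2) (Ici (0:ℝ) ×ˢ Icc (0:ℝ) 1)
  hux_C1 : ContDiffOn ℝ 1 (fun p : ℝ × ℝ => ux p.1 p.2) (Ici (0:ℝ) ×ˢ Icc (0:ℝ) 1)
  hu_tt : ∀ t ∈ Ici (0:ℝ), ∀ x ∈ Icc (0:ℝ) 1, HasDerivAt (fun s => ut s x) (utt t x) t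
  haux_lip : ∀ t ∈ Ici (0:ℝ),
      ∃ K : NNReal, LipschitzOnWith K (fun x => a x * ux t x) (Icc (0:ℝ) 1)
  haux : ∀ t ∈ Ici (0:ℝ), ∀ᵐ x ∂(volume.restrict (Ioo (0:ℝ) 1)),
      HasDerivAt (fun y => a y * ux t y) (dAux t x) x
  hPDE : ∀ t ∈ Ici (0:ℝ), ∀ᵐ x ∂(volume.restrict (Ioo (0:ℝ) 1)),
      utt t x - dAux t x = - q x * ut t x
  hbc1 : ∀ t ∈ Ici (0:ℝ), ut t 1 = η t
  hbc0 : ∀ t ∈ Ici (0:ℝ), ut t 0 = ζ t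
  hηC1 : ContDiffOn ℝ 1 η (Ici (0:ℝ))
  hζC1 : ContDiffOn ℝ 1 ζ (Ici (0:ℝ))
  hode1 : ∀ t ∈ Ici (0:ℝ), HasDerivAt η (-ux t 1 - q₁ * η t) t
  hode0 : ∀ t ∈ Ici (0:ℝ), HasDerivAt ζ (ux t 0 - q₀ * ζ t) t

/-- The energy of a classical solution of system (S'). -/
noncomputable def energyS' {a q : ℝ → ℝ} {q₀ q₁ : ℝ}
    (sol : ClassicalSolutionS' a q q₀ q₁) (t : ℝ) : ℝ :=
  (1/2) * (∫ x in (0:ℝ)..1, (sol.ut t x ^ 2 + a x * sol.ux t x ^ 2))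
    + (1/2) * sol.η t ^ 2 + (1/2) * sol.ζ t ^ 2

open Filter Topology

/-- Lebesgue measure on the unit interval. -/
noncomputable abbrev unitMeasure : Measure ℝ := volume.restrict (Ioc (0:ℝ) 1)

local notation "𝓤" => unitMeasure

instance isProbabilityMeasure_unitMeasure : IsProbabilityMeasure unitMeasure :=
  ⟨by simp [unitMeasure]⟩

lemma integral_unitMeasure (f : ℝ → ℝ) : ∫ x, f x ∂𝓤 = ∫ x in (0:ℝ)..1, f x :=
  (intervalIntegral.integral_of_le zero_le_one).symm

lemma ae_unitMeasure_of_Ioo {P : ℝ → Prop}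
    (h : ∀ᵐ x ∂(volume.restrict (Ioo (0:ℝ) 1)), P x) : ∀ᵐ x ∂𝓤, P x := by
  rwa [unitMeasure, ← Measure.restrict_congr_set Ioo_ae_eq_Ioc]

lemma ae_unitMeasure_mem : ∀ᵐ x ∂𝓤, x ∈ Icc (0:ℝ) 1 := by
  filter_upwards [ae_restrict_mem measurableSet_Ioc] with x hx using Ioc_subset_Icc_self hx

lemma ae_unitMeasure_mem_Ioo : ∀ᵐ x ∂𝓤, x ∈ Ioo (0:ℝ) 1 :=
  ae_unitMeasure_of_Ioo (ae_restrict_mem measurableSet_Ioo)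

lemma Continuous.integrable_unitMeasure {f : ℝ → ℝ} (hf : Continuous f) : Integrable f 𝓤 :=
  (hf.integrableOn_Icc (a := 0) (b := 1)).mono_set Ioc_subset_Icc_self

/-- `f` is integrable on `[0,1]` with integral `I`. -/
def HasInt (f : ℝ → ℝ) (I : ℝ) : Prop := Integrable f 𝓤 ∧ ∫ x, f x ∂𝓤 = I

lemma MeasureTheory.Integrable.hasInt {f : ℝ → ℝ} (hf : Integrable f 𝓤) :
    HasInt f (∫ x, f x ∂𝓤) := ⟨hf, rfl⟩

namespace HasInt

variable {f g : ℝ → ℝ} {I J : ℝ}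

lemma add (hf : HasInt f I) (hg : HasInt g J) : HasInt (fun x => f x + g x) (I + J) :=
  ⟨hf.1.add hg.1, by rw [integral_add hf.1 hg.1, hf.2, hg.2]⟩

lemma sub (hf : HasInt f I) (hg : HasInt g J) : HasInt (fun x => f x - g x) (I - J) :=
  ⟨hf.1.sub hg.1, by rw [integral_sub hf.1 hg.1, hf.2, hg.2]⟩

lemma const_mul (hf : HasInt f I) (k : ℝ) : HasInt (fun x => k * f x) (k * I) :=
  ⟨hf.1.const_mul k, by rw [integral_const_mul, hf.2]⟩

lemma const (k : ℝ) : HasInt (fun _ => k) k := ⟨integrable_const k, by simp⟩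

lemma le (hf : HasInt f I) (hg : HasInt g J) (h : ∀ᵐ x ∂𝓤, f x ≤ g x) : I ≤ J := by
  rw [← hf.2, ← hg.2]
  exact integral_mono_ae hf.1 hg.1 h

lemma eq (hf : HasInt f I) (hg : HasInt g J) (h : ∀ᵐ x ∂𝓤, f x = g x) : I = J := by
  rw [← hf.2, ← hg.2]
  exact integral_congr_ae h

lemma nonneg (hf : HasInt f I) (h : ∀ᵐ x ∂𝓤, 0 ≤ f x) : 0 ≤ I := (const 0).le hf h

end HasInt

/-- The square of the mean is at most the mean of the square. -/
lemma sq_integral_le {f : ℝ → ℝ} (hf : Integrable f 𝓤) (hf2 : Integrable (fun x => f x ^ 2) 𝓤) :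
    (∫ x, f x ∂𝓤) ^ 2 ≤ ∫ x, f x ^ 2 ∂𝓤 := by
  set m := ∫ x, f x ∂𝓤
  have h := ((hf2.hasInt.sub (hf.hasInt.const_mul (2 * m))).add (HasInt.const (m ^ 2))).nonneg
    (ae_of_all _ fun x => by nlinarith [sq_nonneg (f x - m)])
  nlinarith

/-- A primitive is controlled by the `L²` norm. -/
lemma sq_primitive_le {f : ℝ → ℝ} (hf : Integrable f 𝓤)
    (hf2 : Integrable (fun x => f x ^ 2) 𝓤) {x : ℝ} (hx : x ∈ Icc (0:ℝ) 1) :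
    (∫ y in (0:ℝ)..x, f y) ^ 2 ≤ ∫ y, f y ^ 2 ∂𝓤 := by
  have e : ∫ y in (0:ℝ)..x, f y = ∫ y, (Iic x).indicator f y ∂𝓤 := by
    rw [intervalIntegral.integral_of_le hx.1, integral_indicator measurableSet_Iic,
      Measure.restrict_restrict measurableSet_Iic]
    congr 2
    ext y
    simp only [mem_Ioc, mem_inter_iff, mem_Iic]
    constructor
    · rintro ⟨h1, h2⟩
      exact ⟨h2, h1, h2.trans hx.2⟩
    · rintro ⟨h1, h2, -⟩
      exact ⟨h2, h1⟩
  have e2 : (fun y => (Iic x).indicator f y ^ 2) = (Iic x).indicator (fun y => f y ^ 2) := by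
    ext y
    by_cases hy : y ∈ Iic x <;> simp [indicator, hy]
  rw [e]
  refine (sq_integral_le (hf.indicator measurableSet_Iic)
    (e2 ▸ hf2.indicator measurableSet_Iic)).trans ?_
  rw [e2]
  refine integral_mono (hf2.indicator measurableSet_Iic) hf2 fun y => ?_
  exact indicator_le_self' (fun _ _ => sq_nonneg _) y

/-- `f` is absolutely continuous on `[0,1]` with almost everywhere derivative `f'`. -/
structure ACDeriv (f f' : ℝ → ℝ) : Prop where
  ac : AbsolutelyContinuousOnInterval f 0 1
  deriv : ∀ᵐ x ∂𝓤, HasDerivAt f (f' x) x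

namespace ACDeriv

variable {f f' g g' : ℝ → ℝ}

lemma ae_deriv_eq (h : ACDeriv f f') : ∀ᵐ x ∂𝓤, _root_.deriv f x = f' x := by
  filter_upwards [h.deriv] with x hx using hx.deriv

lemma integrable (h : ACDeriv f f') : Integrable f' 𝓤 := by
  have := h.ac.intervalIntegrable_deriv
  rw [intervalIntegrable_iff_integrableOn_Ioc_of_le zero_le_one] at this
  exact this.congr h.ae_deriv_eq

lemma integral_eq (h : ACDeriv f f') : ∫ x, f' x ∂𝓤 = f 1 - f 0 := by
  rw [← h.ac.integral_deriv_eq_sub, ← integral_unitMeasure]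
  exact integral_congr_ae (h.ae_deriv_eq.mono fun x hx => hx.symm)

lemma primitive_eq (h : ACDeriv f f') {x : ℝ} (hx : x ∈ Icc (0:ℝ) 1) :
    ∫ y in (0:ℝ)..x, f' y = f x - f 0 := by
  have hac : AbsolutelyContinuousOnInterval f 0 x :=
    h.ac.mono (by rw [uIcc_of_le hx.1, uIcc_of_le zero_le_one]; exact Icc_subset_Icc_right hx.2)
  rw [← hac.integral_deriv_eq_sub, intervalIntegral.integral_of_le hx.1,
    intervalIntegral.integral_of_le hx.1]
  refine integral_congr_ae ?_
  filter_upwards [ae_mono (Measure.restrict_mono (Ioc_subset_Ioc_right hx.2) le_rfl)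
    h.ae_deriv_eq] with y hy using hy.symm

lemma mul (hf : ACDeriv f f') (hg : ACDeriv g g') :
    ACDeriv (fun x => f x * g x) (fun x => f' x * g x + f x * g' x) :=
  ⟨hf.ac.fun_mul hg.ac, by
    filter_upwards [hf.deriv, hg.deriv] with x h1 h2 using h1.mul h2⟩

lemma sub_const (hf : ACDeriv f f') (k : ℝ) : ACDeriv (fun x => f x - k) f' :=
  ⟨hf.ac.fun_sub (LipschitzWith.const k).lipschitzOnWith.absolutelyContinuousOnInterval, by
    filter_upwards [hf.deriv] with x h1 using h1.sub_const k⟩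

lemma of_hasDerivAt (h : ∀ x, HasDerivAt f (f' x) x) (hc : Continuous f') : ACDeriv f f' := by
  refine ⟨ContDiffOn.absolutelyContinuousOnInterval (ContDiff.contDiffOn ?_), ae_of_all _ h⟩
  have : _root_.deriv f = f' := funext fun x => (h x).deriv
  rw [contDiff_one_iff_deriv, this]
  exact ⟨fun x => (h x).differentiableAt, hc⟩

lemma of_primitive {k : ℝ} (hc : Continuous f')
    (h : ∀ x ∈ Icc (0:ℝ) 1, f x = k + ∫ y in (0:ℝ)..x, f' y) : ACDeriv f f' := by
  have hd : ∀ x, HasDerivAt (fun x => k + ∫ y in (0:ℝ)..x, f' y) (f' x) x := fun x =>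
    (intervalIntegral.integral_hasDerivAt_right (hc.intervalIntegrable _ _)
      (hc.stronglyMeasurableAtFilter _ _) hc.continuousAt).const_add k
  have hcd : ContDiff ℝ 1 (fun x => k + ∫ y in (0:ℝ)..x, f' y) := by
    have : _root_.deriv (fun x => k + ∫ y in (0:ℝ)..x, f' y) = f' := funext fun x => (hd x).deriv
    rw [contDiff_one_iff_deriv, this]
    exact ⟨fun x => (hd x).differentiableAt, hc⟩
  refine ⟨ContDiffOn.absolutelyContinuousOnInterval (hcd.contDiffOn.congr fun x hx => ?_), ?_⟩
  · rw [uIcc_of_le zero_le_one] at hx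
    exact h x hx
  · filter_upwards [ae_unitMeasure_mem_Ioo] with x hx
    refine (hd x).congr_of_eventuallyEq ?_
    filter_upwards [isOpen_Ioo.mem_nhds hx] with y hy using h y (Ioo_subset_Icc_self hy)

end ACDeriv

/-- `f` and `ft` are jointly continuous and `ft` is the derivative of `f` in the first variable at
positive times. -/
structure TimeDeriv (f ft : ℝ → ℝ → ℝ) : Prop where
  cont : Continuous fun z : ℝ × ℝ => f z.1 z.2
  cont' : Continuous fun z : ℝ × ℝ => ft z.1 z.2
  deriv : ∀ t > 0, ∀ x, HasDerivAt (fun s => f s x) (ft t x) t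

namespace TimeDeriv

variable {f ft g gt : ℝ → ℝ → ℝ}

lemma cont_right (hf : TimeDeriv f ft) (t : ℝ) : Continuous (f t) :=
  hf.cont.comp (by fun_prop : Continuous fun x : ℝ => (t, x))

lemma cont'_right (hf : TimeDeriv f ft) (t : ℝ) : Continuous (ft t) :=
  hf.cont'.comp (by fun_prop : Continuous fun x : ℝ => (t, x))

lemma cont_left (hf : TimeDeriv f ft) (x : ℝ) : Continuous fun t => f t x :=
  hf.cont.comp (by fun_prop : Continuous fun t : ℝ => (t, x))

lemma mul (hf : TimeDeriv f ft) (hg : TimeDeriv g gt) :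
    TimeDeriv (fun t x => f t x * g t x) (fun t x => ft t x * g t x + f t x * gt t x) :=
  ⟨hf.cont.mul hg.cont, (hf.cont'.mul hg.cont).add (hf.cont.mul hg.cont'),
    fun t ht x => (hf.deriv t ht x).mul (hg.deriv t ht x)⟩

lemma add (hf : TimeDeriv f ft) (hg : TimeDeriv g gt) :
    TimeDeriv (fun t x => f t x + g t x) (fun t x => ft t x + gt t x) :=
  ⟨hf.cont.add hg.cont, hf.cont'.add hg.cont',
    fun t ht x => (hf.deriv t ht x).add (hg.deriv t ht x)⟩

lemma sub (hf : TimeDeriv f ft) (hg : TimeDeriv g gt) :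
    TimeDeriv (fun t x => f t x - g t x) (fun t x => ft t x - gt t x) :=
  ⟨hf.cont.sub hg.cont, hf.cont'.sub hg.cont',
    fun t ht x => (hf.deriv t ht x).sub (hg.deriv t ht x)⟩

lemma space_mul {r : ℝ → ℝ} (hr : Continuous r) (hf : TimeDeriv f ft) :
    TimeDeriv (fun t x => r x * f t x) (fun t x => r x * ft t x) :=
  ⟨(hr.comp continuous_snd).mul hf.cont, (hr.comp continuous_snd).mul hf.cont',
    fun t ht x => (hf.deriv t ht x).const_mul _⟩

/-- Differentiation under an integral over `[0,b]`. -/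
lemma hasDerivAt_intervalIntegral (hf : TimeDeriv f ft) (b : ℝ) {t : ℝ} (ht : 0 < t) :
    HasDerivAt (fun s => ∫ x in (0:ℝ)..b, f s x) (∫ x in (0:ℝ)..b, ft t x) t := by
  obtain ⟨K, hK⟩ := ((isCompact_Icc (a := t / 2) (b := 2 * t)).prod
    (isCompact_uIcc (a := (0:ℝ)) (b := b))).exists_bound_of_continuousOn hf.cont'.continuousOn
  refine (intervalIntegral.hasDerivAt_integral_of_dominated_loc_of_deriv_le
    (bound := fun _ => K) (s := Icc (t / 2) (2 * t)) (Icc_mem_nhds (by linarith) (by linarith))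
    (Eventually.of_forall fun s => (hf.cont_right s).aestronglyMeasurable)
    ((hf.cont_right t).intervalIntegrable _ _) (hf.cont'_right t).aestronglyMeasurable
    (ae_of_all _ fun x hx s hs => hK (s, x) ⟨hs, uIoc_subset_uIcc hx⟩)
    intervalIntegrable_const
    (ae_of_all _ fun x _ s hs => hf.deriv s (by linarith [hs.1]) x)).2

lemma primitive (hf : TimeDeriv f ft) :
    TimeDeriv (fun t x => ∫ y in (0:ℝ)..x, f t y) (fun t x => ∫ y in (0:ℝ)..x, ft t y) := by
  refine ⟨?_, ?_, fun t ht x => hf.hasDerivAt_intervalIntegral x ht⟩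
  · exact intervalIntegral.continuous_parametric_intervalIntegral_of_continuous
      (f := fun (z : ℝ × ℝ) y => f z.1 y)
      (hf.cont.comp (by fun_prop : Continuous fun z : (ℝ × ℝ) × ℝ => (z.1.1, z.2))) continuous_snd
  · exact intervalIntegral.continuous_parametric_intervalIntegral_of_continuous
      (f := fun (z : ℝ × ℝ) y => ft z.1 y)
      (hf.cont'.comp (by fun_prop : Continuous fun z : (ℝ × ℝ) × ℝ => (z.1.1, z.2))) continuous_snd

/-- The integral over `[0,1]`, seen as a function of time which is constant in space. -/
lemma integral (hf : TimeDeriv f ft) :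
    TimeDeriv (fun t _ => ∫ y, f t y ∂𝓤) (fun t _ => ∫ y, ft t y ∂𝓤) := by
  have h := hf.primitive
  simp only [integral_unitMeasure]
  exact ⟨h.cont.comp (by fun_prop : Continuous fun z : ℝ × ℝ => (z.1, (1:ℝ))),
    h.cont'.comp (by fun_prop : Continuous fun z : ℝ × ℝ => (z.1, (1:ℝ))),
    fun t ht x => h.deriv t ht 1⟩

lemma at_point (hf : TimeDeriv f ft) (x₀ : ℝ) :
    TimeDeriv (fun t _ => f t x₀) (fun t _ => ft t x₀) :=
  ⟨hf.cont.comp (by fun_prop : Continuous fun z : ℝ × ℝ => (z.1, x₀)),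
    hf.cont'.comp (by fun_prop : Continuous fun z : ℝ × ℝ => (z.1, x₀)),
    fun t ht _ => hf.deriv t ht x₀⟩

lemma const_mul (hf : TimeDeriv f ft) (k : ℝ) :
    TimeDeriv (fun t x => k * f t x) (fun t x => k * ft t x) :=
  hf.space_mul (r := fun _ => k) continuous_const

lemma neg (hf : TimeDeriv f ft) : TimeDeriv (fun t x => -f t x) (fun t x => -ft t x) :=
  ⟨hf.cont.neg, hf.cont'.neg, fun t ht x => (hf.deriv t ht x).neg⟩

end TimeDeriv

lemma Continuous.hasInt {f : ℝ → ℝ} (hf : Continuous f) : HasInt f (∫ x, f x ∂𝓤) :=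
  hf.integrable_unitMeasure.hasInt

lemma ACDeriv.hasInt {f f' : ℝ → ℝ} (h : ACDeriv f f') : HasInt f' (f 1 - f 0) :=
  ⟨h.integrable, h.integral_eq⟩

lemma sq_integral_le_of_continuous {f : ℝ → ℝ} (hf : Continuous f) :
    (∫ x, f x ∂𝓤) ^ 2 ≤ ∫ x, f x ^ 2 ∂𝓤 :=
  sq_integral_le hf.integrable_unitMeasure (hf.pow 2).integrable_unitMeasure

/-- Coefficients `A`, `q` on the unit interval together with the weights of the multiplier method:
`ρ` is a normalized bump function living where the damping `q` is effective, `σ = A ρ`, and `g`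
vanishes at both ends and increases, along with `g A`, away from the support of `ρ`. -/
structure Multipliers (A A' q ρ σ σ' g g' : ℝ → ℝ) (α C : ℝ) : Prop where
  one_le : 1 ≤ C
  α_pos : 0 < α
  A_cont : Continuous A
  A_lower : ∀ x, α ≤ A x
  A_upper : ∀ x, A x ≤ C
  A_deriv : ACDeriv A A'
  q_meas : Measurable q
  q_nonneg : ∀ᵐ x ∂𝓤, 0 ≤ q x
  q_le : ∀ᵐ x ∂𝓤, q x ≤ C
  ρ_cont : Continuous ρ
  ρ_nonneg : ∀ x, 0 ≤ ρ x
  ρ_le : ∀ x ∈ Icc (0:ℝ) 1, ρ x ≤ C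
  ρ_integral : ∫ x, ρ x ∂𝓤 = 1
  σ_eq : ∀ x, σ x = A x * ρ x
  σ_deriv : ACDeriv σ σ'
  σ'_cont : Continuous σ'
  σ_zero : σ 0 = 0
  σ_one : σ 1 = 0
  σ_le : ∀ᵐ x ∂𝓤, σ x ≤ C * q x
  σ'_le : ∀ᵐ x ∂𝓤, σ' x ^ 2 ≤ C * q x
  g_deriv : ACDeriv g g'
  g_cont : Continuous g
  g_zero : g 0 = 0
  g_one : g 1 = 0
  g_le : ∀ x ∈ Icc (0:ℝ) 1, |g x| ≤ C
  g'_ge : ∀ᵐ x ∂𝓤, 1 - C * ρ x ≤ g' x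
  gA'_ge : ∀ᵐ x ∂𝓤, 1 - C * σ x ≤ g' x * A x + g x * A' x

/-- The state of the damped wave equation at a fixed time: `v` is the velocity, `p` the flux,
`w` and `s` are their time derivatives. -/
structure Snapshot (A q : ℝ → ℝ) (q₀ q₁ : ℝ) (v w p s : ℝ → ℝ) : Prop where
  v_cont : Continuous v
  w_cont : Continuous w
  p_cont : Continuous p
  s_cont : Continuous s
  v_deriv : ACDeriv v (fun x => s x / A x)
  p_deriv : ACDeriv p (fun x => w x + q x * v x)
  bc_one : A 1 * w 1 = -p 1 - A 1 * q₁ * v 1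
  bc_zero : A 0 * w 0 = p 0 - A 0 * q₀ * v 0

/-- The deviation of `p` from its `ρ`-mean. -/
noncomputable def fluctuation (ρ p : ℝ → ℝ) (x : ℝ) : ℝ := p x - ∫ y, ρ y * p y ∂𝓤

lemma continuous_fluctuation (ρ : ℝ → ℝ) {p : ℝ → ℝ} (hp : Continuous p) :
    Continuous (fluctuation ρ p) := hp.sub continuous_const

namespace Multipliers

variable {A A' q ρ σ σ' g g' : ℝ → ℝ} {α C : ℝ}

lemma A_pos (M : Multipliers A A' q ρ σ σ' g g' α C) (x : ℝ) : 0 < A x :=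
  M.α_pos.trans_le (M.A_lower x)

lemma q_mul (M : Multipliers A A' q ρ σ σ' g g' α C) {f : ℝ → ℝ} (hf : Integrable f 𝓤) :
    Integrable (fun x => q x * f x) 𝓤 :=
  hf.bdd_mul (c := C) M.q_meas.aestronglyMeasurable (by
    filter_upwards [M.q_nonneg, M.q_le] with x h0 h1
    rwa [Real.norm_eq_abs, abs_of_nonneg h0])

lemma q_mul_hasInt (M : Multipliers A A' q ρ σ σ' g g' α C) {f : ℝ → ℝ} (hf : Continuous f) :
    HasInt (fun x => q x * f x) (∫ x, q x * f x ∂𝓤) :=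
  (M.q_mul hf.integrable_unitMeasure).hasInt

lemma damping_nonneg (M : Multipliers A A' q ρ σ σ' g g' α C) (v : ℝ → ℝ) :
    0 ≤ ∫ x, q x * v x ^ 2 ∂𝓤 :=
  integral_nonneg_of_ae (M.q_nonneg.mono fun _ hx => mul_nonneg hx (sq_nonneg _))

lemma integral_fluctuation (M : Multipliers A A' q ρ σ σ' g g' α C) {p : ℝ → ℝ}
    (hp : Continuous p) : ∫ x, ρ x * fluctuation ρ p x ∂𝓤 = 0 := by
  have h1 := (M.ρ_cont.mul hp).hasInt.sub
    (M.ρ_cont.hasInt.const_mul (∫ y, ρ y * p y ∂𝓤))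
  have h2 := (M.ρ_cont.mul (continuous_fluctuation ρ hp)).hasInt.eq h1
    (ae_of_all _ fun x => by simp only [fluctuation, Pi.mul_apply]; ring)
  simp only [Pi.mul_apply, M.ρ_integral] at h2
  rw [h2]
  ring

lemma sq_mean_le (M : Multipliers A A' q ρ σ σ' g g' α C) {p : ℝ → ℝ} (hp : Continuous p) :
    (∫ x, ρ x * p x ∂𝓤) ^ 2 ≤ C ^ 2 * ∫ x, p x ^ 2 ∂𝓤 := by
  refine (sq_integral_le_of_continuous (M.ρ_cont.mul hp)).trans ?_
  refine ((M.ρ_cont.mul hp).pow 2).hasInt.le ((hp.pow 2).hasInt.const_mul _) ?_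
  filter_upwards [ae_unitMeasure_mem] with x hx
  simp only [Pi.pow_apply, Pi.mul_apply, mul_pow]
  exact mul_le_mul_of_nonneg_right (pow_le_pow_left₀ (M.ρ_nonneg x) (M.ρ_le x hx) 2) (sq_nonneg _)

/-- A weighted damping term is controlled by the dissipation. -/
lemma sq_primitive_damping_le (M : Multipliers A A' q ρ σ σ' g g' α C) {v : ℝ → ℝ}
    (hv : Continuous v) {x : ℝ} (hx : x ∈ Icc (0:ℝ) 1) :
    (∫ y in (0:ℝ)..x, q y * v y) ^ 2 ≤ C * ∫ y, q y * v y ^ 2 ∂𝓤 := by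
  have h2 : Integrable (fun y => (q y * v y) ^ 2) 𝓤 :=
    (M.q_mul (M.q_mul (hv.pow 2).integrable_unitMeasure)).congr
      (ae_of_all _ fun y => by simp only [Pi.pow_apply]; ring)
  refine (sq_primitive_le (M.q_mul hv.integrable_unitMeasure) h2 hx).trans ?_
  refine h2.hasInt.le ((M.q_mul_hasInt (hv.pow 2)).const_mul C) ?_
  filter_upwards [M.q_nonneg, M.q_le] with y h0 h1
  have : 0 ≤ (C - q y) * (q y * v y ^ 2) :=
    mul_nonneg (by linarith) (mul_nonneg h0 (sq_nonneg _))
  simp only [Pi.pow_apply]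
  linarith

end Multipliers

namespace Snapshot

variable {A A' q ρ σ σ' g g' v w p s : ℝ → ℝ} {α C q₀ q₁ : ℝ}

/-- The energy identity. -/
lemma energy_identity (M : Multipliers A A' q ρ σ σ' g g' α C) (S : Snapshot A q q₀ q₁ v w p s) :
    ∫ x, ((w x * v x + v x * w x) + (A x)⁻¹ * (s x * p x + p x * s x)) ∂𝓤
      + A 1 * (w 1 * v 1 + v 1 * w 1) + A 0 * (w 0 * v 0 + v 0 * w 0)
      = -2 * (∫ x, q x * v x ^ 2 ∂𝓤 + A 1 * q₁ * v 1 ^ 2 + A 0 * q₀ * v 0 ^ 2) := by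
  have hA : Continuous fun x => (A x)⁻¹ := M.A_cont.inv₀ fun x => (M.A_pos x).ne'
  have h1 := ((S.v_deriv.mul S.p_deriv).hasInt.sub (M.q_mul_hasInt (S.v_cont.pow 2))).const_mul 2
  have hc : Continuous fun x => (w x * v x + v x * w x) + (A x)⁻¹ * (s x * p x + p x * s x) :=
    ((S.w_cont.mul S.v_cont).add (S.v_cont.mul S.w_cont)).add
      (hA.mul ((S.s_cont.mul S.p_cont).add (S.p_cont.mul S.s_cont)))
  have h2 := hc.hasInt.eq h1 (ae_of_all _ fun x => by simp only [Pi.pow_apply]; ring)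
  rw [h2]
  simp only [Pi.pow_apply]
  linear_combination (2 * v 1) * S.bc_one + (2 * v 0) * S.bc_zero

/-- The `ρ`-mean of the flux varies slowly. -/
lemma sq_mean_deriv_le (M : Multipliers A A' q ρ σ σ' g g' α C)
    (S : Snapshot A q q₀ q₁ v w p s) :
    (∫ x, ρ x * s x ∂𝓤) ^ 2 ≤ C * ∫ x, q x * v x ^ 2 ∂𝓤 := by
  have h1 := (S.v_deriv.mul M.σ_deriv).hasInt.sub (S.v_cont.mul M.σ'_cont).hasInt
  have h2 := (M.ρ_cont.mul S.s_cont).hasInt.eq h1 (ae_of_all _ fun x => by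
    have := (M.A_pos x).ne'
    simp only [M.σ_eq x, Pi.mul_apply]
    field_simp
    ring)
  simp only [Pi.mul_apply, M.σ_zero, M.σ_one] at h2
  have h3 : (∫ x, ρ x * s x ∂𝓤) ^ 2 = (∫ x, v x * σ' x ∂𝓤) ^ 2 := by
    rw [h2]
    ring
  rw [h3]
  refine (sq_integral_le_of_continuous (S.v_cont.mul M.σ'_cont)).trans ?_
  refine ((S.v_cont.mul M.σ'_cont).pow 2).hasInt.le
    ((M.q_mul_hasInt (S.v_cont.pow 2)).const_mul C) ?_
  filter_upwards [M.σ'_le] with x hx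
  simp only [Pi.pow_apply, Pi.mul_apply]
  nlinarith [mul_le_mul_of_nonneg_right hx (sq_nonneg (v x))]

/-- The local multiplier controlling the fluctuation of the flux where the damping acts. -/
lemma local_estimate (M : Multipliers A A' q ρ σ σ' g g' α C) (S : Snapshot A q q₀ q₁ v w p s)
    {ε : ℝ} (hε : 0 < ε) :
    -∫ x, ((∫ y in (0:ℝ)..x, w y) * (ρ x * fluctuation ρ p x)
        + (∫ y in (0:ℝ)..x, v y) * (ρ x * fluctuation ρ s x)) ∂𝓤
      ≤ -(1 / 2) * (∫ x, ρ x * fluctuation ρ p x ^ 2 ∂𝓤) + ε * ∫ x, v x ^ 2 ∂𝓤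
        + (2 * C + C / ε) * ∫ x, q x * v x ^ 2 ∂𝓤 := by
  have hfp := continuous_fluctuation ρ S.p_cont
  have hfs := continuous_fluctuation ρ S.s_cont
  have hV : ACDeriv (fun x => ∫ y in (0:ℝ)..x, v y) v :=
    ACDeriv.of_primitive (k := 0) S.v_cont fun _ _ => by simp
  have hVc : Continuous fun x => ∫ y in (0:ℝ)..x, v y :=
    intervalIntegral.continuous_primitive (fun a b => S.v_cont.intervalIntegrable a b) 0
  have hWc : Continuous fun x => ∫ y in (0:ℝ)..x, w y :=
    intervalIntegral.continuous_primitive (fun a b => S.w_cont.intervalIntegrable a b) 0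
  have hexact := ((hV.mul M.σ_deriv).mul S.v_deriv).hasInt
  have hP := S.sq_mean_deriv_le M
  set B := ∫ x, q x * v x ^ 2 ∂𝓤 with hB
  set n := ∫ x, v x ^ 2 ∂𝓤 with hn
  set P₁ := ∫ x, ρ x * s x ∂𝓤 with hP₁
  set P := ∫ x, ρ x * p x ∂𝓤 with hP₀
  have hl := hexact.sub ((hWc.mul (M.ρ_cont.mul hfp)).add (hVc.mul (M.ρ_cont.mul hfs))).hasInt
  have hr0 := M.ρ_cont.hasInt.const_mul (C * B / 2 + ε / 2 * n + C * B / (2 * ε))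
  have hr1 := (M.ρ_cont.mul (hfp.pow 2)).hasInt.const_mul (-(1 / 2))
  have hr2 := (M.ρ_cont.mul hfp).hasInt.const_mul (p 0 - P)
  have hr3 := (M.q_mul_hasInt (S.v_cont.pow 2)).const_mul (C + C / (2 * ε))
  have hr := (((hr0.add hr1).add hr2).add hr3).add (HasInt.const (ε / 2 * n))
  have key := hl.le hr (by
    filter_upwards [ae_unitMeasure_mem, M.σ_le, M.σ'_le] with x hx hσ hσ'
    have hVn : (∫ y in (0:ℝ)..x, v y) ^ 2 ≤ n :=
      sq_primitive_le S.v_cont.integrable_unitMeasure (S.v_cont.pow 2).integrable_unitMeasure hx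
    have hQ := M.sq_primitive_damping_le S.v_cont hx
    have hWeq : ∫ y in (0:ℝ)..x, w y = p x - p 0 - ∫ y in (0:ℝ)..x, q y * v y := by
      rw [← S.p_deriv.primitive_eq hx, intervalIntegral.integral_add
        (S.w_cont.intervalIntegrable _ _)]
      · ring
      · rw [intervalIntegrable_iff_integrableOn_Ioc_of_le hx.1]
        exact IntegrableOn.mono_set (M.q_mul S.v_cont.integrable_unitMeasure)
          (Ioc_subset_Ioc_right hx.2)
    have hA := (M.A_pos x).ne'
    simp only [Pi.add_apply, Pi.mul_apply, Pi.pow_apply, hWeq]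
    set V := ∫ y in (0:ℝ)..x, v y
    set W := ∫ y in (0:ℝ)..x, q y * v y
    have e1 : fluctuation ρ s x = s x - P₁ := rfl
    have e2 : p x = fluctuation ρ p x + P := by simp [fluctuation, hP₀]
    have e3 : V * σ x * (s x / A x) = V * ρ x * s x := by
      rw [M.σ_eq x]
      field_simp
    rw [e1, e2, e3]
    set f := fluctuation ρ p x
    have hρ := M.ρ_nonneg x
    have i1 : ρ x * (W * f) ≤ ρ x * (C * B / 2 + f ^ 2 / 2) :=
      mul_le_mul_of_nonneg_left (by nlinarith [sq_nonneg (W - f)]) hρ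
    have i2 : ∀ a b c d : ℝ, a ^ 2 ≤ c → b ^ 2 ≤ d → a * b ≤ ε / 2 * c + d / (2 * ε) := by
      intro a b c d hac hbd
      have h1 : a * b ≤ ε / 2 * a ^ 2 + b ^ 2 / (2 * ε) := by
        have : ε / 2 * a ^ 2 + b ^ 2 / (2 * ε) - a * b = (ε * a - b) ^ 2 / (2 * ε) := by
          field_simp
          ring
        have h2 : 0 ≤ (ε * a - b) ^ 2 / (2 * ε) := by positivity
        linarith
      have h2 : ε / 2 * a ^ 2 ≤ ε / 2 * c := by gcongr
      have h3 : b ^ 2 / (2 * ε) ≤ d / (2 * ε) := by gcongr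
      linarith
    have i3 := mul_le_mul_of_nonneg_left (i2 V P₁ n (C * B) hVn hP) hρ
    have i4 := i2 V (σ' x * v x) n (C * q x * v x ^ 2) hVn (by
      rw [mul_pow]
      exact mul_le_mul_of_nonneg_right hσ' (sq_nonneg _))
    have i5 := mul_le_mul_of_nonneg_right hσ (sq_nonneg (v x))
    have e4 : C * q x * v x ^ 2 / (2 * ε) = C / (2 * ε) * (q x * v x ^ 2) := by ring
    rw [e4] at i4
    nlinarith)
  simp only [Pi.add_apply, Pi.mul_apply, Pi.pow_apply, M.σ_one, M.σ_zero, M.ρ_integral,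
    M.integral_fluctuation S.p_cont, ← hB] at key ⊢
  have e : C * B / (2 * ε) = C / (2 * ε) * B := by ring
  have e' : C / ε * B = 2 * (C / (2 * ε) * B) := by field_simp
  have e'' : (2 * C + C / ε) * B = 2 * C * B + C / ε * B := by ring
  rw [e] at key
  rw [e'', e']
  have : 0 ≤ C * B := by
    have := M.damping_nonneg v
    have := M.one_le
    positivity
  nlinarith

/-- The global multiplier, whose weight vanishes at both ends. -/
lemma global_estimate (M : Multipliers A A' q ρ σ σ' g g' α C)
    (S : Snapshot A q q₀ q₁ v w p s) :
    ∫ x, g x * (w x * fluctuation ρ p x + v x * fluctuation ρ s x) ∂𝓤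
      ≤ -(1 / 4) * (∫ x, v x ^ 2 ∂𝓤 + ∫ x, fluctuation ρ p x ^ 2 ∂𝓤)
        + C / 2 * (∫ x, ρ x * fluctuation ρ p x ^ 2 ∂𝓤)
        + (2 * C ^ 3 + C ^ 2 / 2) * ∫ x, q x * v x ^ 2 ∂𝓤 := by
  have hfp := continuous_fluctuation ρ S.p_cont
  have hfs := continuous_fluctuation ρ S.s_cont
  have hfd : ACDeriv (fluctuation ρ p) _ := S.p_deriv.sub_const (∫ y, ρ y * p y ∂𝓤)
  have hE1 := (M.g_deriv.mul (hfd.mul hfd)).hasInt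
  have hE2 := ((M.g_deriv.mul M.A_deriv).mul (S.v_deriv.mul S.v_deriv)).hasInt
  have hP := S.sq_mean_deriv_le M
  set B := ∫ x, q x * v x ^ 2 ∂𝓤 with hB
  set P₁ := ∫ x, ρ x * s x ∂𝓤 with hP₁
  have hl := ((M.g_cont.mul ((S.w_cont.mul hfp).add (S.v_cont.mul hfs))).hasInt.sub
    (hE1.const_mul (1 / 2))).sub (hE2.const_mul (1 / 2))
  have hr := ((((S.v_cont.pow 2).hasInt.add (hfp.pow 2).hasInt).const_mul (-(1 / 4))).add
    ((M.ρ_cont.mul (hfp.pow 2)).hasInt.const_mul (C / 2))).add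
    ((M.q_mul_hasInt (S.v_cont.pow 2)).const_mul (C ^ 3 + C ^ 2 / 2)) |>.add
    (HasInt.const (C ^ 3 * B))
  have key := hl.le hr (by
    filter_upwards [ae_unitMeasure_mem, M.σ_le, M.g'_ge, M.gA'_ge, M.q_nonneg, M.q_le]
      with x hx hσ hg' hgA' hq0 hqC
    have hA := (M.A_pos x).ne'
    have hg := M.g_le x hx
    have hC : 0 ≤ C := by linarith [M.one_le]
    simp only [Pi.add_apply, Pi.mul_apply, Pi.pow_apply]
    have e1 : fluctuation ρ s x = s x - P₁ := rfl
    have e3 : g x * A x * (s x / A x * v x + v x * (s x / A x)) = 2 * (g x * v x * s x) := by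
      field_simp
      ring
    rw [e1, e3]
    set f := fluctuation ρ p x
    have hg2 : g x ^ 2 ≤ C ^ 2 := sq_le_sq' (by linarith [neg_abs_le (g x)]) (by
      linarith [le_abs_self (g x)])
    have i1 := mul_le_mul_of_nonneg_right hg' (sq_nonneg f)
    have i2 := mul_le_mul_of_nonneg_right hgA' (sq_nonneg (v x))
    have i3 : C * σ x * v x ^ 2 ≤ C ^ 2 * (q x * v x ^ 2) := by
      have := mul_le_mul_of_nonneg_left (mul_le_mul_of_nonneg_right hσ (sq_nonneg (v x))) hC
      linarith
    have i4 : -(g x * (q x * v x) * f) ≤ 1 / 4 * f ^ 2 + C ^ 3 * (q x * v x ^ 2) := by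
      have h1 : g x ^ 2 * (q x * (q x * v x ^ 2)) ≤ C ^ 2 * (C * (q x * v x ^ 2)) := by
        have : 0 ≤ q x * v x ^ 2 := by positivity
        gcongr
      nlinarith [sq_nonneg (1 / 2 * f + g x * (q x * v x))]
    have i5 : -(g x * v x * P₁) ≤ 1 / 4 * v x ^ 2 + C ^ 3 * B := by
      have h1 : g x ^ 2 * P₁ ^ 2 ≤ C ^ 2 * (C * B) := by gcongr
      nlinarith [sq_nonneg (1 / 2 * v x + g x * P₁)]
    nlinarith)
  simp only [Pi.add_apply, Pi.mul_apply, Pi.pow_apply, M.g_one, M.g_zero, ← hB] at key ⊢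
  linarith

lemma mean_estimate_aux {C B n m J P P₁ H K A₁ p₁ v₁ q₁ : ℝ} (hC : 1 ≤ C) (hB : 0 ≤ B)
    (hP : P₁ ^ 2 ≤ C * B) (hJ : J ^ 2 ≤ m) (hS : K ^ 2 ≤ n) (hH : H ^ 2 ≤ C * B)
    (hA : (A₁ * v₁) ^ 2 ≤ C ^ 2 * v₁ ^ 2) :
    P₁ * (A₁ * v₁ + K) + P * (-p₁ - A₁ * q₁ * v₁ + (p₁ - J - P - H))
      ≤ -(1 / 2) * P ^ 2 + 2 * (n + m) + (3 * C + 2 * C ^ 2 * (1 + q₁ ^ 2)) * (B + v₁ ^ 2) := by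
  have hn : 0 ≤ n := (sq_nonneg _).trans hS
  have hm : 0 ≤ m := (sq_nonneg _).trans hJ
  have hbq : (A₁ * v₁ * q₁) ^ 2 ≤ C ^ 2 * v₁ ^ 2 * q₁ ^ 2 := by
    rw [mul_pow]
    gcongr
  have t1 := two_mul_le_add_sq P₁ (A₁ * v₁)
  have t2 := two_mul_le_add_sq P₁ K
  have t3 := sq_nonneg (P + 3 * (A₁ * v₁ * q₁))
  have t4 := sq_nonneg (P + 3 * J)
  have t5 := sq_nonneg (P + 3 * H)
  have u1 : 0 ≤ C ^ 2 * v₁ ^ 2 := by positivity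
  have u2 : 0 ≤ C ^ 2 * v₁ ^ 2 * q₁ ^ 2 := by positivity
  have u3 : 0 ≤ C * B := by positivity
  have u4 : 0 ≤ C * v₁ ^ 2 := by positivity
  have u5 : 0 ≤ C ^ 2 * B := by positivity
  have u6 : 0 ≤ C ^ 2 * B * q₁ ^ 2 := by positivity
  linarith

/-- The multiplier controlling the mean of the flux through the boundary condition. -/
lemma mean_estimate (M : Multipliers A A' q ρ σ σ' g g' α C) (S : Snapshot A q q₀ q₁ v w p s) :
    (∫ x, ρ x * s x ∂𝓤) * (A 1 * v 1 + ∫ x, x * v x ∂𝓤)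
        + (∫ x, ρ x * p x ∂𝓤) * (A 1 * w 1 + ∫ x, x * w x ∂𝓤)
      ≤ -(1 / 2) * (∫ x, ρ x * p x ∂𝓤) ^ 2
        + 2 * (∫ x, v x ^ 2 ∂𝓤 + ∫ x, fluctuation ρ p x ^ 2 ∂𝓤)
        + (3 * C + 2 * C ^ 2 * (1 + q₁ ^ 2)) * (∫ x, q x * v x ^ 2 ∂𝓤 + v 1 ^ 2) := by
  have hfp := continuous_fluctuation ρ S.p_cont
  have hid : ACDeriv (fun x : ℝ => x) (fun _ => 1) :=
    ACDeriv.of_hasDerivAt (fun x => hasDerivAt_id x) continuous_const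
  have hxw : Continuous fun x => x * w x := continuous_id.mul S.w_cont
  have hxv : Continuous fun x => x * v x := continuous_id.mul S.v_cont
  have hJ := sq_integral_le_of_continuous hfp
  have hP := S.sq_mean_deriv_le M
  have hS : (∫ x, x * v x ∂𝓤) ^ 2 ≤ ∫ x, v x ^ 2 ∂𝓤 := by
    refine (sq_integral_le_of_continuous hxv).trans ?_
    refine (hxv.pow 2).hasInt.le (S.v_cont.pow 2).hasInt ?_
    filter_upwards [ae_unitMeasure_mem] with x hx
    have : x ^ 2 ≤ 1 := by nlinarith [hx.1, hx.2]
    simp only [Pi.pow_apply, mul_pow]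
    nlinarith [mul_le_mul_of_nonneg_right this (sq_nonneg (v x))]
  have hH : (∫ x, q x * (x * v x) ∂𝓤) ^ 2 ≤ C * ∫ x, q x * v x ^ 2 ∂𝓤 := by
    rw [integral_unitMeasure (fun x => q x * (x * v x))]
    refine (M.sq_primitive_damping_le hxv (right_mem_Icc.2 zero_le_one)).trans ?_
    refine mul_le_mul_of_nonneg_left ?_ (by linarith [M.one_le])
    refine (M.q_mul_hasInt (hxv.pow 2)).le (M.q_mul_hasInt (S.v_cont.pow 2)) ?_
    filter_upwards [ae_unitMeasure_mem, M.q_nonneg] with x hx hq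
    have : x ^ 2 ≤ 1 := by nlinarith [hx.1, hx.2]
    simp only [Pi.pow_apply, mul_pow]
    refine mul_le_mul_of_nonneg_left ?_ hq
    nlinarith [mul_le_mul_of_nonneg_right this (sq_nonneg (v x))]
  have hw : ∫ x, x * w x ∂𝓤 = p 1 - (∫ x, fluctuation ρ p x ∂𝓤) - (∫ x, ρ x * p x ∂𝓤)
      - ∫ x, q x * (x * v x) ∂𝓤 := by
    have h := hxw.hasInt.eq ((((hid.mul S.p_deriv).hasInt.sub hfp.hasInt).sub
      (HasInt.const (∫ x, ρ x * p x ∂𝓤))).sub (M.q_mul_hasInt hxv))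
      (ae_of_all _ fun x => by simp only [fluctuation]; ring)
    rw [h]
    ring
  have hB := M.damping_nonneg v
  have hA1 : (A 1 * v 1) ^ 2 ≤ C ^ 2 * v 1 ^ 2 := by
    rw [mul_pow]
    have := (M.A_pos 1).le
    have := M.A_upper 1
    gcongr
  rw [hw, S.bc_one]
  exact mean_estimate_aux M.one_le hB hP hJ hS hH hA1

end Snapshot

/-- A weighted energy, which is nonincreasing along the flow. -/
noncomputable def weightedEnergy (A v p : ℝ → ℝ) : ℝ :=
  1 / 2 * (∫ x, (v x * v x + (A x)⁻¹ * (p x * p x)) ∂𝓤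
    + A 1 * (v 1 * v 1) + A 0 * (v 0 * v 0))

/-- The functional of the local multiplier. -/
noncomputable def localFunctional (ρ v p : ℝ → ℝ) : ℝ :=
  -∫ x, (∫ y in (0:ℝ)..x, v y) * (ρ x * fluctuation ρ p x) ∂𝓤

/-- The functional of the global multiplier. -/
noncomputable def globalFunctional (ρ g v p : ℝ → ℝ) : ℝ :=
  ∫ x, g x * (v x * fluctuation ρ p x) ∂𝓤

/-- The functional controlling the mean of the flux. -/
noncomputable def meanFunctional (A ρ v p : ℝ → ℝ) : ℝ :=
  (∫ x, ρ x * p x ∂𝓤) * (A 1 * v 1 + ∫ x, x * v x ∂𝓤)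

namespace Multipliers

variable {A A' q ρ σ σ' g g' v p : ℝ → ℝ} {α C : ℝ}

lemma continuous_inv_A (M : Multipliers A A' q ρ σ σ' g g' α C) : Continuous fun x => (A x)⁻¹ :=
  M.A_cont.inv₀ fun x => (M.A_pos x).ne'

lemma weightedEnergy_hasInt (M : Multipliers A A' q ρ σ σ' g g' α C) (hv : Continuous v)
    (hp : Continuous p) : HasInt (fun x => v x * v x + (A x)⁻¹ * (p x * p x))
      (2 * weightedEnergy A v p - A 1 * (v 1 * v 1) - A 0 * (v 0 * v 0)) :=
  ⟨((hv.mul hv).add (M.continuous_inv_A.mul (hp.mul hp))).integrable_unitMeasure, by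
    rw [weightedEnergy]
    ring⟩

lemma weightedEnergy_le (M : Multipliers A A' q ρ σ σ' g g' α C) (hv : Continuous v)
    (hp : Continuous p) : weightedEnergy A v p ≤ (1 + 1 / α + C) *
      (∫ x, v x ^ 2 ∂𝓤 + ∫ x, fluctuation ρ p x ^ 2 ∂𝓤 + (∫ x, ρ x * p x ∂𝓤) ^ 2
        + v 1 ^ 2 + v 0 ^ 2) := by
  have hfp := continuous_fluctuation ρ hp
  have hn : 0 ≤ ∫ x, v x ^ 2 ∂𝓤 := integral_nonneg fun _ => sq_nonneg _
  have hm : 0 ≤ ∫ x, fluctuation ρ p x ^ 2 ∂𝓤 := integral_nonneg fun _ => sq_nonneg _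
  have hα : 0 < 1 / α := one_div_pos.2 M.α_pos
  have key := (M.weightedEnergy_hasInt hv hp).le
    (((hv.pow 2).hasInt.add ((hfp.pow 2).hasInt.const_mul (2 * (1 / α)))).add
      (HasInt.const (2 * (1 / α) * (∫ x, ρ x * p x ∂𝓤) ^ 2))) (by
    refine ae_of_all _ fun x => ?_
    have e : p x = fluctuation ρ p x + ∫ x, ρ x * p x ∂𝓤 := by simp [fluctuation]
    simp only [Pi.pow_apply]
    set f := fluctuation ρ p x
    set P := ∫ x, ρ x * p x ∂𝓤
    have h1 : (A x)⁻¹ ≤ 1 / α := by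
      rw [one_div]
      exact inv_anti₀ M.α_pos (M.A_lower x)
    have h2 : (A x)⁻¹ * (p x * p x) ≤ 1 / α * (p x * p x) :=
      mul_le_mul_of_nonneg_right h1 (mul_self_nonneg _)
    have h3 : 1 / α * (p x * p x) ≤ 1 / α * (2 * f ^ 2 + 2 * P ^ 2) := by
      refine mul_le_mul_of_nonneg_left ?_ hα.le
      rw [e]
      nlinarith [sq_nonneg (f - P)]
    nlinarith)
  simp only [Pi.pow_apply] at key
  have h1 := mul_le_mul_of_nonneg_right (M.A_upper 1) (sq_nonneg (v 1))
  have h0 := mul_le_mul_of_nonneg_right (M.A_upper 0) (sq_nonneg (v 0))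
  set n := ∫ x, v x ^ 2 ∂𝓤
  set m := ∫ x, fluctuation ρ p x ^ 2 ∂𝓤
  set P := ∫ x, ρ x * p x ∂𝓤
  set β := 1 / α
  have hC := M.one_le
  have u1 : 0 ≤ β * n := by positivity
  have u2 : 0 ≤ C * n := by positivity
  have u3 : 0 ≤ C * m := by positivity
  have u4 : 0 ≤ C * P ^ 2 := by positivity
  have u5 : 0 ≤ β * v 1 ^ 2 := by positivity
  have u6 : 0 ≤ β * v 0 ^ 2 := by positivity
  have u7 : 0 ≤ C * v 1 ^ 2 := by positivity
  have u8 : 0 ≤ C * v 0 ^ 2 := by positivity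
  have := sq_nonneg P
  have := sq_nonneg (v 1)
  have := sq_nonneg (v 0)
  linarith

lemma velocity_le (M : Multipliers A A' q ρ σ σ' g g' α C) (hv : Continuous v)
    (hp : Continuous p) : ∫ x, v x ^ 2 ∂𝓤 ≤ 2 * weightedEnergy A v p := by
  have key := (hv.pow 2).hasInt.le (M.weightedEnergy_hasInt hv hp) (ae_of_all _ fun x => by
    have := mul_nonneg (inv_pos.2 (M.A_pos x)).le (mul_self_nonneg (p x))
    simp only [Pi.pow_apply]
    nlinarith)
  have h1 := mul_nonneg (M.A_pos 1).le (mul_self_nonneg (v 1))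
  have h0 := mul_nonneg (M.A_pos 0).le (mul_self_nonneg (v 0))
  simp only [Pi.pow_apply] at key
  linarith

lemma flux_le (M : Multipliers A A' q ρ σ σ' g g' α C) (hv : Continuous v)
    (hp : Continuous p) : ∫ x, p x ^ 2 ∂𝓤 ≤ 2 * C * weightedEnergy A v p := by
  have hC := M.one_le
  have key := (hp.pow 2).hasInt.le ((M.weightedEnergy_hasInt hv hp).const_mul C)
    (ae_of_all _ fun x => by
      have hA := M.A_pos x
      have h1 : 1 ≤ C * (A x)⁻¹ := by
        rw [← div_eq_mul_inv, one_le_div hA]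
        exact M.A_upper x
      have h2 := mul_le_mul_of_nonneg_right h1 (sq_nonneg (p x))
      have h3 : 0 ≤ C * (v x * v x) := mul_nonneg (by linarith) (mul_self_nonneg _)
      simp only [Pi.pow_apply]
      nlinarith)
  have h1 := mul_nonneg (M.A_pos 1).le (mul_self_nonneg (v 1))
  have h0 := mul_nonneg (M.A_pos 0).le (mul_self_nonneg (v 0))
  simp only [Pi.pow_apply] at key
  nlinarith

lemma boundary_le (M : Multipliers A A' q ρ σ σ' g g' α C) (hv : Continuous v)
    (hp : Continuous p) : v 1 ^ 2 ≤ 2 / α * weightedEnergy A v p := by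
  have key := (M.weightedEnergy_hasInt hv hp).nonneg (ae_of_all _ fun x => by
    have := (M.A_pos x).le
    have := mul_self_nonneg (p x)
    have := mul_self_nonneg (v x)
    positivity)
  have h1 := mul_le_mul_of_nonneg_right (M.A_lower 1) (mul_self_nonneg (v 1))
  have h0 := mul_nonneg (M.A_pos 0).le (mul_self_nonneg (v 0))
  have := M.α_pos
  rw [div_mul_eq_mul_div, le_div_iff₀ this]
  linarith

lemma fluctuation_le (M : Multipliers A A' q ρ σ σ' g g' α C) (hp : Continuous p) :
    ∫ x, fluctuation ρ p x ^ 2 ∂𝓤 ≤ 2 * (1 + C ^ 2) * ∫ x, p x ^ 2 ∂𝓤 := by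
  have key := ((continuous_fluctuation ρ hp).pow 2).hasInt.le
    (((hp.pow 2).hasInt.const_mul 2).add (HasInt.const (2 * (∫ x, ρ x * p x ∂𝓤) ^ 2)))
    (ae_of_all _ fun x => by
      simp only [Pi.pow_apply, fluctuation]
      nlinarith [sq_nonneg (p x + ∫ x, ρ x * p x ∂𝓤)])
  have := M.sq_mean_le hp
  simp only [Pi.pow_apply] at key
  linarith

lemma abs_localFunctional_le (M : Multipliers A A' q ρ σ σ' g g' α C) (hv : Continuous v)
    (hp : Continuous p) : |localFunctional ρ v p| ≤
      1 / 2 * ∫ x, v x ^ 2 ∂𝓤 + C ^ 2 / 2 * ∫ x, fluctuation ρ p x ^ 2 ∂𝓤 := by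
  have hfp := continuous_fluctuation ρ hp
  have hVc : Continuous fun x => ∫ y in (0:ℝ)..x, v y :=
    intervalIntegral.continuous_primitive (fun a b => hv.intervalIntegrable a b) 0
  rw [localFunctional, abs_neg]
  refine (abs_integral_le_integral_abs).trans ?_
  refine (hVc.mul (M.ρ_cont.mul hfp)).abs.hasInt.le
    ((HasInt.const (1 / 2 * ∫ x, v x ^ 2 ∂𝓤)).add ((hfp.pow 2).hasInt.const_mul (C ^ 2 / 2))) ?_
  filter_upwards [ae_unitMeasure_mem] with x hx
  have hVn := sq_primitive_le hv.integrable_unitMeasure (hv.pow 2).integrable_unitMeasure hx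
  simp only [Pi.mul_apply, Pi.pow_apply] at hVn ⊢
  set f := fluctuation ρ p x
  set V := ∫ y in (0:ℝ)..x, v y
  have h1 : (ρ x * f) ^ 2 ≤ C ^ 2 * f ^ 2 := by
    rw [mul_pow]
    have := M.ρ_nonneg x
    have := M.ρ_le x hx
    gcongr
  rw [abs_le]
  constructor
  · nlinarith [sq_nonneg (V + ρ x * f)]
  · nlinarith [sq_nonneg (V - ρ x * f)]

lemma abs_globalFunctional_le (M : Multipliers A A' q ρ σ σ' g g' α C) (hv : Continuous v)
    (hp : Continuous p) : |globalFunctional ρ g v p| ≤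
      1 / 2 * ∫ x, v x ^ 2 ∂𝓤 + C ^ 2 / 2 * ∫ x, fluctuation ρ p x ^ 2 ∂𝓤 := by
  have hfp := continuous_fluctuation ρ hp
  refine (abs_integral_le_integral_abs).trans ?_
  refine (M.g_cont.mul (hv.mul hfp)).abs.hasInt.le
    (((hv.pow 2).hasInt.const_mul (1 / 2)).add ((hfp.pow 2).hasInt.const_mul (C ^ 2 / 2))) ?_
  filter_upwards [ae_unitMeasure_mem] with x hx
  simp only [Pi.mul_apply, Pi.pow_apply]
  set f := fluctuation ρ p x
  have h1 : (g x * f) ^ 2 ≤ C ^ 2 * f ^ 2 := by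
    rw [mul_pow]
    have : g x ^ 2 ≤ C ^ 2 := sq_le_sq' (by linarith [M.g_le x hx, neg_abs_le (g x)])
      (by linarith [M.g_le x hx, le_abs_self (g x)])
    gcongr
  rw [abs_le]
  constructor
  · nlinarith [sq_nonneg (v x + g x * f)]
  · nlinarith [sq_nonneg (v x - g x * f)]

lemma abs_meanFunctional_le (M : Multipliers A A' q ρ σ σ' g g' α C) (hv : Continuous v) :
    |meanFunctional A ρ v p| ≤
      1 / 2 * (∫ x, ρ x * p x ∂𝓤) ^ 2 + C ^ 2 * v 1 ^ 2 + ∫ x, v x ^ 2 ∂𝓤 := by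
  have hxv : Continuous fun x => x * v x := continuous_id.mul hv
  have hS : (∫ x, x * v x ∂𝓤) ^ 2 ≤ ∫ x, v x ^ 2 ∂𝓤 := by
    refine (sq_integral_le_of_continuous hxv).trans ?_
    refine (hxv.pow 2).hasInt.le (hv.pow 2).hasInt ?_
    filter_upwards [ae_unitMeasure_mem] with x hx
    have : x ^ 2 ≤ 1 := by nlinarith [hx.1, hx.2]
    simp only [Pi.pow_apply, mul_pow]
    nlinarith [mul_le_mul_of_nonneg_right this (sq_nonneg (v x))]
  have hA1 : (A 1 * v 1) ^ 2 ≤ C ^ 2 * v 1 ^ 2 := by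
    rw [mul_pow]
    have := (M.A_pos 1).le
    have := M.A_upper 1
    gcongr
  rw [meanFunctional]
  set K := ∫ x, x * v x ∂𝓤
  set P := ∫ x, ρ x * p x ∂𝓤
  set b := A 1 * v 1
  rw [abs_le]
  constructor
  · nlinarith [sq_nonneg (P + (b + K)), sq_nonneg (b - K)]
  · nlinarith [sq_nonneg (P - (b + K)), sq_nonneg (b - K)]

/-- All the functionals are controlled by the energy. -/
lemma abs_functionals_le (M : Multipliers A A' q ρ σ σ' g g' α C) (hv : Continuous v)
    (hp : Continuous p) :
    |localFunctional ρ v p| ≤ (2 + 2 * C ^ 3 * (1 + C ^ 2) + C ^ 3 + 2 * C ^ 2 / α)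
        * weightedEnergy A v p ∧
    |globalFunctional ρ g v p| ≤ (2 + 2 * C ^ 3 * (1 + C ^ 2) + C ^ 3 + 2 * C ^ 2 / α)
        * weightedEnergy A v p ∧
    |meanFunctional A ρ v p| ≤ (2 + 2 * C ^ 3 * (1 + C ^ 2) + C ^ 3 + 2 * C ^ 2 / α)
        * weightedEnergy A v p := by
  have h1 := M.abs_localFunctional_le hv hp
  have h2 := M.abs_globalFunctional_le hv hp
  have h3 := M.abs_meanFunctional_le (p := p) hv
  have hn := M.velocity_le hv hp
  have hnp := M.flux_le hv hp
  have he := M.boundary_le hv hp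
  have hm := M.fluctuation_le hp
  have hP := M.sq_mean_le hp
  have hn0 : 0 ≤ ∫ x, v x ^ 2 ∂𝓤 := integral_nonneg fun _ => sq_nonneg _
  set n := ∫ x, v x ^ 2 ∂𝓤
  set m := ∫ x, fluctuation ρ p x ^ 2 ∂𝓤
  set np := ∫ x, p x ^ 2 ∂𝓤
  set F := weightedEnergy A v p
  have hC := M.one_le
  have hα := M.α_pos
  have hF : 0 ≤ F := by linarith
  have m1 : C ^ 2 * m ≤ C ^ 2 * (2 * (1 + C ^ 2) * (2 * C * F)) := by gcongr; exact hm.trans (by gcongr)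
  have m2 : C ^ 2 * np ≤ C ^ 2 * (2 * C * F) := by gcongr
  have m3 : C ^ 2 * v 1 ^ 2 ≤ C ^ 2 * (2 / α * F) := by gcongr
  have e3 : 2 * C ^ 2 / α * F = C ^ 2 * (2 / α * F) := by ring
  have u1 : 0 ≤ C ^ 2 * (2 / α * F) := by positivity
  have u2 : 0 ≤ C ^ 3 * F := by positivity
  have u3 : 0 ≤ C ^ 5 * F := by positivity
  rw [add_mul _ _ F, e3]
  refine ⟨?_, ?_, ?_⟩ <;> linarith

end Multipliers

/-- A choice of weights turning the four multiplier estimates into a strict Lyapunov functional. -/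
lemma exists_lyapunov_weights {K c₀ : ℝ} (hK : 1 ≤ K) (hc₀ : 0 < c₀) :
    ∃ k₁ k₂ δ ν : ℝ, 0 < ν ∧
      (∀ F X₁ X₂ X₃ : ℝ, |X₁| ≤ K * F → |X₂| ≤ K * F → |X₃| ≤ K * F →
        F / 2 ≤ F + δ * (k₁ * X₁ + k₂ * X₂ + X₃) ∧
        F + δ * (k₁ * X₁ + k₂ * X₂ + X₃) ≤ 2 * F) ∧
      ∀ n m r P B e₁ e₀ F dF dX₁ dX₂ dX₃ : ℝ, 0 ≤ n → 0 ≤ m → 0 ≤ B → 0 ≤ e₁ → 0 ≤ e₀ →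
        dF ≤ -(B + c₀ * (e₁ + e₀)) →
        (∀ ε > 0, dX₁ ≤ -(1 / 2) * r + ε * n + (2 * K + K / ε) * B) →
        dX₂ ≤ -(1 / 4) * (n + m) + K * r + K * B →
        dX₃ ≤ -(1 / 2) * P + 2 * (n + m) + K * (B + e₁) →
        F ≤ K * (n + m + P + e₁ + e₀) →
        dF + δ * (k₁ * dX₁ + k₂ * dX₂ + dX₃) ≤ -ν * (2 * F) := by
  have hK0 : 0 < K := by linarith
  obtain ⟨D, hD⟩ : ∃ D, D = 1024 * K ^ 3 + 64 * K ^ 2 + 17 * K := ⟨_, rfl⟩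
  have hDpos : 0 < D := by rw [hD]; positivity
  have hK2 : 0 < K ^ 2 := by positivity
  have hK3 : 0 < K ^ 3 := by positivity
  have hKD : K ≤ D := by linarith
  have hDK : K * (32 * K + 17) ≤ D := by linarith
  have hD2 : 1 ≤ D := hK.trans hKD
  obtain ⟨c₁, hc₁⟩ : ∃ c₁, c₁ = min 1 c₀ := ⟨_, rfl⟩
  have hc1 : c₁ ≤ 1 := hc₁ ▸ min_le_left _ _
  have hc0 : c₁ ≤ c₀ := hc₁ ▸ min_le_right _ _
  have hcpos : 0 < c₁ := hc₁ ▸ lt_min one_pos hc₀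
  obtain ⟨δ, hδ⟩ : ∃ δ, δ = c₁ / (2 * D) := ⟨_, rfl⟩
  have hδpos : 0 < δ := by rw [hδ]; positivity
  have hδD : δ * D = c₁ / 2 := by rw [hδ]; field_simp
  refine ⟨32 * K, 16, δ, δ / (4 * K), by positivity, ?_, ?_⟩
  · intro F X₁ X₂ X₃ h₁ h₂ h₃
    have hF0 : 0 ≤ F := nonneg_of_mul_nonneg_right ((abs_nonneg _).trans h₁) hK0
    have hX : |32 * K * X₁ + 16 * X₂ + X₃| ≤ D * F := by
      refine le_trans (abs_le.2 ⟨?_, ?_⟩) (mul_le_mul_of_nonneg_right hDK hF0)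
      · have := mul_le_mul_of_nonneg_left (abs_le.1 h₁).1 (show 0 ≤ 32 * K by linarith)
        linarith [(abs_le.1 h₂).1, (abs_le.1 h₃).1]
      · have := mul_le_mul_of_nonneg_left (abs_le.1 h₁).2 (show 0 ≤ 32 * K by linarith)
        linarith [(abs_le.1 h₂).2, (abs_le.1 h₃).2]
    have hδX : |δ * (32 * K * X₁ + 16 * X₂ + X₃)| ≤ F / 2 := by
      rw [abs_mul, abs_of_pos hδpos]
      calc δ * _ ≤ δ * (D * F) := by gcongr
        _ = c₁ / 2 * F := by rw [← mul_assoc, hδD]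
        _ ≤ 1 / 2 * F := by gcongr
        _ = F / 2 := by ring
    obtain ⟨hlo, hup⟩ := abs_le.1 hδX
    exact ⟨by linarith, by linarith⟩
  intro n m r P B e₁ e₀ F dF dX₁ dX₂ dX₃ hn hm hB he₁ he₀ hdF hd₁ hd₂ hd₃ hF
  have hd₁' := hd₁ (1 / (32 * K)) (by positivity)
  have e₁' : 32 * K * (-(1 / 2) * r + 1 / (32 * K) * n + (2 * K + K / (1 / (32 * K))) * B)
      = -(16 * (K * r)) + n + (64 * K ^ 2 + 1024 * K ^ 3) * B := by
    field_simp
    ring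
  have hd₁'' := mul_le_mul_of_nonneg_left hd₁' (show 0 ≤ 32 * K by linarith)
  rw [e₁'] at hd₁''
  have hsum : 32 * K * dX₁ + 16 * dX₂ + dX₃ ≤ -(1 / 2) * (n + m + P) + D * (B + e₁) := by
    have h1 : K * e₁ ≤ D * e₁ := mul_le_mul_of_nonneg_right hKD he₁
    have h2 : D * B = (64 * K ^ 2 + 1024 * K ^ 3) * B + 17 * (K * B) := by rw [hD]; ring
    clear hd₁ hd₁' e₁' hD
    obtain ⟨Z, hZ⟩ : ∃ Z, Z = (64 * K ^ 2 + 1024 * K ^ 3) * B := ⟨_, rfl⟩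
    rw [← hZ] at h2 hd₁''
    have h3 : D * (B + e₁) = D * B + D * e₁ := mul_add _ _ _
    have h4 : K * (B + e₁) = K * B + K * e₁ := mul_add _ _ _
    rw [h3, h2]
    rw [h4] at hd₃
    obtain ⟨Y, hY⟩ : ∃ Y, Y = 32 * K * dX₁ := ⟨_, rfl⟩
    rw [← hY] at hd₁'' ⊢
    linarith
  have hδsum := mul_le_mul_of_nonneg_left hsum hδpos.le
  have e₂ : δ * (-(1 / 2) * (n + m + P) + D * (B + e₁))
      = -(δ / 2) * (n + m + P) + c₁ / 2 * (B + e₁) := by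
    rw [mul_add, ← mul_assoc δ D, hδD]
    ring
  rw [e₂] at hδsum
  have hδc : δ ≤ c₁ := by
    have := mul_le_mul_of_nonneg_left hD2 hδpos.le
    linarith
  have hmain : dF + δ * (32 * K * dX₁ + 16 * dX₂ + dX₃) ≤ -(δ / 2) * (n + m + P + e₁ + e₀) := by
    have a1 := mul_le_mul_of_nonneg_right hc0 (add_nonneg he₁ he₀)
    have a2 := mul_le_mul_of_nonneg_right hδc (add_nonneg he₁ he₀)
    have a3 := mul_le_mul_of_nonneg_right hc1 hB
    have a4 := mul_nonneg hcpos.le he₀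
    clear hd₁ hd₁' hd₁'' hd₂ hd₃ hsum e₁' e₂ hD hδ
    obtain ⟨Y, hY⟩ : ∃ Y, Y = δ * (32 * K * dX₁ + 16 * dX₂ + dX₃) := ⟨_, rfl⟩
    rw [← hY] at hδsum ⊢
    linarith
  have hKinv : F / K ≤ n + m + P + e₁ + e₀ := by
    rw [div_le_iff₀' hK0]
    exact hF
  calc _ ≤ -(δ / 2) * (n + m + P + e₁ + e₀) := hmain
    _ ≤ -(δ / 2) * (F / K) := mul_le_mul_of_nonpos_left hKinv (by linarith)
    _ = -(δ / (4 * K)) * (2 * F) := by field_simp; ring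

/-- A trajectory of the damped wave equation in terms of velocity and flux. -/
structure DampedWave (A q : ℝ → ℝ) (q₀ q₁ : ℝ) (v w p s : ℝ → ℝ → ℝ) : Prop where
  v_time : TimeDeriv v w
  p_time : TimeDeriv p s
  snapshot : ∀ t > 0, Snapshot A q q₀ q₁ (v t) (w t) (p t) (s t)

lemma le_exp_of_deriv_le {L L' : ℝ → ℝ} {ν : ℝ} (hc : Continuous L)
    (hd : ∀ t > 0, HasDerivAt L (L' t) t) (hle : ∀ t > 0, L' t ≤ -ν * L t) {t : ℝ} (ht : 0 ≤ t) :
    L t ≤ L 0 * Real.exp (-ν * t) := by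
  have hd' : ∀ t > 0, HasDerivAt (fun t => L t * Real.exp (ν * t))
      (L' t * Real.exp (ν * t) + L t * (Real.exp (ν * t) * ν)) t := fun t ht =>
    (hd t ht).mul (((hasDerivAt_id t).const_mul ν).exp.congr_deriv (by simp))
  have hanti : AntitoneOn (fun t => L t * Real.exp (ν * t)) (Ici 0) := by
    refine antitoneOn_of_deriv_nonpos (convex_Ici 0) (by fun_prop) ?_ ?_
    · rw [interior_Ici]
      exact fun t ht => (hd' t ht).differentiableAt.differentiableWithinAt
    · rw [interior_Ici]
      intro t ht
      rw [(hd' t ht).deriv]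
      nlinarith [mul_le_mul_of_nonneg_right (hle t ht) (Real.exp_pos (ν * t)).le]
  have h := hanti self_mem_Ici ht ht
  simp only [mul_zero, Real.exp_zero, mul_one] at h
  rw [neg_mul, Real.exp_neg, ← div_eq_mul_inv, le_div_iff₀ (Real.exp_pos _)]
  exact h

/-- Uniform exponential decay of the weighted energy. -/
lemma exists_weightedEnergy_decay {A A' q ρ σ σ' g g' : ℝ → ℝ} {α C q₀ q₁ : ℝ}
    (M : Multipliers A A' q ρ σ σ' g g' α C) (hq₀ : 0 < q₀) (hq₁ : 0 < q₁) :
    ∃ ν > 0, ∀ v w p s, DampedWave A q q₀ q₁ v w p s → ∀ t, 0 ≤ t →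
      weightedEnergy A (v t) (p t) ≤ 4 * weightedEnergy A (v 0) (p 0) * Real.exp (-ν * t) := by
  have hC := M.one_le
  have hα := M.α_pos
  obtain ⟨K, hK⟩ : ∃ K, K = (1 + 1 / α + C) + (2 + 2 * C ^ 3 * (1 + C ^ 2) + C ^ 3 + 2 * C ^ 2 / α)
    + (2 * C ^ 3 + C ^ 2 / 2) + (3 * C + 2 * C ^ 2 * (1 + q₁ ^ 2)) := ⟨_, rfl⟩
  have p1 : 0 ≤ 1 + 1 / α + C := by positivity
  have p2 : 0 ≤ 2 + 2 * C ^ 3 * (1 + C ^ 2) + C ^ 3 + 2 * C ^ 2 / α := by positivity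
  have p3 : 0 ≤ 2 * C ^ 3 + C ^ 2 / 2 := by positivity
  have p4 : 0 ≤ 3 * C + 2 * C ^ 2 * (1 + q₁ ^ 2) := by positivity
  have p5 : 0 ≤ 1 / α := by positivity
  have p6 : 0 ≤ 2 * C ^ 2 * (1 + q₁ ^ 2) := by positivity
  have hCK : C ≤ K := by linarith
  have hK1 : 1 ≤ K := by linarith
  have hc₀ : 0 < α * min q₀ q₁ := mul_pos hα (lt_min hq₀ hq₁)
  obtain ⟨k₁, k₂, δ, ν, hν, hequiv, hdecay⟩ := exists_lyapunov_weights hK1 hc₀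
  refine ⟨ν, hν, fun v w p s W t ht => ?_⟩
  have hequiv' : ∀ t, weightedEnergy A (v t) (p t) / 2 ≤ weightedEnergy A (v t) (p t)
        + δ * (k₁ * localFunctional ρ (v t) (p t) + k₂ * globalFunctional ρ g (v t) (p t)
          + meanFunctional A ρ (v t) (p t)) ∧
      weightedEnergy A (v t) (p t)
        + δ * (k₁ * localFunctional ρ (v t) (p t) + k₂ * globalFunctional ρ g (v t) (p t)
          + meanFunctional A ρ (v t) (p t)) ≤ 2 * weightedEnergy A (v t) (p t) := by
    intro t
    have hv := W.v_time.cont_right t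
    have hp := W.p_time.cont_right t
    obtain ⟨h1, h2, h3⟩ := M.abs_functionals_le hv hp
    have hF : 0 ≤ weightedEnergy A (v t) (p t) := by
      have := M.velocity_le hv hp
      have : 0 ≤ ∫ x, v t x ^ 2 ∂𝓤 := integral_nonneg fun _ => sq_nonneg _
      linarith
    have hle : 2 + 2 * C ^ 3 * (1 + C ^ 2) + C ^ 3 + 2 * C ^ 2 / α ≤ K := by linarith
    have := mul_le_mul_of_nonneg_right hle hF
    exact hequiv _ _ _ _ (h1.trans this) (h2.trans this) (h3.trans this)
  have tP := (W.p_time.space_mul M.ρ_cont).integral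
  have tf : TimeDeriv (fun t x => fluctuation ρ (p t) x) (fun t x => fluctuation ρ (s t) x) :=
    W.p_time.sub tP
  have tF := (((((W.v_time.mul W.v_time).add
    ((W.p_time.mul W.p_time).space_mul M.continuous_inv_A)).integral).add
    (((W.v_time.mul W.v_time).at_point 1).const_mul (A 1))).add
    (((W.v_time.mul W.v_time).at_point 0).const_mul (A 0))).const_mul (1 / 2)
  have t1 := ((W.v_time.primitive.mul (tf.space_mul M.ρ_cont)).integral).neg
  have t2 := ((W.v_time.mul tf).space_mul M.g_cont).integral
  have t3 := tP.mul (((W.v_time.at_point 1).const_mul (A 1)).add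
    (W.v_time.space_mul continuous_id).integral)
  have tL := tF.add ((((t1.const_mul k₁).add (t2.const_mul k₂)).add t3).const_mul δ)
  have key := le_exp_of_deriv_le (ν := ν) (L := fun t => weightedEnergy A (v t) (p t)
      + δ * (k₁ * localFunctional ρ (v t) (p t) + k₂ * globalFunctional ρ g (v t) (p t)
        + meanFunctional A ρ (v t) (p t)))
    (tL.cont_left 0) (fun t ht => tL.deriv t ht 0) (fun t ht => ?_) ht
  · have h0 := mul_le_mul_of_nonneg_right (hequiv' 0).2 (Real.exp_pos (-ν * t)).le
    have h1 := (hequiv' t).1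
    linarith
  have S := W.snapshot t ht
  have hB := M.damping_nonneg (v t)
  set B := ∫ x, q x * v t x ^ 2 ∂𝓤 with hBdef
  have hr : 0 ≤ ∫ x, ρ x * fluctuation ρ (p t) x ^ 2 ∂𝓤 :=
    integral_nonneg fun x => mul_nonneg (M.ρ_nonneg x) (sq_nonneg _)
  refine (hdecay (∫ x, v t x ^ 2 ∂𝓤) (∫ x, fluctuation ρ (p t) x ^ 2 ∂𝓤)
    (∫ x, ρ x * fluctuation ρ (p t) x ^ 2 ∂𝓤) ((∫ x, ρ x * p t x ∂𝓤) ^ 2) B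
    (v t 1 ^ 2) (v t 0 ^ 2) (weightedEnergy A (v t) (p t)) _ _ _ _
    (integral_nonneg fun _ => sq_nonneg _) (integral_nonneg fun _ => sq_nonneg _) hB
    (sq_nonneg _) (sq_nonneg _) ?_ (fun ε hε => (S.local_estimate M hε).trans ?_)
    ((S.global_estimate M).trans ?_) ((S.mean_estimate M).trans ?_)
    ((M.weightedEnergy_le S.v_cont S.p_cont).trans ?_)).trans
    (mul_le_mul_of_nonpos_left (hequiv' t).2 (by linarith))
  · rw [S.energy_identity M]
    have h (x : ℝ) (k : ℝ) (hk : min q₀ q₁ ≤ k) :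
        α * min q₀ q₁ * v t x ^ 2 ≤ A x * k * v t x ^ 2 := by
      have := M.A_lower x
      have := (lt_min hq₀ hq₁).le
      have := (M.A_pos x).le
      gcongr
    linarith [h 1 q₁ (min_le_right _ _), h 0 q₀ (min_le_left _ _)]
  · have : C / ε ≤ K / ε := by gcongr
    have := mul_le_mul_of_nonneg_right
      (show 2 * C + C / ε ≤ 2 * K + K / ε by linarith) hB
    linarith
  · have h1 := mul_le_mul_of_nonneg_right (show C / 2 ≤ K by linarith) hr
    have h2 := mul_le_mul_of_nonneg_right (show 2 * C ^ 3 + C ^ 2 / 2 ≤ K by linarith) hB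
    linarith
  · have h1 := mul_le_mul_of_nonneg_right (show 3 * C + 2 * C ^ 2 * (1 + q₁ ^ 2) ≤ K by linarith)
      (add_nonneg hB (sq_nonneg (v t 1)))
    linarith
  · refine mul_le_mul_of_nonneg_right (show 1 + 1 / α + C ≤ K by linarith) ?_
    have h1 : 0 ≤ ∫ x, v t x ^ 2 ∂𝓤 := integral_nonneg fun _ => sq_nonneg _
    have h2 : 0 ≤ ∫ x, fluctuation ρ (p t) x ^ 2 ∂𝓤 := integral_nonneg fun _ => sq_nonneg _
    positivity

/-- A continuous function vanishing off `[c,d]` is controlled by a damping active on `(c,d)`. -/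
lemma exists_le_mul_damping {f q : ℝ → ℝ} {c d q_min : ℝ} (hf : Continuous f)
    (hf0 : ∀ x ∉ Icc c d, f x = 0) (hqm : 0 < q_min)
    (hq0 : ∀ᵐ x ∂𝓤, 0 ≤ q x) (hq : ∀ᵐ x ∂(volume.restrict (Ioo c d)), q_min ≤ q x) :
    ∃ D, 0 ≤ D ∧ ∀ᵐ x ∂𝓤, f x ≤ D * q x := by
  obtain ⟨K, hK⟩ := (isCompact_Icc (a := c) (b := d)).exists_bound_of_continuousOn hf.continuousOn
  have hK0 : 0 ≤ max K 0 / q_min := by positivity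
  refine ⟨max K 0 / q_min, hK0, ?_⟩
  rw [ae_restrict_iff' measurableSet_Ioo] at hq
  filter_upwards [hq0, ae_restrict_of_ae hq, ae_restrict_of_ae (Measure.ae_ne volume c),
    ae_restrict_of_ae (Measure.ae_ne volume d)] with x hx0 hx hxc hxd
  by_cases hmem : x ∈ Icc c d
  · have hx' := hx ⟨lt_of_le_of_ne hmem.1 (Ne.symm hxc), lt_of_le_of_ne hmem.2 hxd⟩
    calc f x ≤ max K 0 := (le_abs_self _).trans ((hK x hmem).trans (le_max_left _ _))
      _ = max K 0 / q_min * q_min := by field_simp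
      _ ≤ _ := mul_le_mul_of_nonneg_left hx' hK0
  · rw [hf0 x hmem]
    exact mul_nonneg hK0 hx0

/-- A smooth bump supported in `(c,d)`, normalized with respect to the weight `A⁻¹`. -/
lemma exists_normalized_bump {A : ℝ → ℝ} {c d : ℝ} (hA : Continuous A) (hA0 : ∀ x, 0 < A x)
    (hc : 0 ≤ c) (hcd : c < d) (hd : d ≤ 1) :
    ∃ σ : ℝ → ℝ, ContDiff ℝ 1 σ ∧ (∀ x, 0 ≤ σ x) ∧ (∀ x ∉ Ioo c d, σ x = 0) ∧
      ∫ x, σ x / A x ∂𝓤 = 1 := by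
  obtain ⟨f, hfs, hf, hfr⟩ := (isOpen_Ioo (a := c) (b := d)).exists_contDiff_support_eq (n := 1)
  have hf0 : ∀ x, 0 ≤ f x := fun x => (hfr (mem_range_self x)).1
  have hI : 0 < ∫ x, f x / A x ∂𝓤 := by
    rw [integral_unitMeasure]
    refine intervalIntegral.integral_pos one_pos
      (hf.continuous.div₀ hA fun x => (hA0 x).ne').continuousOn
      (fun x _ => div_nonneg (hf0 x) (hA0 x).le) ⟨(c + d) / 2, ⟨by linarith, by linarith⟩, ?_⟩
    refine div_pos (lt_of_le_of_ne (hf0 _) (Ne.symm ?_)) (hA0 _)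
    rw [← Function.mem_support, hfs]
    exact ⟨by linarith, by linarith⟩
  refine ⟨fun x => (∫ x, f x / A x ∂𝓤)⁻¹ * f x, contDiff_const.mul hf,
    fun x => mul_nonneg (inv_pos.2 hI).le (hf0 x), fun x hx => ?_, ?_⟩
  · rw [← hfs, Function.notMem_support] at hx
    simp [hx]
  · simp only [mul_div_assoc]
    rw [integral_const_mul, inv_mul_cancel₀ hI.ne']

lemma exists_multipliers {A q : ℝ → ℝ} {α β c d q_min Q : ℝ} {L : NNReal} (hL : LipschitzWith L A)
    (hα : 0 < α) (hlow : ∀ x, α ≤ A x) (hup : ∀ x, A x ≤ β) (hqm : Measurable q)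
    (hq0 : ∀ᵐ x ∂𝓤, 0 ≤ q x) (hqQ : ∀ᵐ x ∂𝓤, q x ≤ Q) (hQ : 0 ≤ Q) (hc : 0 ≤ c) (hcd : c < d)
    (hd : d ≤ 1) (hq_min : 0 < q_min)
    (hq : ∀ᵐ x ∂(volume.restrict (Ioo c d)), q_min ≤ q x) :
    ∃ A' ρ σ σ' g g' C, Multipliers A A' q ρ σ σ' g g' α C := by
  have hA0 : ∀ x, 0 < A x := fun x => hα.trans_le (hlow x)
  obtain ⟨σ, hσ, hσ0, hσs, hσI⟩ := exists_normalized_bump hL.continuous hA0 hc hcd hd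
  have hσ' : Continuous (deriv σ) := hσ.continuous_deriv le_rfl
  have hσ's : ∀ x ∉ Icc c d, deriv σ x = 0 := fun x hx => by
    have : σ =ᶠ[𝓝 x] fun _ => 0 := by
      filter_upwards [isClosed_Icc.isOpen_compl.mem_nhds hx] with y hy
      exact hσs y fun h => hy (Ioo_subset_Icc_self h)
    rw [this.deriv_eq, deriv_const]
  obtain ⟨D₁, hD₁, hσq⟩ := exists_le_mul_damping hσ.continuous
    (fun x hx => hσs x fun h => hx (Ioo_subset_Icc_self h)) hq_min hq0 hq
  obtain ⟨D₂, hD₂, hσ'q⟩ := exists_le_mul_damping (hσ'.pow 2)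
    (fun x hx => by simp [hσ's x hx]) hq_min hq0 hq
  obtain ⟨ρ, hρ⟩ : ∃ ρ : ℝ → ℝ, ρ = fun x => σ x / A x := ⟨_, rfl⟩
  have hρc : Continuous ρ := by
    rw [hρ]
    exact hσ.continuous.div₀ hL.continuous fun x => (hA0 x).ne'
  have hρ0 : ∀ x, 0 ≤ ρ x := fun x => by
    rw [hρ]
    exact div_nonneg (hσ0 x) (hA0 x).le
  have hσρ : ∀ x, σ x = A x * ρ x := fun x => by
    rw [hρ]
    exact (mul_div_cancel₀ _ (hA0 x).ne').symm
  have hρI : ∫ x, ρ x ∂𝓤 = 1 := by rw [hρ]; exact hσI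
  obtain ⟨R, hR⟩ := (isCompact_Icc (a := (0:ℝ)) (b := 1)).exists_bound_of_continuousOn
    hρc.continuousOn
  have hR0 : 0 ≤ R := (norm_nonneg _).trans (hR 0 ⟨le_rfl, zero_le_one⟩)
  obtain ⟨θ, hθ⟩ : ∃ θ : ℝ → ℝ, θ = fun x => ∫ y in (0:ℝ)..x, ρ y := ⟨_, rfl⟩
  have hθd : ∀ x, HasDerivAt θ (ρ x) x := fun x => by
    rw [hθ]
    exact intervalIntegral.integral_hasDerivAt_right (hρc.intervalIntegrable _ _)
      (hρc.stronglyMeasurableAtFilter _ _) hρc.continuousAt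
  have hθc : Continuous θ := continuous_iff_continuousAt.2 fun x => (hθd x).continuousAt
  have hθ0 : θ 0 = 0 := by simp [hθ]
  have hθ1 : θ 1 = 1 := by rw [hθ]; simp only [← integral_unitMeasure, hρI]
  have hmono : Monotone θ := monotone_of_hasDerivAt_nonneg hθd hρ0
  obtain ⟨k, hk⟩ : ∃ k : ℝ, k = (L + 1) / α + 1 := ⟨_, rfl⟩
  have hLnn : (0:ℝ) ≤ L := L.2
  have hk1 : 1 ≤ k := by rw [hk]; linarith [show 0 ≤ (L + 1) / α by positivity]
  have hkα : L + 1 ≤ k * α := by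
    rw [hk, add_mul, div_mul_cancel₀ _ hα.ne']
    linarith
  obtain ⟨E, hE⟩ : ∃ E, E = Real.exp k := ⟨_, rfl⟩
  have hE0 : 0 < E := hE ▸ Real.exp_pos k
  obtain ⟨g, hg⟩ : ∃ g : ℝ → ℝ, g = fun x => (1 - θ x) * (Real.exp (k * x) - 1)
    + θ x * (1 - Real.exp (k * (1 - x))) := ⟨_, rfl⟩
  obtain ⟨g', hg'⟩ : ∃ g' : ℝ → ℝ, g' = fun x => k * ((1 - θ x) * Real.exp (k * x)
    + θ x * Real.exp (k * (1 - x))) + ρ x * (2 - Real.exp (k * (1 - x)) - Real.exp (k * x)) :=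
    ⟨_, rfl⟩
  have hgd : ∀ x, HasDerivAt g (g' x) x := fun x => by
    have h1 : HasDerivAt (fun x => Real.exp (k * x)) (Real.exp (k * x) * k) x :=
      (((hasDerivAt_id x).const_mul k).exp).congr_deriv (by simp)
    have h2 : HasDerivAt (fun x => Real.exp (k * (1 - x))) (Real.exp (k * (1 - x)) * (-k)) x :=
      ((((hasDerivAt_id x).const_sub 1).const_mul k).exp).congr_deriv (by simp)
    rw [hg, hg']
    exact ((((hθd x).const_sub 1).mul (h1.sub_const 1)).add
      ((hθd x).mul (h2.const_sub 1))).congr_deriv (by ring)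
  have hg'c : Continuous g' := by rw [hg']; fun_prop
  have hexp : ∀ x ∈ Icc (0:ℝ) 1, ∃ X Z : ℝ, 1 ≤ X ∧ X ≤ E ∧ 1 ≤ Z ∧ Z ≤ E ∧
      g x = (1 - θ x) * (X - 1) + θ x * (1 - Z) ∧
      g' x = k * ((1 - θ x) * X + θ x * Z) + ρ x * (2 - Z - X) := by
    intro x hx
    refine ⟨Real.exp (k * x), Real.exp (k * (1 - x)), ?_, ?_, ?_, ?_, by rw [hg], by rw [hg']⟩
    · exact Real.one_le_exp (mul_nonneg (by linarith) hx.1)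
    · rw [hE]
      exact Real.exp_le_exp.2 (by nlinarith [hx.2])
    · exact Real.one_le_exp (mul_nonneg (by linarith) (by linarith [hx.2]))
    · rw [hE]
      exact Real.exp_le_exp.2 (by nlinarith [hx.1])
  have hbound : ∀ x ∈ Icc (0:ℝ) 1, ∃ Y : ℝ, 1 ≤ Y ∧ Y ≤ E ∧ |g x| ≤ Y ∧
      k * Y - 2 * E * ρ x ≤ g' x := by
    intro x hx
    obtain ⟨X, Z, hX1, hXE, hZ1, hZE, e1, e2⟩ := hexp x hx
    have h0 : 0 ≤ θ x := hθ0 ▸ hmono hx.1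
    have h1 : 0 ≤ 1 - θ x := sub_nonneg.2 (hθ1 ▸ hmono hx.2)
    have a1 := mul_le_mul_of_nonneg_left hX1 h1
    have a2 := mul_le_mul_of_nonneg_left hXE h1
    have a3 := mul_le_mul_of_nonneg_left hZ1 h0
    have a4 := mul_le_mul_of_nonneg_left hZE h0
    refine ⟨(1 - θ x) * X + θ x * Z, by linarith, by linarith, ?_, ?_⟩
    · rw [e1, abs_le]
      constructor <;> linarith
    · rw [e2]
      have := mul_le_mul_of_nonneg_left (show -(2 * E) ≤ 2 - Z - X by linarith) (hρ0 x)
      linarith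
  have hβ : 0 < β := hα.trans_le ((hlow 0).trans (hup 0))
  refine ⟨deriv A, ρ, σ, deriv σ, g, g', 1 + β + Q + R + D₁ + D₂ + 2 * E, ?_⟩
  refine
    { one_le := by linarith
      α_pos := hα
      A_cont := hL.continuous
      A_lower := hlow
      A_upper := fun x => (hup x).trans (by linarith)
      A_deriv := ⟨hL.lipschitzOnWith.absolutelyContinuousOnInterval, ae_restrict_of_ae
        (hL.ae_differentiableAt_real.mono fun x hx => hx.hasDerivAt)⟩
      q_meas := hqm
      q_nonneg := hq0
      q_le := hqQ.mono fun x hx => hx.trans (by linarith)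
      ρ_cont := hρc
      ρ_nonneg := hρ0
      ρ_le := fun x hx => (le_abs_self _).trans ((hR x hx).trans (by linarith))
      ρ_integral := hρI
      σ_eq := hσρ
      σ_deriv := .of_hasDerivAt
        (fun x => ((hσ.differentiable one_ne_zero) x).hasDerivAt) hσ'
      σ'_cont := hσ'
      σ_zero := hσs 0 fun h => absurd h.1 (by linarith)
      σ_one := hσs 1 fun h => absurd h.2 (by linarith)
      σ_le := ?_
      σ'_le := ?_
      g_deriv := .of_hasDerivAt hgd hg'c
      g_cont := continuous_iff_continuousAt.2 fun x => (hgd x).continuousAt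
      g_zero := by simp [hg, hθ0]
      g_one := by simp [hg, hθ1]
      g_le := ?_
      g'_ge := ?_
      gA'_ge := ?_ }
  · filter_upwards [hσq, hq0] with x h1 h2
    exact h1.trans (mul_le_mul_of_nonneg_right (by linarith) h2)
  · filter_upwards [hσ'q, hq0] with x h1 h2
    exact h1.trans (mul_le_mul_of_nonneg_right (by linarith) h2)
  · intro x hx
    obtain ⟨Y, -, hYE, hgY, -⟩ := hbound x hx
    linarith
  · filter_upwards [ae_unitMeasure_mem] with x hx
    obtain ⟨Y, hY1, -, -, hg'Y⟩ := hbound x hx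
    have h1 := mul_le_mul_of_nonneg_right
      (show 2 * E ≤ 1 + β + Q + R + D₁ + D₂ + 2 * E by linarith) (hρ0 x)
    have h2 : 1 ≤ k * Y := one_le_mul_of_one_le_of_one_le hk1 hY1
    linarith
  · filter_upwards [ae_unitMeasure_mem] with x hx
    obtain ⟨Y, hY1, -, hgY, hg'Y⟩ := hbound x hx
    have h1 := mul_le_mul_of_nonneg_right
      (show 2 * E ≤ 1 + β + Q + R + D₁ + D₂ + 2 * E by linarith) (hσ0 x)
    have h2 := mul_le_mul_of_nonneg_right hg'Y (hA0 x).le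
    have h3 : |g x * deriv A x| ≤ Y * L := by
      rw [abs_mul]
      exact mul_le_mul hgY (norm_deriv_le_of_lipschitz hL) (abs_nonneg _) (by linarith)
    have h4 : Y * (L + 1) ≤ Y * (k * A x) :=
      mul_le_mul_of_nonneg_left (hkα.trans (mul_le_mul_of_nonneg_left (hlow x) (by linarith)))
        (by linarith)
    have h5 : (k * Y - 2 * E * ρ x) * A x = Y * (k * A x) - 2 * E * σ x := by
      rw [hσρ]
      ring
    have h6 := (abs_le.1 h3).1
    rw [h5] at h2
    linarith


/-- The retraction of the line onto the unit interval. -/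
noncomputable def clampUnit (x : ℝ) : ℝ := projIcc (0:ℝ) 1 zero_le_one x

lemma clampUnit_mem (x : ℝ) : clampUnit x ∈ Icc (0:ℝ) 1 := (projIcc (0:ℝ) 1 zero_le_one x).2

lemma clampUnit_of_mem {x : ℝ} (hx : x ∈ Icc (0:ℝ) 1) : clampUnit x = x := by
  rw [clampUnit, projIcc_of_mem _ hx]

lemma lipschitzWith_clampUnit : LipschitzWith 1 clampUnit := LipschitzWith.projIcc zero_le_one

lemma LipschitzOnWith.comp_clampUnit {a : ℝ → ℝ} {K : NNReal}
    (h : LipschitzOnWith K a (Icc (0:ℝ) 1)) : LipschitzWith K fun x => a (clampUnit x) := by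
  rw [← lipschitzOnWith_univ, ← mul_one K]
  exact h.comp lipschitzWith_clampUnit.lipschitzOnWith fun x _ => clampUnit_mem x

/-- The time derivative of a function on the half strip `[0,∞) × [0,1]`. -/
noncomputable def stripTimeDeriv (f : ℝ → ℝ → ℝ) (t x : ℝ) : ℝ :=
  fderivWithin ℝ (fun z : ℝ × ℝ => f z.1 z.2) (Ici (0:ℝ) ×ˢ Icc (0:ℝ) 1) (t, x) (1, 0)

lemma hasDerivAt_stripTimeDeriv {f : ℝ → ℝ → ℝ}
    (hf : ContDiffOn ℝ 1 (fun z : ℝ × ℝ => f z.1 z.2) (Ici (0:ℝ) ×ˢ Icc (0:ℝ) 1))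
    {t x : ℝ} (ht : 0 < t) (hx : x ∈ Icc (0:ℝ) 1) :
    HasDerivAt (fun s => f s x) (stripTimeDeriv f t x) t := by
  have h1 := ((hf.differentiableOn one_ne_zero) (t, x) ⟨ht.le, hx⟩).hasFDerivWithinAt
  have h2 : HasDerivWithinAt (fun s : ℝ => (s, x)) (1, 0) (Ici 0) t :=
    ((hasDerivAt_id t).prodMk (hasDerivAt_const t x)).hasDerivWithinAt
  exact (h1.comp_hasDerivWithinAt t h2 fun s hs => mk_mem_prod hs hx).hasDerivAt (Ici_mem_nhds ht)

lemma timeDeriv_strip {f : ℝ → ℝ → ℝ}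
    (hf : ContDiffOn ℝ 1 (fun z : ℝ × ℝ => f z.1 z.2) (Ici (0:ℝ) ×ˢ Icc (0:ℝ) 1)) :
    TimeDeriv (fun t x => f (max t 0) (clampUnit x))
      (fun t x => stripTimeDeriv f (max t 0) (clampUnit x)) := by
  have hc : Continuous fun z : ℝ × ℝ => (max z.1 0, clampUnit z.2) :=
    (continuous_fst.max continuous_const).prodMk
      (lipschitzWith_clampUnit.continuous.comp continuous_snd)
  have hmem : ∀ z : ℝ × ℝ, (max z.1 0, clampUnit z.2) ∈ Ici (0:ℝ) ×ˢ Icc (0:ℝ) 1 := fun z =>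
    mk_mem_prod (mem_Ici.2 (le_max_right _ _)) (clampUnit_mem _)
  refine ⟨hf.continuousOn.comp_continuous hc hmem, ?_, fun t ht x => ?_⟩
  · have hd := (hf.continuousOn_fderivWithin ((uniqueDiffOn_Ici 0).prod
      (uniqueDiffOn_Icc zero_lt_one)) le_rfl).comp_continuous hc hmem
    exact hd.clm_apply continuous_const
  · rw [max_eq_left ht.le]
    refine (hasDerivAt_stripTimeDeriv hf ht (clampUnit_mem x)).congr_of_eventuallyEq ?_
    filter_upwards [lt_mem_nhds ht] with s hs
    rw [max_eq_left hs.le]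

namespace ClassicalSolutionS'

variable {a q : ℝ → ℝ} {q₀ q₁ : ℝ} (sol : ClassicalSolutionS' a q q₀ q₁)

lemma ut_sub_eq_integral {t x : ℝ} (ht : 0 < t) (hx : x ∈ Icc (0:ℝ) 1) :
    sol.ut t x - sol.ut t 0
      = ∫ y in (0:ℝ)..x, stripTimeDeriv sol.ux (max t 0) (clampUnit y) := by
  have hT := timeDeriv_strip sol.hux_C1
  have h0 : (0:ℝ) ∈ Icc (0:ℝ) 1 := ⟨le_rfl, zero_le_one⟩
  have h1 := hT.hasDerivAt_intervalIntegral x ht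
  have h2 := (sol.hu_t t ht.le x hx).sub (sol.hu_t t ht.le 0 h0)
  refine h2.unique (h1.congr_of_eventuallyEq ?_)
  filter_upwards [lt_mem_nhds ht] with s hs
  refine (intervalIntegral.integral_eq_sub_of_hasDerivAt (fun y hy => ?_)
    ((hT.cont_right s).intervalIntegrable _ _)).symm
  rw [uIcc_of_le hx.1] at hy
  have hy' : y ∈ Icc (0:ℝ) 1 := ⟨hy.1, hy.2.trans hx.2⟩
  rw [max_eq_left hs.le, clampUnit_of_mem hy']
  exact sol.hu_x s hs.le y hy'

lemma stripTimeDeriv_ut {t x : ℝ} (ht : 0 < t) (hx : x ∈ Icc (0:ℝ) 1) :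
    stripTimeDeriv sol.ut t x = sol.utt t x :=
  (hasDerivAt_stripTimeDeriv sol.hut_C1 ht hx).unique (sol.hu_tt t ht.le x hx)

lemma utt_one {t : ℝ} (ht : 0 < t) : sol.utt t 1 = -sol.ux t 1 - q₁ * sol.ut t 1 := by
  rw [sol.hbc1 t ht.le]
  refine (sol.hu_tt t ht.le 1 ⟨zero_le_one, le_rfl⟩).unique
    ((sol.hode1 t ht.le).congr_of_eventuallyEq ?_)
  filter_upwards [lt_mem_nhds ht] with s hs using sol.hbc1 s hs.le

lemma utt_zero {t : ℝ} (ht : 0 < t) : sol.utt t 0 = sol.ux t 0 - q₀ * sol.ut t 0 := by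
  rw [sol.hbc0 t ht.le]
  refine (sol.hu_tt t ht.le 0 ⟨le_rfl, zero_le_one⟩).unique
    ((sol.hode0 t ht.le).congr_of_eventuallyEq ?_)
  filter_upwards [lt_mem_nhds ht] with s hs using sol.hbc0 s hs.le

lemma acDeriv_flux {t : ℝ} (ht : 0 < t) :
    ACDeriv (fun x => a (clampUnit x) * sol.ux (max t 0) (clampUnit x))
      (fun x => stripTimeDeriv sol.ut (max t 0) (clampUnit x)
        + q x * sol.ut (max t 0) (clampUnit x)) := by
  have heq : ∀ x ∈ Icc (0:ℝ) 1,
      a (clampUnit x) * sol.ux (max t 0) (clampUnit x) = a x * sol.ux t x := fun x hx => by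
    rw [clampUnit_of_mem hx, max_eq_left ht.le]
  obtain ⟨K, hK⟩ := sol.haux_lip t ht.le
  have hK' : LipschitzOnWith K
      (fun x => a (clampUnit x) * sol.ux (max t 0) (clampUnit x)) (uIcc (0:ℝ) 1) := by
    rw [uIcc_of_le zero_le_one]
    intro x hx y hy
    beta_reduce
    rw [heq x hx, heq y hy]
    exact hK hx hy
  refine ⟨hK'.absolutelyContinuousOnInterval, ?_⟩
  filter_upwards [ae_unitMeasure_mem_Ioo, ae_unitMeasure_of_Ioo (sol.haux t ht.le),
    ae_unitMeasure_of_Ioo (sol.hPDE t ht.le)] with x hx hd hpde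
  have hx' := Ioo_subset_Icc_self hx
  rw [clampUnit_of_mem hx']
  simp only [max_eq_left ht.le] at heq ⊢
  rw [sol.stripTimeDeriv_ut ht hx',
    show sol.utt t x + q x * sol.ut t x = sol.dAux t x by linarith]
  refine hd.congr_of_eventuallyEq ?_
  filter_upwards [isOpen_Ioo.mem_nhds hx] with y hy using heq y (Ioo_subset_Icc_self hy)

/-- Classical solutions, extended from the half strip, are damped waves. -/
lemma dampedWave (ha : Continuous fun x => a (clampUnit x)) (ha0 : ∀ x, a (clampUnit x) ≠ 0) :
    DampedWave (fun x => a (clampUnit x)) q q₀ q₁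
      (fun t x => sol.ut (max t 0) (clampUnit x))
      (fun t x => stripTimeDeriv sol.ut (max t 0) (clampUnit x))
      (fun t x => a (clampUnit x) * sol.ux (max t 0) (clampUnit x))
      (fun t x => a (clampUnit x) * stripTimeDeriv sol.ux (max t 0) (clampUnit x)) := by
  have hv := timeDeriv_strip sol.hut_C1
  have hp := (timeDeriv_strip sol.hux_C1).space_mul ha
  have m0 : (0:ℝ) ∈ Icc (0:ℝ) 1 := ⟨le_rfl, zero_le_one⟩
  have m1 : (1:ℝ) ∈ Icc (0:ℝ) 1 := ⟨zero_le_one, le_rfl⟩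
  refine ⟨hv, hp, fun t ht => ?_⟩
  refine
    { v_cont := hv.cont_right t
      w_cont := hv.cont'_right t
      p_cont := hp.cont_right t
      s_cont := hp.cont'_right t
      v_deriv := ?_
      p_deriv := sol.acDeriv_flux ht
      bc_one := ?_
      bc_zero := ?_ }
  · have e : (fun x => a (clampUnit x) * stripTimeDeriv sol.ux (max t 0) (clampUnit x)
        / a (clampUnit x)) = fun x => stripTimeDeriv sol.ux (max t 0) (clampUnit x) :=
      funext fun x => mul_div_cancel_left₀ _ (ha0 x)
    rw [e]
    refine .of_primitive (k := sol.ut t 0) ((timeDeriv_strip sol.hux_C1).cont'_right t)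
      fun x hx => ?_
    rw [← sol.ut_sub_eq_integral ht hx, clampUnit_of_mem hx, max_eq_left ht.le]
    ring
  · simp only [clampUnit_of_mem m1, max_eq_left ht.le]
    rw [sol.stripTimeDeriv_ut ht m1, sol.utt_one ht]
    ring
  · simp only [clampUnit_of_mem m0, max_eq_left ht.le]
    rw [sol.stripTimeDeriv_ut ht m0, sol.utt_zero ht]
    ring

lemma weightedEnergy_eq (ha0 : ∀ x, a (clampUnit x) ≠ 0) {t : ℝ} (ht : 0 ≤ t) :
    weightedEnergy (fun x => a (clampUnit x)) (fun x => sol.ut (max t 0) (clampUnit x))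
        (fun x => a (clampUnit x) * sol.ux (max t 0) (clampUnit x))
      = 1 / 2 * ((∫ x in (0:ℝ)..1, (sol.ut t x ^ 2 + a x * sol.ux t x ^ 2))
        + a 1 * sol.η t ^ 2 + a 0 * sol.ζ t ^ 2) := by
  have m0 : (0:ℝ) ∈ Icc (0:ℝ) 1 := ⟨le_rfl, zero_le_one⟩
  have m1 : (1:ℝ) ∈ Icc (0:ℝ) 1 := ⟨zero_le_one, le_rfl⟩
  rw [weightedEnergy, ← integral_unitMeasure]
  simp only [clampUnit_of_mem m1, clampUnit_of_mem m0, max_eq_left ht, sol.hbc1 t ht,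
    sol.hbc0 t ht, ← sq]
  congr 3
  refine integral_congr_ae ?_
  filter_upwards [ae_unitMeasure_mem] with x hx
  have := ha0 x
  rw [clampUnit_of_mem hx] at this ⊢
  field_simp

lemma energyS'_comparison {a_min a_max : ℝ} (h0 : 0 < a_min)
    (ha : ∀ x ∈ Icc (0:ℝ) 1, a_min ≤ a x ∧ a x ≤ a_max) {t : ℝ} (ht : 0 ≤ t) :
    min 1 a_min * energyS' sol t ≤ weightedEnergy (fun x => a (clampUnit x))
        (fun x => sol.ut (max t 0) (clampUnit x))
        (fun x => a (clampUnit x) * sol.ux (max t 0) (clampUnit x)) ∧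
      weightedEnergy (fun x => a (clampUnit x)) (fun x => sol.ut (max t 0) (clampUnit x))
        (fun x => a (clampUnit x) * sol.ux (max t 0) (clampUnit x))
      ≤ max 1 a_max * energyS' sol t := by
  have m0 : (0:ℝ) ∈ Icc (0:ℝ) 1 := ⟨le_rfl, zero_le_one⟩
  have m1 : (1:ℝ) ∈ Icc (0:ℝ) 1 := ⟨zero_le_one, le_rfl⟩
  rw [sol.weightedEnergy_eq (fun x => (h0.trans_le (ha _ (clampUnit_mem x)).1).ne') ht, energyS']
  have hJ : 0 ≤ ∫ x in (0:ℝ)..1, (sol.ut t x ^ 2 + a x * sol.ux t x ^ 2) :=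
    intervalIntegral.integral_nonneg zero_le_one fun x hx =>
      add_nonneg (sq_nonneg _) (mul_nonneg (h0.le.trans (ha x hx).1) (sq_nonneg _))
  have b1 := mul_le_mul_of_nonneg_right (min_le_left 1 a_min) hJ
  have b2 := mul_le_mul_of_nonneg_right ((min_le_right 1 a_min).trans (ha 1 m1).1)
    (sq_nonneg (sol.η t))
  have b3 := mul_le_mul_of_nonneg_right ((min_le_right 1 a_min).trans (ha 0 m0).1)
    (sq_nonneg (sol.ζ t))
  have c1 := mul_le_mul_of_nonneg_right (le_max_left 1 a_max) hJ
  have c2 := mul_le_mul_of_nonneg_right ((ha 1 m1).2.trans (le_max_right 1 a_max))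
    (sq_nonneg (sol.η t))
  have c3 := mul_le_mul_of_nonneg_right ((ha 0 m0).2.trans (le_max_right 1 a_max))
    (sq_nonneg (sol.ζ t))
  constructor <;> linarith

end ClassicalSolutionS'

/-- Exponential decay of the energy for classical solutions of system (S'). -/
theorem exponential_stability_S' (a q : ℝ → ℝ) (a_min a_max c d q_min q_max q₀ q₁ : ℝ)
    (hA1 : AssumptionA1 a a_min a_max) (hA2 : AssumptionA2 q c d q_min q_max)
    (hq₀ : 0 < q₀) (hq₁ : 0 < q₁) :
    ∃ M > (0:ℝ), ∃ ν > (0:ℝ), ∀ sol : ClassicalSolutionS' a q q₀ q₁, ∀ t ∈ Ici (0:ℝ),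
      energyS' sol t ≤ M * energyS' sol 0 * Real.exp (-ν * t) := by
  obtain ⟨⟨K, hK⟩, ha0, -, ha⟩ := hA1
  obtain ⟨hqm, ⟨Q, hQ⟩, hq0, hc, hcd, hd, hq_min, -, hq⟩ := hA2
  have hQ0 : 0 ≤ Q := (abs_nonneg _).trans (hQ 0 ⟨le_rfl, zero_le_one⟩)
  obtain ⟨A', ρ, σ, σ', g, g', C, M⟩ := exists_multipliers hK.comp_clampUnit ha0
    (fun x => (ha _ (clampUnit_mem x)).1) (fun x => (ha _ (clampUnit_mem x)).2) hqm
    (ae_unitMeasure_of_Ioo hq0)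
    (ae_unitMeasure_mem.mono fun x hx => (le_abs_self _).trans (hQ x hx)) hQ0 hc hcd hd hq_min
    (hq.mono fun x hx => hx.1)
  obtain ⟨ν, hν, hdecay⟩ := exists_weightedEnergy_decay M hq₀ hq₁
  have hmin : 0 < min 1 a_min := lt_min one_pos ha0
  have hmax : 0 < max 1 a_max := one_pos.trans_le (le_max_left _ _)
  refine ⟨4 * max 1 a_max / min 1 a_min, by positivity, ν, hν, fun sol t ht => ?_⟩
  have hdec := hdecay _ _ _ _ (sol.dampedWave M.A_cont fun x => (M.A_pos x).ne') t ht
  have h1 := (sol.energyS'_comparison ha0 ha ht).1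
  have h0 := (sol.energyS'_comparison ha0 ha (le_refl (0:ℝ))).2
  have h2 := mul_le_mul_of_nonneg_right h0 (Real.exp_pos (-ν * t)).le
  rw [div_mul_eq_mul_div, div_mul_eq_mul_div, le_div_iff₀ hmin]
  linarith
end
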